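/- Let N ≥ 3, let Σ be a domain (nonempty open connected subset) of the unit sphere S^{N−1} ⊂ ℝ^N, and let R > 0. Let c be a real number with λ₁(Σ) < c ≤ μ(C_Σ). Suppose p ≥ p_Σ and u ∈ L^p_loc(C_Σ^R) is a nonnegative distributional supersolution of −Δu − c|x|^{−2}u ≥ u^p in C_Σ^R, i.e. c|x|^{−2}u ∈ L¹_loc(C_Σ^R) and ∫ u(−Δφ − c|x|^{−2}φ) dx ≥ ∫ u^p φ dx for every nonnegative φ ∈ C_c^∞(C_Σ^R). Then u ≡ 0 almost everywhere in C_Σ^R. -/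

import Mathlib

open MeasureTheory Metric Filter
open scoped Topology ENNReal NNReal RealInnerProductSpace

noncomputable section

/-- `ℝ^N` as a Euclidean space. -/
abbrev Euc (N : ℕ) : Type := EuclideanSpace ℝ (Fin N)

/-- `φ ∈ C_c^∞(Ω)`: smooth functions with compact support contained in `Ω`. -/
def IsTestFun {N : ℕ} (Ω : Set (Euc N)) (φ : Euc N → ℝ) : Prop :=
  ContDiff ℝ (⊤ : ℕ∞) φ ∧ HasCompactSupport φ ∧ tsupport φ ⊆ Ω

/-- The classical Laplacian of `φ` at `x`: the sum of the pure second partial derivatives. -/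
def lap {N : ℕ} (φ : Euc N → ℝ) (x : Euc N) : ℝ :=
  ∑ i : Fin N, iteratedFDeriv ℝ 2 φ x ![EuclideanSpace.single i 1, EuclideanSpace.single i 1]

/-- The best constant `μ(Ω)` in the Hardy inequality on `Ω` with the weight `|x|⁻²`. -/
def hardyConst {N : ℕ} (Ω : Set (Euc N)) : ℝ :=
  sInf {t : ℝ | ∃ φ : Euc N → ℝ, IsTestFun Ω φ ∧ φ ≠ 0 ∧
    t = (∫ x in Ω, ‖gradient φ x‖ ^ 2) / (∫ x in Ω, ‖x‖ ^ (-2 : ℝ) * φ x ^ 2)}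

/-- `Σ` is a domain (nonempty relatively open connected subset) of the unit sphere `S^{N-1}`. -/
def IsSphereDomain (N : ℕ) (S : Set (Euc N)) : Prop :=
  S.Nonempty ∧ S ⊆ sphere (0 : Euc N) 1 ∧
    (∃ U : Set (Euc N), IsOpen U ∧ S = U ∩ sphere (0 : Euc N) 1) ∧ IsConnected S

/-- The open cone `C_Σ = {rσ : r > 0, σ ∈ Σ}` over a subset `S` of the unit sphere. -/
def sphCone {N : ℕ} (S : Set (Euc N)) : Set (Euc N) :=
  {x | ∃ r : ℝ, 0 < r ∧ ∃ σ ∈ S, x = r • σ}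

/-- The cone-like domain `C_Σ^R = C_Σ ∩ B_R(0)`. -/
def coneLike {N : ℕ} (S : Set (Euc N)) (R : ℝ) : Set (Euc N) :=
  sphCone S ∩ ball (0 : Euc N) R

lemma lap_eq_sum {N : ℕ} (f : Euc N → ℝ) (x : Euc N) :
    lap f x = ∑ i : Fin N, fderiv ℝ (fderiv ℝ f) x (EuclideanSpace.single i 1)
      (EuclideanSpace.single i 1) := by
  unfold lap
  refine Finset.sum_congr rfl fun i _ => ?_
  rw [iteratedFDeriv_two_apply]
  simp

lemma lap_congr {N : ℕ} {f g : Euc N → ℝ} {x : Euc N} (h : f =ᶠ[𝓝 x] g) : lap f x = lap g x := by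
  rw [lap_eq_sum, lap_eq_sum, (h.fderiv (𝕜 := ℝ)).fderiv_eq]

lemma fderiv2_apply {N : ℕ} {f : Euc N → ℝ} {x : Euc N} (hf : ContDiffAt ℝ 2 f x) (v w : Euc N) :
    fderiv ℝ (fderiv ℝ f) x v w = fderiv ℝ (fun y => fderiv ℝ f y w) x v := by
  have h : DifferentiableAt ℝ (fderiv ℝ f) x :=
    (hf.fderiv_right (m := 1) (by norm_num)).differentiableAt (by norm_num)
  rw [fderiv_clm_apply h (differentiableAt_const w)]
  simp

lemma sum_inner_single_sq {N : ℕ} (x : Euc N) :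
    ∑ i : Fin N, (inner ℝ x (EuclideanSpace.single i (1:ℝ))) ^ 2 = ‖x‖ ^ 2 := by
  rw [EuclideanSpace.norm_sq_eq]
  refine Finset.sum_congr rfl fun i _ => ?_
  simp [EuclideanSpace.inner_single_right]

lemma sum_inner_single_clm {N : ℕ} (x : Euc N) (L : Euc N →L[ℝ] ℝ) :
    ∑ i : Fin N, (inner ℝ x (EuclideanSpace.single i (1:ℝ))) * L (EuclideanSpace.single i (1:ℝ)) = L x := by
  have hx : x = ∑ i : Fin N, (inner ℝ x (EuclideanSpace.single i (1:ℝ))) • EuclideanSpace.single i (1:ℝ) := by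
    ext j
    simp [EuclideanSpace.inner_single_right, Finset.sum_apply, Pi.single_apply]
  conv_rhs => rw [hx]
  simp only [map_sum, map_smul, smul_eq_mul]

lemma hasFDerivAt_normsq {N : ℕ} (y : Euc N) :
    HasFDerivAt (fun z : Euc N => ‖z‖ ^ 2) ((2:ℝ) • innerSL ℝ y) y := by
  have := (hasStrictFDerivAt_norm_sq y).hasFDerivAt
  refine this.congr_fderiv ?_
  ext v
  simp [two_smul]
  try ring

/-- Laplacian of `F(|x|²) Ψ(x)`. -/
lemma lap_radial_mul {N : ℕ} {F F1 : ℝ → ℝ} {F2 : ℝ} {Ψ : Euc N → ℝ} {x : Euc N}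
    (hF : ∀ᶠ s in 𝓝 (‖x‖ ^ 2), HasDerivAt F (F1 s) s)
    (hF1 : HasDerivAt F1 F2 (‖x‖ ^ 2)) (hΨ : ContDiffAt ℝ 2 Ψ x)
    (hf : ContDiffAt ℝ 2 (fun y => F (‖y‖ ^ 2) * Ψ y) x) :
    lap (fun y => F (‖y‖ ^ 2) * Ψ y) x =
      (4 * ‖x‖ ^ 2 * F2 + 2 * N * F1 (‖x‖ ^ 2)) * Ψ x + 4 * F1 (‖x‖ ^ 2) * fderiv ℝ Ψ x x
        + F (‖x‖ ^ 2) * lap Ψ x := by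
  have hq : Continuous (fun y : Euc N => ‖y‖ ^ 2) := by fun_prop
  have hFy : ∀ᶠ y in 𝓝 x, HasDerivAt F (F1 (‖y‖ ^ 2)) (‖y‖ ^ 2) :=
    hq.continuousAt.eventually hF
  have hΨy : ∀ᶠ y in 𝓝 x, DifferentiableAt ℝ Ψ y := by
    have := hΨ.eventually (by norm_num)
    filter_upwards [this] with y hy
    exact hy.differentiableAt (by norm_num)
  have key : ∀ v : Euc N, fderiv ℝ (fderiv ℝ (fun y => F (‖y‖ ^ 2) * Ψ y)) x v v =
      4 * F2 * (inner ℝ x (v)) ^ 2 * Ψ x + 2 * F1 (‖x‖ ^ 2) * Ψ x * ‖v‖ ^ 2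
        + 4 * F1 (‖x‖ ^ 2) * ((inner ℝ x (v)) * fderiv ℝ Ψ x v)
        + F (‖x‖ ^ 2) * fderiv ℝ (fderiv ℝ Ψ) x v v := by
    intro v
    rw [fderiv2_apply hf, fderiv2_apply hΨ]
    have e1 : (fun y => fderiv ℝ (fun y => F (‖y‖ ^ 2) * Ψ y) y v) =ᶠ[𝓝 x]
        fun y => F (‖y‖ ^ 2) * fderiv ℝ Ψ y v + Ψ y * (F1 (‖y‖ ^ 2) * (2 * (inner ℝ y (v)))) := by
      filter_upwards [hFy, hΨy] with y h1 h2
      have := (h1.comp_hasFDerivAt y (hasFDerivAt_normsq y)).mul h2.hasFDerivAt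
      have h3 : HasFDerivAt (fun y => F (‖y‖ ^ 2) * Ψ y) _ y := this
      rw [h3.fderiv]
      simp
    rw [e1.fderiv_eq]
    have hd : DifferentiableAt ℝ (fun y => fderiv ℝ Ψ y v) x := by
      have : DifferentiableAt ℝ (fderiv ℝ Ψ) x :=
        (hΨ.fderiv_right (m := 1) (by norm_num)).differentiableAt (by norm_num)
      exact this.clm_apply (differentiableAt_const v)
    have h1 := (hFy.self_of_nhds.comp_hasFDerivAt x (hasFDerivAt_normsq x)).mul hd.hasFDerivAt
    have hin : HasFDerivAt (fun y : Euc N => 2 * inner ℝ y v) ((2:ℝ) • innerSL ℝ v) x := by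
      have h0 := ((innerSL ℝ v).hasFDerivAt (x := x)).const_mul (2:ℝ)
      refine h0.congr_of_eventuallyEq (Eventually.of_forall fun y => ?_)
      simp [real_inner_comm]
    have h2 := (hΨy.self_of_nhds.hasFDerivAt).mul
      ((hF1.comp_hasFDerivAt x (hasFDerivAt_normsq x)).mul hin)
    have h3 := h1.add h2
    have h4 := HasFDerivAt.fderiv h3
    have h5 : (fun y => F (‖y‖ ^ 2) * fderiv ℝ Ψ y v + Ψ y * (F1 (‖y‖ ^ 2) * (2 * (inner ℝ y (v))))) =
      ((((F ∘ fun z => ‖z‖ ^ 2) * fun y => (fderiv ℝ Ψ y) v) +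
          Ψ * ((F1 ∘ fun z => ‖z‖ ^ 2) * fun y => 2 * (inner ℝ y (v))))) := by
      ext y; simp
    rw [h5, h4]
    simp [real_inner_self_eq_norm_sq]
    ring
  rw [lap_eq_sum, lap_eq_sum]
  simp_rw [key]
  rw [Finset.sum_add_distrib, Finset.sum_add_distrib, Finset.sum_add_distrib,
    ← Finset.mul_sum, ← Finset.mul_sum, ← Finset.sum_mul, ← Finset.mul_sum, sum_inner_single_sq,
    sum_inner_single_clm, ← Finset.mul_sum]
  simp
  ring

lemma two_le_smooth : (2 : WithTop ℕ∞) ≤ ((⊤ : ℕ∞) : WithTop ℕ∞) := by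
  have : ((2 : ℕ∞) : WithTop ℕ∞) ≤ ((⊤ : ℕ∞) : WithTop ℕ∞) := by exact_mod_cast le_top
  exact this

/-- the primitive used for the mean value kernel -/
def mvJ (s : ℝ) : ℝ := (1/2) * ∫ σ in s..1, expNegInvGlue (1 - σ)

lemma expGlue_smooth : ContDiff ℝ (⊤ : ℕ∞) expNegInvGlue := expNegInvGlue.contDiff

lemma mvJ_hasDerivAt (s : ℝ) : HasDerivAt mvJ (-(1/2) * expNegInvGlue (1 - s)) s := by
  have hc : Continuous (fun σ : ℝ => expNegInvGlue (1 - σ)) :=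
    expGlue_smooth.continuous.comp (by fun_prop)
  have := (intervalIntegral.integral_hasDerivAt_left (hc.intervalIntegrable s 1)
    (hc.stronglyMeasurableAtFilter _ _) hc.continuousAt).const_mul (1/2:ℝ)
  refine this.congr_deriv (by ring)

lemma mvJ_smooth : ContDiff ℝ (⊤ : ℕ∞) mvJ := by
  rw [contDiff_infty_iff_deriv]
  refine ⟨fun s => (mvJ_hasDerivAt s).differentiableAt, ?_⟩
  have : deriv mvJ = fun s => -(1/2) * expNegInvGlue (1 - s) := by
    ext s; exact (mvJ_hasDerivAt s).deriv
  rw [this]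
  exact contDiff_const.mul (expGlue_smooth.comp (contDiff_const.sub contDiff_id))

lemma mvJ_zero {s : ℝ} (hs : 1 ≤ s) : mvJ s = 0 := by
  unfold mvJ
  rw [intervalIntegral.integral_congr (g := fun _ => 0)]
  · simp
  · intro σ hσ
    rw [Set.uIcc_of_ge hs] at hσ
    exact expNegInvGlue.zero_of_nonpos (by linarith [hσ.1])

lemma mvJ_nonneg (s : ℝ) : 0 ≤ mvJ s := by
  rcases le_total 1 s with h | h
  · rw [mvJ_zero h]
  · unfold mvJ
    have := intervalIntegral.integral_nonneg h
      (fun σ _ => expNegInvGlue.nonneg (1 - σ)) (μ := volume)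
    positivity

lemma lap_comp_sub {N : ℕ} (f : Euc N → ℝ) (a x : Euc N) :
    lap (fun z => f (z - a)) x = lap f (x - a) := by
  unfold lap
  simp_rw [iteratedFDeriv_comp_sub]

/-- mean value kernel -/
def mvK {N : ℕ} (x : Euc N) (e : ℝ) (y : Euc N) : ℝ :=
  (e ^ N)⁻¹ * expNegInvGlue (1 - ‖y - x‖ ^ 2 / e ^ 2)

/-- potential of the mean value kernel -/
def mvT {N : ℕ} (x : Euc N) (e : ℝ) (y : Euc N) : ℝ :=
  (e ^ N)⁻¹ * mvJ (‖y - x‖ ^ 2 / e ^ 2)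

lemma mvT_smooth {N : ℕ} (x : Euc N) (e : ℝ) : ContDiff ℝ (⊤ : ℕ∞) (mvT x e) := by
  unfold mvT
  refine contDiff_const.mul (mvJ_smooth.comp ?_)
  exact ((contDiff_id.sub contDiff_const).norm_sq ℝ).div_const _

lemma one_le_of_not_mem {N : ℕ} {x y : Euc N} {e : ℝ} (he : 0 < e) (hy : y ∉ ball x e) :
    1 ≤ ‖y - x‖ ^ 2 / e ^ 2 := by
  rw [mem_ball, dist_eq_norm, not_lt] at hy
  rw [le_div_iff₀ (by positivity), one_mul]
  gcongr

lemma mvT_nonneg {N : ℕ} (x : Euc N) {e : ℝ} (he : 0 < e) (y) : 0 ≤ mvT x e y := by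
  unfold mvT
  have := mvJ_nonneg (‖y - x‖ ^ 2 / e ^ 2)
  positivity

lemma mvK_nonneg {N : ℕ} (x : Euc N) {e : ℝ} (he : 0 < e) (y) : 0 ≤ mvK x e y := by
  unfold mvK
  have := expNegInvGlue.nonneg (1 - ‖y - x‖ ^ 2 / e ^ 2)
  positivity

lemma mvT_support {N : ℕ} (x : Euc N) {e : ℝ} (he : 0 < e) : tsupport (mvT x e) ⊆ closedBall x e := by
  refine closure_minimal ?_ isClosed_closedBall
  intro y hy
  by_contra h
  apply hy
  unfold mvT
  rw [mvJ_zero (one_le_of_not_mem he (fun h' => h (ball_subset_closedBall h'))), mul_zero]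

lemma mvK_zero {N : ℕ} {x : Euc N} {e : ℝ} (he : 0 < e) {y : Euc N} (hy : y ∉ ball x e) :
    mvK x e y = 0 := by
  unfold mvK
  rw [expNegInvGlue.zero_of_nonpos (by linarith [one_le_of_not_mem he hy]), mul_zero]

lemma mvT_test {N : ℕ} (x : Euc N) {e e0 : ℝ} (he : 0 < e) (h : e < e0) :
    IsTestFun (ball x e0) (mvT x e) :=
  ⟨mvT_smooth x e, (isCompact_closedBall x e).of_isClosed_subset (isClosed_tsupport _)
    (mvT_support x he), (mvT_support x he).trans (closedBall_subset_ball h)⟩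

lemma lap_mvT {N : ℕ} (x : Euc N) {e : ℝ} (he : 0 < e) (y : Euc N) :
    lap (mvT x e) y = (e ^ N)⁻¹ * (2 * ‖y - x‖ ^ 2 / e ^ 4 *
      deriv expNegInvGlue (1 - ‖y - x‖ ^ 2 / e ^ 2) - N / e ^ 2 *
        expNegInvGlue (1 - ‖y - x‖ ^ 2 / e ^ 2)) := by
  have h0 : mvT x e = fun z => (fun w : Euc N => mvJ (‖w‖ ^ 2 / e ^ 2) * (e ^ N)⁻¹) (z - x) := by
    ext z; simp [mvT]; ring
  rw [h0, lap_comp_sub (fun w : Euc N => mvJ (‖w‖ ^ 2 / e ^ 2) * (e ^ N)⁻¹) x y]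
  set z := y - x
  rw [lap_radial_mul (F := fun s => mvJ (s / e ^ 2)) (Ψ := fun _ => (e ^ N)⁻¹)
    (F1 := fun s => (-(1/2) * expNegInvGlue (1 - s / e ^ 2)) * (1 / e ^ 2))
    (F2 := (1/2) * deriv expNegInvGlue (1 - ‖z‖ ^ 2 / e ^ 2) * (1 / e ^ 4))]
  · have : lap (fun _ : Euc N => (e ^ N)⁻¹) z = 0 := by
      rw [lap_eq_sum]; simp
    rw [this]
    simp
    field_simp
    ring
  · refine Eventually.of_forall fun s => ?_
    have h1 : HasDerivAt (fun s : ℝ => s / e ^ 2) (1 / e ^ 2) s := (hasDerivAt_id s).div_const _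
    have h2 := HasDerivAt.comp (h₂ := mvJ) s (mvJ_hasDerivAt (s / e ^ 2)) h1
    exact h2
  · have h1 : HasDerivAt (fun s : ℝ => 1 - s / e ^ 2) (-(1 / e ^ 2)) (‖z‖ ^ 2) :=
      ((hasDerivAt_id _).div_const _).const_sub 1
    have h2 : HasDerivAt expNegInvGlue (deriv expNegInvGlue (1 - ‖z‖ ^ 2 / e ^ 2))
        (1 - ‖z‖ ^ 2 / e ^ 2) :=
      (expGlue_smooth.differentiable (by norm_num)).differentiableAt.hasDerivAt
    have h3 := ((h2.comp (‖z‖ ^ 2) h1).const_mul (-(1/2) : ℝ)).mul_const (1 / e ^ 2)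
    refine h3.congr_deriv ?_
    field_simp
  · exact contDiffAt_const
  · have : ContDiff ℝ (⊤ : ℕ∞) (fun y : Euc N => mvJ (‖y‖ ^ 2 / e ^ 2) * (e ^ N)⁻¹) :=
      (mvJ_smooth.comp ((contDiff_id.norm_sq ℝ).div_const _)).mul contDiff_const
    exact (this.of_le two_le_smooth).contDiffAt

lemma mvK_hasDerivAt {N : ℕ} (x : Euc N) {e : ℝ} (he : 0 < e) (y : Euc N) :
    HasDerivAt (fun e => mvK x e y) (e * lap (mvT x e) y) e := by
  rw [lap_mvT x he]
  have h1 : HasDerivAt (fun e : ℝ => (e ^ N)⁻¹) (-(N * e ^ (N - 1)) / (e ^ N) ^ 2) e :=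
    (hasDerivAt_pow N e).inv (by positivity)
  have h2 : HasDerivAt (fun e : ℝ => 1 - ‖y - x‖ ^ 2 / e ^ 2)
      (2 * ‖y - x‖ ^ 2 / e ^ 3) e := by
    have h3 : HasDerivAt (fun e : ℝ => (e ^ 2)⁻¹) (-((2:ℕ) * e ^ (2 - 1)) / (e ^ 2) ^ 2) e :=
      (hasDerivAt_pow 2 e).inv (by positivity)
    refine ((h3.const_mul (‖y - x‖ ^ 2)).const_sub 1).congr_deriv ?_
    field_simp
    norm_num
    ring
  have h4 : HasDerivAt expNegInvGlue (deriv expNegInvGlue (1 - ‖y - x‖ ^ 2 / e ^ 2))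
        (1 - ‖y - x‖ ^ 2 / e ^ 2) :=
      (expGlue_smooth.differentiable (by norm_num)).differentiableAt.hasDerivAt
  refine (h1.mul (h4.comp e h2)).congr_deriv ?_
  rcases N with _ | n
  · simp
    field_simp
  · simp
    field_simp
    ring

lemma lap_zero_of_notMem {N : ℕ} {f : Euc N → ℝ} {x : Euc N} (hx : x ∉ tsupport f) :
    lap f x = 0 := by
  have : f =ᶠ[𝓝 x] fun _ => 0 := notMem_tsupport_iff_eventuallyEq.mp hx
  rw [lap_congr this, lap_eq_sum]
  simp

lemma lap_continuous {N : ℕ} {f : Euc N → ℝ} (hf : ContDiff ℝ 2 f) : Continuous (lap f) := by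
  have h : lap f = fun x => ∑ i : Fin N, fderiv ℝ (fderiv ℝ f) x (EuclideanSpace.single i 1)
      (EuclideanSpace.single i 1) := by
    ext x; exact lap_eq_sum f x
  rw [h]
  have h1 : ContDiff ℝ 1 (fderiv ℝ f) := hf.fderiv_right (by norm_num)
  have h2 : Continuous (fderiv ℝ (fderiv ℝ f)) := h1.continuous_fderiv (by norm_num)
  fun_prop

lemma mvK_continuous {N : ℕ} (x : Euc N) (e : ℝ) : Continuous (mvK x e) := by
  unfold mvK
  have := expGlue_smooth.continuous
  fun_prop

lemma mv_bound {N : ℕ} (x : Euc N) {e : ℝ} (he : 0 < e) :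
    ∃ B : ℝ, ∀ e' ∈ Set.Icc (e/2) (2*e), ∀ y, ‖e' * lap (mvT x e') y‖ ≤ B := by
  have hc : ContinuousOn (fun q : ℝ × Euc N => q.1 * ((q.1 ^ N)⁻¹ * (2 * ‖q.2 - x‖ ^ 2 / q.1 ^ 4 *
      deriv expNegInvGlue (1 - ‖q.2 - x‖ ^ 2 / q.1 ^ 2) - N / q.1 ^ 2 *
        expNegInvGlue (1 - ‖q.2 - x‖ ^ 2 / q.1 ^ 2))))
        (Set.Icc (e/2) (2*e) ×ˢ closedBall x (2*e)) := by
    have h1 := expGlue_smooth.continuous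
    have h2 : Continuous (deriv expNegInvGlue) := expGlue_smooth.continuous_deriv (by norm_num)
    have hpos : ∀ q ∈ (Set.Icc (e/2) (2*e) ×ˢ closedBall x (2*e) : Set (ℝ × Euc N)), q.1 ≠ 0 := by
      rintro ⟨a, b⟩ ⟨h, -⟩
      have := h.1
      simp only at *
      intro h0
      linarith
    have h3 : ContinuousOn (fun q : ℝ × Euc N => 1 - ‖q.2 - x‖ ^ 2 / q.1 ^ 2)
        (Set.Icc (e/2) (2*e) ×ˢ closedBall x (2*e)) := by
      refine continuousOn_const.sub (ContinuousOn.div (by fun_prop) (by fun_prop) ?_)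
      intro q hq
      exact pow_ne_zero _ (hpos q hq)
    refine continuousOn_fst.mul (ContinuousOn.mul (ContinuousOn.inv₀ (by fun_prop) ?_) 
      (ContinuousOn.sub (ContinuousOn.mul (ContinuousOn.div (by fun_prop) (by fun_prop) ?_)
        (h2.comp_continuousOn h3)) (ContinuousOn.mul (ContinuousOn.div (by fun_prop) (by fun_prop) ?_) 
          (h1.comp_continuousOn h3))))
    all_goals intro q hq; exact pow_ne_zero _ (hpos q hq)
  obtain ⟨B, hB⟩ := (isCompact_Icc.prod (isCompact_closedBall x (2*e))).exists_bound_of_continuousOn hc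
  refine ⟨max B 0, fun e' he' y => ?_⟩
  have hpos : 0 < e' := by linarith [he'.1]
  by_cases hy : y ∈ closedBall x (2*e)
  · rw [lap_mvT x hpos]
    exact (hB (e', y) ⟨he', hy⟩).trans (le_max_left _ _)
  · rw [lap_zero_of_notMem (fun h => hy (closedBall_subset_closedBall he'.2 (mvT_support x hpos h)))]
    simp

lemma mv_hasDerivAt {N : ℕ} {w : Euc N → ℝ} (hw : Integrable w) (x : Euc N) {e : ℝ} (he : 0 < e) :
    HasDerivAt (fun e => ∫ y, w y * mvK x e y) (e * ∫ y, w y * lap (mvT x e) y) e := by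
  obtain ⟨B, hB⟩ := mv_bound x he
  have hlc : ∀ e' : ℝ, Continuous (lap (mvT x e')) := fun e' =>
    lap_continuous ((mvT_smooth x e').of_le two_le_smooth)
  have hbd : ∃ C, ∀ y, ‖mvK x e y‖ ≤ C := by
    have hcs : HasCompactSupport (mvK x e) := by
      refine HasCompactSupport.intro (isCompact_closedBall x e) fun y hy => mvK_zero he ?_
      exact fun h => hy (ball_subset_closedBall h)
    exact hcs.exists_bound_of_continuous (mvK_continuous x e)
  obtain ⟨C, hC⟩ := hbd
  have := hasDerivAt_integral_of_dominated_loc_of_deriv_le (μ := volume) 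
    (F := fun e y => w y * mvK x e y) (F' := fun e y => w y * (e * lap (mvT x e) y))
    (bound := fun y => ‖w y‖ * B) (x₀ := e) (s := Set.Icc (e/2) (2*e))
    (Icc_mem_nhds (by linarith) (by linarith))
    (Eventually.of_forall fun e' => hw.aestronglyMeasurable.mul
      (mvK_continuous x e').aestronglyMeasurable)
    (hw.mul_bdd (c := C) (mvK_continuous x e).aestronglyMeasurable (Eventually.of_forall hC))
    (hw.aestronglyMeasurable.mul (continuous_const.mul (hlc e)).aestronglyMeasurable)
    (Eventually.of_forall fun y e' he' => by
      rw [norm_mul]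
      gcongr
      exact hB e' he' y)
    (hw.norm.mul_const B)
    (Eventually.of_forall fun y e' he' =>
      (mvK_hasDerivAt x (by linarith [he'.1]) y).const_mul (w y))
  refine this.2.congr_deriv ?_
  rw [← integral_const_mul]
  congr 1
  ext y
  ring

/-- total mass of the potential -/
def mvc (N : ℕ) : ℝ := ∫ z : Euc N, mvJ (‖z‖ ^ 2)

/-- total mass of the kernel -/
def mvM (N : ℕ) : ℝ := ∫ z : Euc N, expNegInvGlue (1 - ‖z‖ ^ 2)

lemma integral_scaled {N : ℕ} (f : ℝ → ℝ) (x : Euc N) {e : ℝ} (he : 0 < e) :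
    ∫ y : Euc N, (e ^ N)⁻¹ * f (‖y - x‖ ^ 2 / e ^ 2) = ∫ z : Euc N, f (‖z‖ ^ 2) := by
  rw [integral_const_mul]
  have h1 : ∫ y : Euc N, f (‖y - x‖ ^ 2 / e ^ 2) = ∫ y : Euc N, f (‖y‖ ^ 2 / e ^ 2) :=
    integral_sub_right_eq_self (fun y : Euc N => f (‖y‖ ^ 2 / e ^ 2)) x
  rw [h1]
  have h2 := Measure.integral_comp_inv_smul (volume : Measure (Euc N)) (fun z => f (‖z‖ ^ 2)) e
  have h3 : ∀ y : Euc N, f (‖e⁻¹ • y‖ ^ 2) = f (‖y‖ ^ 2 / e ^ 2) := by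
    intro y
    rw [norm_smul, mul_pow, norm_inv, Real.norm_of_nonneg he.le]
    congr 1
    field_simp
  simp_rw [h3] at h2
  rw [h2]
  have : 0 < e ^ N := by positivity
  simp [abs_of_pos he]
  field_simp

lemma mvT_integral {N : ℕ} (x : Euc N) {e : ℝ} (he : 0 < e) : ∫ y, mvT x e y = mvc N :=
  integral_scaled mvJ x he

lemma mvK_integral {N : ℕ} (x : Euc N) {e : ℝ} (he : 0 < e) : ∫ y, mvK x e y = mvM N :=
  integral_scaled (fun s => expNegInvGlue (1 - s)) x he

lemma mvM_pos (N : ℕ) : 0 < mvM N := by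
  unfold mvM
  have hc : Continuous (fun z : Euc N => expNegInvGlue (1 - ‖z‖ ^ 2)) :=
    expGlue_smooth.continuous.comp (by fun_prop)
  have hcs : HasCompactSupport (fun z : Euc N => expNegInvGlue (1 - ‖z‖ ^ 2)) := by
    refine HasCompactSupport.intro (isCompact_closedBall 0 1) fun y hy => ?_
    apply expNegInvGlue.zero_of_nonpos
    rw [mem_closedBall, dist_zero_right, not_le] at hy
    nlinarith
  refine hc.integral_pos_of_hasCompactSupport_nonneg_nonzero hcs
    (fun z => expNegInvGlue.nonneg _) (x := 0) ?_
  simp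

lemma mvc_nonneg (N : ℕ) : 0 ≤ mvc N := integral_nonneg fun _ => mvJ_nonneg _

/-- mean value inequality for distributional (almost) supersolutions -/
lemma mv_ineq {N : ℕ} {w : Euc N → ℝ} (hw : Integrable w) (x : Euc N) {e0 Q : ℝ}
    (h : ∀ φ, IsTestFun (ball x e0) φ → (∀ y, 0 ≤ φ y) → ∫ y, w y * lap φ y ≤ Q * ∫ y, φ y)
    {e1 e2 : ℝ} (h1 : 0 < e1) (h12 : e1 ≤ e2) (h2 : e2 < e0) :
    ∫ y, w y * mvK x e2 y ≤ (∫ y, w y * mvK x e1 y) + Q * mvc N * (e2 ^ 2 - e1 ^ 2) / 2 := by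
  have hd : ∀ e, 0 < e → HasDerivAt (fun e => (∫ y, w y * mvK x e y) - Q * mvc N * e ^ 2 / 2)
      (e * (∫ y, w y * lap (mvT x e) y) - Q * mvc N * e) e := by
    intro e he
    have h3 : HasDerivAt (fun e : ℝ => Q * mvc N * e ^ 2 / 2) (Q * mvc N * e) e := by
      refine (((hasDerivAt_pow 2 e).const_mul (Q * mvc N)).div_const 2).congr_deriv ?_
      norm_num
      ring
    exact (mv_hasDerivAt hw x he).sub h3
  have hanti : AntitoneOn (fun e => (∫ y, w y * mvK x e y) - Q * mvc N * e ^ 2 / 2)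
      (Set.Icc e1 e2) := by
    refine antitoneOn_of_deriv_nonpos (convex_Icc _ _) ?_ ?_ ?_
    · intro e he
      exact (hd e (h1.trans_le he.1)).continuousAt.continuousWithinAt
    · rw [interior_Icc]
      intro e he
      exact (hd e (h1.trans he.1)).differentiableAt.differentiableWithinAt
    · rw [interior_Icc]
      intro e he
      have he0 : 0 < e := h1.trans he.1
      rw [(hd e he0).deriv]
      have := h (mvT x e) (mvT_test x he0 (he.2.trans h2)) (mvT_nonneg x he0)
      rw [mvT_integral x he0] at this
      nlinarith
  have := hanti (Set.left_mem_Icc.2 h12) (Set.right_mem_Icc.2 h12) h12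
  simp only at this
  linarith

lemma expGlue_le_one (x : ℝ) : expNegInvGlue x ≤ 1 := by
  unfold expNegInvGlue
  split_ifs with h
  · exact zero_le_one
  · rw [Real.exp_le_one_iff]
    have : 0 < x⁻¹ := inv_pos.2 (not_le.1 h)
    linarith

lemma mvK_le {N : ℕ} (x : Euc N) {e : ℝ} (he : 0 < e) (y : Euc N) : mvK x e y ≤ (e ^ N)⁻¹ := by
  unfold mvK
  have : 0 < (e ^ N)⁻¹ := by positivity
  nlinarith [expGlue_le_one (1 - ‖y - x‖ ^ 2 / e ^ 2)]

lemma mvK_bdd_mul {N : ℕ} {w : Euc N → ℝ} (hw : Integrable w) (x : Euc N) {e : ℝ} (he : 0 < e) :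
    Integrable (fun y => w y * mvK x e y) := by
  refine hw.mul_bdd (c := (e ^ N)⁻¹) (mvK_continuous x e).aestronglyMeasurable
    (Eventually.of_forall fun y => ?_)
  rw [Real.norm_of_nonneg (mvK_nonneg x he y)]
  exact mvK_le x he y

lemma mvK_integrable {N : ℕ} (x : Euc N) {e : ℝ} (he : 0 < e) : Integrable (mvK x e) := by
  have hcs : HasCompactSupport (mvK x e) := by
    refine HasCompactSupport.intro (isCompact_closedBall x e) fun y hy => mvK_zero he ?_
    exact fun h => hy (ball_subset_closedBall h)
  exact (mvK_continuous x e).integrable_of_hasCompactSupport hcs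

lemma mv_ae {N : ℕ} [NeZero N] {w : Euc N → ℝ} (hw : Integrable w) :
    ∀ᵐ x : Euc N, Tendsto (fun e => ∫ y, w y * mvK x e y) (𝓝[>] 0) (𝓝 (mvM N * w x)) := by
  have hL := (Besicovitch.vitaliFamily (volume : Measure (Euc N))).ae_tendsto_average_norm_sub
    hw.locallyIntegrable
  filter_upwards [hL] with x hx
  have hx' := hx.comp (Besicovitch.tendsto_filterAt volume x)
  rw [tendsto_iff_norm_sub_tendsto_zero]
  have hlim : Tendsto (fun e => volume.real (ball (0 : Euc N) 1) *
      ⨍ y in closedBall x e, ‖w y - w x‖) (𝓝[>] 0) (𝓝 0) := by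
    have := hx'.const_mul (volume.real (ball (0 : Euc N) 1))
    rw [mul_zero] at this
    exact this
  refine squeeze_zero' (Eventually.of_forall fun _ => norm_nonneg _) ?_ hlim
  filter_upwards [self_mem_nhdsWithin] with e he
  have he : 0 < e := he
  have hIK := mvK_integrable x he
  have hIw := mvK_bdd_mul hw x he
  have h1 : (∫ y, w y * mvK x e y) - mvM N * w x = ∫ y, (w y - w x) * mvK x e y := by
    rw [← mvK_integral x he, ← integral_mul_const, ← integral_sub hIw (hIK.mul_const _)]
    congr 1; ext y; ring
  rw [h1]
  have hon : IntegrableOn (fun y => ‖w y - w x‖) (closedBall x e) :=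
    (hw.integrableOn.sub (integrableOn_const (measure_closedBall_lt_top.ne))).norm
  have h2 : ∫ y, (w y - w x) * mvK x e y = ∫ y in closedBall x e, (w y - w x) * mvK x e y := by
    rw [setIntegral_eq_integral_of_forall_compl_eq_zero]
    intro y hy
    rw [mvK_zero he (fun h => hy (ball_subset_closedBall h)), mul_zero]
  rw [h2]
  calc ‖∫ y in closedBall x e, (w y - w x) * mvK x e y‖ 
      ≤ ∫ y in closedBall x e, ‖w y - w x‖ * (e ^ N)⁻¹ := by
        refine norm_integral_le_of_norm_le (hon.mul_const _) (Eventually.of_forall fun y => ?_)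
        rw [norm_mul, Real.norm_of_nonneg (mvK_nonneg x he y)]
        gcongr
        exact mvK_le x he y
    _ = volume.real (ball (0 : Euc N) 1) * ⨍ y in closedBall x e, ‖w y - w x‖ := by
        rw [integral_mul_const, setAverage_eq, smul_eq_mul]
        have hv : volume.real (closedBall x e) = e ^ N * volume.real (ball (0 : Euc N) 1) := by
          rw [Measure.real, Measure.addHaar_closedBall _ _ he.le, ENNReal.toReal_mul, 
            ENNReal.toReal_ofReal (by positivity)]
          simp [Measure.real]
        have hp : 0 < volume.real (ball (0 : Euc N) 1) :=
          ENNReal.toReal_pos (measure_ball_pos _ _ one_pos).ne' measure_ball_lt_top.ne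
        rw [hv]
        field_simp

/-- mean value inequality at almost every point -/
lemma mv_final {N : ℕ} [NeZero N] {w : Euc N → ℝ} (hw : Integrable w) :
    ∀ᵐ x : Euc N, ∀ e0 Q : ℝ,
      (∀ φ, IsTestFun (ball x e0) φ → (∀ y, 0 ≤ φ y) → ∫ y, w y * lap φ y ≤ Q * ∫ y, φ y) →
      ∀ e2, 0 < e2 → e2 < e0 →
      ∫ y, w y * mvK x e2 y ≤ mvM N * w x + Q * mvc N * e2 ^ 2 / 2 := by
  filter_upwards [mv_ae hw] with x hx e0 Q h e2 h0 h2
  have h3 : Tendsto (fun e => (∫ y, w y * mvK x e y) + Q * mvc N * (e2 ^ 2 - e ^ 2) / 2) (𝓝[>] 0)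
      (𝓝 (mvM N * w x + Q * mvc N * (e2 ^ 2 - 0 ^ 2) / 2)) := by
    refine hx.add ?_
    have : Continuous (fun e : ℝ => Q * mvc N * (e2 ^ 2 - e ^ 2) / 2) := by fun_prop
    exact (this.tendsto 0).mono_left nhdsWithin_le_nhds
  have h4 := ge_of_tendsto h3 (b := ∫ y, w y * mvK x e2 y) (by
    filter_upwards [Ioo_mem_nhdsGT h0] with e he
    exact mv_ineq hw x h he.1 he.2.le h2)
  simpa using h4

lemma mvK_pos {N : ℕ} {x : Euc N} {e : ℝ} (he : 0 < e) {y : Euc N} (hy : y ∈ ball x e) :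
    0 < mvK x e y := by
  unfold mvK
  rw [mem_ball, dist_eq_norm] at hy
  have : 0 < 1 - ‖y - x‖ ^ 2 / e ^ 2 := by
    rw [sub_pos, div_lt_one (by positivity)]
    gcongr
  have := expNegInvGlue.pos_of_pos this
  positivity

lemma IsTestFun.mono {N : ℕ} {A B : Set (Euc N)} (h : A ⊆ B) {φ : Euc N → ℝ} (hφ : IsTestFun A φ) :
    IsTestFun B φ := ⟨hφ.1, hφ.2.1, hφ.2.2.trans h⟩

lemma smp_local {N : ℕ} [NeZero N] {Ω : Set (Euc N)} (hΩ : IsOpen Ω)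
    {u : Euc N → ℝ} (hu : LocallyIntegrableOn u Ω) (hu0 : ∀ᵐ x, x ∈ Ω → 0 ≤ u x)
    (h : ∀ φ, IsTestFun Ω φ → (∀ y, 0 ≤ φ y) → ∫ x in Ω, u x * lap φ x ≤ 0) {z : Euc N} (hz : z ∈ Ω) :
    ∃ r, 0 < r ∧ ((∀ᵐ x, x ∈ ball z r → u x = 0) ∨ (∀ᵐ x, x ∈ ball z r → 0 < u x)) := by
  obtain ⟨ρ, hρ, hsub⟩ := Metric.isOpen_iff.1 hΩ z hz
  set r := ρ / 8 with hr
  have hr0 : 0 < r := by positivity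
  have hcb : closedBall z (4 * r) ⊆ Ω := (closedBall_subset_ball (by linarith)).trans hsub
  refine ⟨r, hr0, ?_⟩
  by_cases hzero : ∀ᵐ x, x ∈ ball z r → u x = 0
  · exact Or.inl hzero
  right
  set w := (closedBall z (4 * r)).indicator u with hwdef
  have hw : Integrable w :=
    (hu.integrableOn_compact_subset hcb (isCompact_closedBall _ _)).integrable_indicator
      measurableSet_closedBall
  have hw0 : ∀ᵐ x, 0 ≤ w x := by
    filter_upwards [hu0] with x hx
    by_cases hm : x ∈ closedBall z (4 * r)
    · simp only [hwdef, Set.indicator_of_mem hm]; exact hx (hcb hm)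
    · simp [hwdef, Set.indicator_of_notMem hm]
  filter_upwards [mv_final hw] with x hx hxr
  have hsub1 : ball x (3 * r) ⊆ closedBall z (4 * r) := by
    intro y hy
    rw [mem_ball] at hy hxr
    rw [mem_closedBall]
    linarith [dist_triangle y x z]
  have hxm : x ∈ closedBall z (4 * r) := by
    rw [mem_ball] at hxr
    rw [mem_closedBall]; linarith
  have htest : ∀ φ, IsTestFun (ball x (3 * r)) φ → (∀ y, 0 ≤ φ y) →
      ∫ y, w y * lap φ y ≤ 0 * ∫ y, φ y := by
    intro φ hφ hφ0
    rw [zero_mul]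
    have := h φ (hφ.mono (hsub1.trans hcb)) hφ0
    rwa [setIntegral_eq_integral_of_forall_compl_eq_zero, 
      show (fun x => u x * lap φ x) = fun x => w x * lap φ x from ?_] at this
    · ext y
      by_cases hy : y ∈ tsupport φ
      · simp only [hwdef, Set.indicator_of_mem (hsub1 (hφ.2.2 hy))]
      · simp [lap_zero_of_notMem hy]
    · intro y hy
      rw [lap_zero_of_notMem (fun h' => hy (hcb (hsub1 (hφ.2.2 h')))), mul_zero]
  have key := hx (3 * r) 0 htest (5/2 * r) (by positivity) (by linarith)
  have hwx : w x = u x := by simp only [hwdef, Set.indicator_of_mem hxm]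
  rw [hwx] at key
  have hpos : 0 < ∫ y, w y * mvK x (5/2 * r) y := by
    have hnn : ∀ᵐ y, 0 ≤ w y * mvK x (5/2 * r) y := by
      filter_upwards [hw0] with y hy
      exact mul_nonneg hy (mvK_nonneg x (by positivity) y)
    refine lt_of_le_of_ne (integral_nonneg_of_ae hnn) fun h0 => hzero ?_
    have h1 := (integral_eq_zero_iff_of_nonneg_ae hnn (mvK_bdd_mul hw x (by positivity))).1 h0.symm
    filter_upwards [h1] with y hy hyr
    have hyx : y ∈ ball x (5/2 * r) := by
      rw [mem_ball] at *
      rw [dist_comm] at hxr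
      linarith [dist_triangle y z x]
    have hym : y ∈ closedBall z (4 * r) := by
      rw [mem_ball] at hyr
      rw [mem_closedBall]; linarith
    have h2 := (mul_eq_zero.1 hy).resolve_right (mvK_pos (by positivity) hyx).ne'
    simpa only [hwdef, Set.indicator_of_mem hym] using h2
  have hM := mvM_pos N
  have : 0 < mvM N * u x := by linarith
  exact pos_of_mul_pos_right this hM.le

lemma ae_of_local {N : ℕ} {Ω : Set (Euc N)} {P : Euc N → Prop}
    (h : ∀ z ∈ Ω, ∃ r, 0 < r ∧ ∀ᵐ x, x ∈ ball z r → P x) : ∀ᵐ x, x ∈ Ω → P x := by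
  rw [ae_iff]
  refine measure_null_of_locally_null _ ?_
  intro z hz
  simp only [Set.mem_ofPred_eq, Classical.not_imp] at hz
  obtain ⟨r, hr, h1⟩ := h z hz.1
  refine ⟨ball z r ∩ {x | ¬ (x ∈ Ω → P x)}, ?_, ?_⟩
  · exact inter_mem (mem_nhdsWithin_of_mem_nhds (ball_mem_nhds z hr)) self_mem_nhdsWithin
  · rw [ae_iff] at h1
    refine measure_mono_null ?_ h1
    rintro x ⟨hx, hx2⟩
    simp only [Set.mem_ofPred_eq, Classical.not_imp] at hx2 ⊢
    exact ⟨hx, hx2.2⟩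

lemma smp {N : ℕ} [NeZero N] {Ω : Set (Euc N)} (hΩ : IsOpen Ω) (hconn : IsPreconnected Ω)
    {u : Euc N → ℝ} (hu : LocallyIntegrableOn u Ω) (hu0 : ∀ᵐ x, x ∈ Ω → 0 ≤ u x)
    (h : ∀ φ, IsTestFun Ω φ → (∀ y, 0 ≤ φ y) → ∫ x in Ω, u x * lap φ x ≤ 0) :
    (∀ᵐ x, x ∈ Ω → u x = 0) ∨ (∀ᵐ x, x ∈ Ω → 0 < u x) := by
  have hopen : ∀ P : Euc N → Prop, IsOpen {z | ∃ r, 0 < r ∧ ∀ᵐ x, x ∈ ball z r → P x} := by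
    intro P
    rw [Metric.isOpen_iff]
    rintro z ⟨r, hr, hP⟩
    refine ⟨r / 2, by positivity, ?_⟩
    intro y hy
    refine ⟨r / 2, by positivity, ?_⟩
    filter_upwards [hP] with x hx hxy
    apply hx
    rw [mem_ball] at *
    linarith [dist_triangle x y z]
  have hdisj : Disjoint {z | ∃ r, 0 < r ∧ ∀ᵐ x, x ∈ ball z r → u x = 0}
      {z | ∃ r, 0 < r ∧ ∀ᵐ x, x ∈ ball z r → 0 < u x} := by
    rw [Set.disjoint_left]
    rintro z ⟨r, hr, h1⟩ ⟨s, hs, h2⟩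
    have h3 : ∀ᵐ x, x ∉ ball z (min r s) := by
      filter_upwards [h1, h2] with x hx1 hx2 hm
      have a := hx1 (ball_subset_ball (min_le_left _ _) hm)
      have b := hx2 (ball_subset_ball (min_le_right _ _) hm)
      linarith
    have h4 : volume (ball z (min r s)) = 0 := by
      rw [ae_iff] at h3
      simp only [not_not] at h3
      exact h3
    exact (measure_ball_pos volume z (lt_min hr hs)).ne' h4
  have hcov : Ω ⊆ {z | ∃ r, 0 < r ∧ ∀ᵐ x, x ∈ ball z r → u x = 0} ∪
      {z | ∃ r, 0 < r ∧ ∀ᵐ x, x ∈ ball z r → 0 < u x} := by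
    intro z hz
    obtain ⟨r, hr, h1 | h1⟩ := smp_local hΩ hu hu0 h hz
    · exact Or.inl ⟨r, hr, h1⟩
    · exact Or.inr ⟨r, hr, h1⟩
  rcases hconn.subset_or_subset (hopen _) (hopen _) hdisj hcov with h1 | h1
  · exact Or.inl (ae_of_local fun z hz => h1 hz)
  · exact Or.inr (ae_of_local fun z hz => h1 hz)

section geometry
variable {N : ℕ} {S : Set (Euc N)}

lemma sphCone_smul {t : ℝ} (ht : 0 < t) {x : Euc N} (hx : x ∈ sphCone S) : t • x ∈ sphCone S := by
  obtain ⟨r, hr, σ, hσ, rfl⟩ := hx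
  exact ⟨t * r, by positivity, σ, hσ, by rw [smul_smul]⟩

lemma zero_notMem_sphCone (hS : IsSphereDomain N S) : (0 : Euc N) ∉ sphCone S := by
  rintro ⟨r, hr, σ, hσ, h⟩
  have h1 : ‖σ‖ = 1 := by simpa using hS.2.1 hσ
  rcases smul_eq_zero.1 h.symm with h2 | h2
  · linarith
  · rw [h2, norm_zero] at h1; norm_num at h1

lemma mem_sphCone_iff (hS : IsSphereDomain N S) {x : Euc N} :
    x ∈ sphCone S ↔ x ≠ 0 ∧ ‖x‖⁻¹ • x ∈ S := by
  constructor
  · intro hx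
    refine ⟨fun h => zero_notMem_sphCone hS (h ▸ hx), ?_⟩
    obtain ⟨r, hr, σ, hσ, rfl⟩ := hx
    have h1 : ‖σ‖ = 1 := by simpa using hS.2.1 hσ
    rw [norm_smul, h1, Real.norm_of_nonneg hr.le, mul_one, smul_smul, inv_mul_cancel₀ hr.ne',
      one_smul]
    exact hσ
  · rintro ⟨h0, h1⟩
    have : 0 < ‖x‖ := norm_pos_iff.2 h0
    exact ⟨‖x‖, this, _, h1, by rw [smul_smul, mul_inv_cancel₀ this.ne', one_smul]⟩

lemma isOpen_sphCone (hS : IsSphereDomain N S) : IsOpen (sphCone S) := by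
  obtain ⟨U, hU, hSU⟩ := hS.2.2.1
  have h : sphCone S = {x : Euc N | x ≠ 0} ∩ (fun x : Euc N => ‖x‖⁻¹ • x) ⁻¹' U := by
    ext x
    rw [mem_sphCone_iff hS]
    constructor
    · rintro ⟨h0, h1⟩
      rw [hSU] at h1
      exact ⟨h0, h1.1⟩
    · rintro ⟨h0, h1⟩
      refine ⟨h0, ?_⟩
      rw [hSU]
      refine ⟨h1, ?_⟩
      have : 0 < ‖x‖ := norm_pos_iff.2 h0
      simp [norm_smul, this.ne']
  rw [h]
  refine ContinuousOn.isOpen_inter_preimage ?_ isOpen_ne hU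
  refine ContinuousOn.smul (ContinuousOn.inv₀ continuous_norm.continuousOn ?_) continuousOn_id
  intro x hx
  exact norm_ne_zero_iff.2 hx

lemma isOpen_coneLike (hS : IsSphereDomain N S) (R : ℝ) : IsOpen (coneLike S R) :=
  (isOpen_sphCone hS).inter isOpen_ball

lemma isPreconnected_coneLike (hS : IsSphereDomain N S) (R : ℝ) :
    IsPreconnected (coneLike S R) := by
  have h : coneLike S R = (fun q : ℝ × Euc N => q.1 • q.2) '' (Set.Ioo 0 R ×ˢ S) := by
    ext x
    constructor
    · rintro ⟨⟨r, hr, σ, hσ, rfl⟩, h2⟩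
      have h1 : ‖σ‖ = 1 := by simpa using hS.2.1 hσ
      rw [mem_ball, dist_zero_right, norm_smul, h1, Real.norm_of_nonneg hr.le, mul_one] at h2
      exact ⟨(r, σ), ⟨⟨hr, h2⟩, hσ⟩, rfl⟩
    · rintro ⟨⟨r, σ⟩, ⟨⟨hr, h2⟩, hσ⟩, rfl⟩
      have h1 : ‖σ‖ = 1 := by simpa using hS.2.1 hσ
      refine ⟨⟨r, hr, σ, hσ, rfl⟩, ?_⟩
      simp only [mem_ball, dist_zero_right, norm_smul, h1, Real.norm_of_nonneg hr.le, mul_one]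
      exact h2
  rw [h]
  exact (isPreconnected_Ioo.prod hS.2.2.2.isPreconnected).image _ (by fun_prop)

lemma sphCone_nonempty (hS : IsSphereDomain N S) : (sphCone S).Nonempty := by
  obtain ⟨σ, hσ⟩ := hS.1
  exact ⟨σ, 1, one_pos, σ, hσ, by simp⟩

end geometry

lemma contDiff_of_tsupp {E F : Type*} [NormedAddCommGroup E] [NormedSpace ℝ E]
    [NormedAddCommGroup F] [NormedSpace ℝ F] {f : E → F} {n : WithTop ℕ∞}
    (h : ∀ x ∈ tsupport f, ContDiffAt ℝ n f x) : ContDiff ℝ n f := by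
  rw [contDiff_iff_contDiffAt]
  intro x
  by_cases hx : x ∈ tsupport f
  · exact h x hx
  · exact contDiffAt_const.congr_of_eventuallyEq (notMem_tsupport_iff_eventuallyEq.mp hx)

lemma tsupport_mul_subset {E : Type*} [TopologicalSpace E] (f g : E → ℝ) :
    tsupport (fun x => f x * g x) ⊆ tsupport g := by
  apply closure_mono
  intro x hx h
  exact hx (by simp [h])

/-- weight -/
lemma rpow_neg_two {N : ℕ} (x : Euc N) : ‖x‖ ^ (-2 : ℝ) = (‖x‖ ^ 2)⁻¹ := by
  rw [Real.rpow_neg (norm_nonneg _)]; norm_cast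

lemma contDiffAt_weight {N : ℕ} {x : Euc N} (hx : x ≠ 0) {n : WithTop ℕ∞} :
    ContDiffAt ℝ n (fun x : Euc N => (‖x‖ ^ 2)⁻¹) x := by
  refine ContDiffAt.inv (contDiff_id.norm_sq ℝ).contDiffAt ?_
  simpa using hx

lemma contDiff_weight_mul {N : ℕ} {φ : Euc N → ℝ} {n : WithTop ℕ∞} (hφ : ContDiff ℝ n φ)
    (h0 : (0 : Euc N) ∉ tsupport φ) : ContDiff ℝ n (fun x => (‖x‖ ^ 2)⁻¹ * φ x) := by
  apply contDiff_of_tsupp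
  intro x hx
  have hx1 : x ∈ tsupport φ := tsupport_mul_subset _ _ hx
  have hx0 : x ≠ 0 := fun h => h0 (h ▸ hx1)
  exact (contDiffAt_weight hx0).mul hφ.contDiffAt

lemma div_x {N : ℕ} {f : Euc N → ℝ} (hf : ContDiff ℝ 1 f) (hc : HasCompactSupport f) :
    ∫ x, fderiv ℝ f x x = -(N * ∫ x, f x) := by
  have hcf : Continuous (fderiv ℝ f) := hf.continuous_fderiv (by norm_num)
  have hi : ∀ i : Fin N, ∫ x, (inner ℝ x (EuclideanSpace.single i (1:ℝ))) *
      fderiv ℝ f x (EuclideanSpace.single i (1:ℝ)) = - ∫ x, f x := by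
    intro i
    set v : Euc N := EuclideanSpace.single i (1:ℝ)
    have hfd : ∀ x : Euc N, fderiv ℝ (fun x : Euc N => inner ℝ x v) x v = 1 := by
      intro x
      have h1 : HasFDerivAt (fun y : Euc N => inner ℝ y v) (innerSL ℝ v) x := by
        refine (innerSL ℝ v).hasFDerivAt.congr_of_eventuallyEq (Eventually.of_forall fun y => ?_)
        simp [real_inner_comm]
      rw [h1.fderiv]
      simp [v]
    have hcs : HasCompactSupport (fun x => fderiv ℝ f x v) := (hc.fderiv_apply ℝ v)
    rw [integral_mul_fderiv_eq_neg_fderiv_mul_of_integrable]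
    · simp_rw [hfd, one_mul]
    · simp_rw [hfd, one_mul]
      exact hf.continuous.integrable_of_hasCompactSupport hc
    · exact Continuous.integrable_of_hasCompactSupport (by fun_prop) hcs.mul_left
    · exact Continuous.integrable_of_hasCompactSupport (by have := hf.continuous; fun_prop) hc.mul_left
    · intro x _; exact (differentiableAt_id).inner ℝ (differentiableAt_const v)
    · intro x _; exact hf.differentiable (by norm_num) x
  have h1 : ∀ x : Euc N, fderiv ℝ f x x = ∑ i : Fin N, (inner ℝ x (EuclideanSpace.single i (1:ℝ))) *
      fderiv ℝ f x (EuclideanSpace.single i (1:ℝ)) := fun x => (sum_inner_single_clm x _).symm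
  simp_rw [h1]
  rw [integral_finsetSum]
  · simp_rw [hi]; simp
  · intro i _
    exact Continuous.integrable_of_hasCompactSupport (by fun_prop) (hc.fderiv_apply ℝ _).mul_left

lemma norm_gradient {N : ℕ} (f : Euc N → ℝ) (x : Euc N) : ‖gradient f x‖ = ‖fderiv ℝ f x‖ := by
  unfold gradient; simp

lemma gradient_continuous {N : ℕ} {f : Euc N → ℝ} (hf : ContDiff ℝ 1 f) :
    Continuous (gradient f) := by
  have hcf : Continuous (fderiv ℝ f) := hf.continuous_fderiv (by norm_num)
  unfold gradient
  exact (LinearIsometryEquiv.continuous _).comp hcf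

lemma gradient_zero_of_notMem {N : ℕ} {f : Euc N → ℝ} {x : Euc N} (hx : x ∉ tsupport f) :
    gradient f x = 0 := by
  have : f =ᶠ[𝓝 x] fun _ => 0 := notMem_tsupport_iff_eventuallyEq.mp hx
  rw [this.gradient_eq]; simp

lemma gradient_sq_integrable {N : ℕ} {f : Euc N → ℝ} (hf : ContDiff ℝ 1 f)
    (hc : HasCompactSupport f) : Integrable (fun x => ‖gradient f x‖ ^ 2) := by
  refine Continuous.integrable_of_hasCompactSupport (by have := gradient_continuous hf; fun_prop) ?_
  refine HasCompactSupport.intro hc fun x hx => ?_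
  rw [gradient_zero_of_notMem hx]; simp

lemma weight_integrable {N : ℕ} {φ : Euc N → ℝ} (hφ : Continuous φ) (hc : HasCompactSupport φ)
    (h0 : (0 : Euc N) ∉ tsupport φ) : Integrable (fun x => (‖x‖ ^ 2)⁻¹ * φ x) :=
  (contDiff_weight_mul (n := 0) (contDiff_zero.2 hφ) h0).continuous.integrable_of_hasCompactSupport
    hc.mul_left

lemma hardy_basic {N : ℕ} {φ : Euc N → ℝ} (hφ : ContDiff ℝ 1 φ) (hc : HasCompactSupport φ)
    (h0 : (0 : Euc N) ∉ tsupport φ) :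
    (((N:ℝ) - 2) / 2) ^ 2 * ∫ x, (‖x‖ ^ 2)⁻¹ * φ x ^ 2 ≤ ∫ x, ‖gradient φ x‖ ^ 2 := by
  set γ := ((N:ℝ) - 2) / 2 with hγ
  have hsq : ContDiff ℝ 1 (fun x => φ x ^ 2) := hφ.pow 2
  have hts : tsupport (fun x => φ x ^ 2) ⊆ tsupport φ := by
    apply closure_mono
    intro x hx h
    exact hx (by simp [h])
  have hcs : HasCompactSupport (fun x => φ x ^ 2) :=
    hc.of_isClosed_subset (isClosed_tsupport _) hts
  have h0s : (0 : Euc N) ∉ tsupport (fun x => φ x ^ 2) := fun h => h0 (hts h)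
  have hdiv := div_x (contDiff_weight_mul hsq h0s) hcs.mul_left
  have hpt : ∀ x, fderiv ℝ (fun x => (‖x‖ ^ 2)⁻¹ * φ x ^ 2) x x =
      2 * ((‖x‖ ^ 2)⁻¹ * (φ x * fderiv ℝ φ x x)) - 2 * ((‖x‖ ^ 2)⁻¹ * φ x ^ 2) := by
    intro x
    rcases eq_or_ne x 0 with rfl | hx
    · simp
    have hn : ‖x‖ ^ 2 ≠ 0 := by simpa using hx
    have h1 := (hasDerivAt_inv hn).comp_hasFDerivAt x (hasFDerivAt_normsq x)
    have h2 := h1.mul ((hφ.differentiable (by norm_num) x).hasFDerivAt.pow 2)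
    have h3 : HasFDerivAt (fun x => (‖x‖ ^ 2)⁻¹ * φ x ^ 2) _ x := h2
    rw [h3.fderiv]
    simp
    field_simp
    ring
  have hI1 : Integrable (fun x => (‖x‖ ^ 2)⁻¹ * φ x ^ 2) := weight_integrable hsq.continuous hcs h0s
  have hI2 : Integrable (fun x => (‖x‖ ^ 2)⁻¹ * (φ x * fderiv ℝ φ x x)) := by
    have hcf : Continuous (fderiv ℝ φ) := hφ.continuous_fderiv (by norm_num)
    have hsub : tsupport (fun x => φ x * fderiv ℝ φ x x) ⊆ tsupport φ := by
      apply closure_mono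
      intro x hx h
      exact hx (by simp [h])
    refine weight_integrable (by have := hφ.continuous; fun_prop)
      (hc.of_isClosed_subset (isClosed_tsupport _) hsub) (fun h => h0 (hsub h))
  simp_rw [hpt] at hdiv
  rw [integral_sub (hI2.const_mul 2) (hI1.const_mul 2), integral_const_mul, integral_const_mul] at hdiv
  have hIg := gradient_sq_integrable hφ hc
  have hnn : 0 ≤ ∫ x, (‖gradient φ x‖ ^ 2 + 2 * γ * ((‖x‖ ^ 2)⁻¹ * (φ x * fderiv ℝ φ x x))
      + γ ^ 2 * ((‖x‖ ^ 2)⁻¹ * φ x ^ 2)) := by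
    refine integral_nonneg fun x => ?_
    simp only [Pi.zero_apply]
    rcases eq_or_ne x 0 with rfl | hx
    · simp
    have hn : ‖x‖ ^ 2 ≠ 0 := by simpa using hx
    have := sq_nonneg ‖gradient φ x + (γ * φ x * (‖x‖ ^ 2)⁻¹) • x‖
    rw [norm_add_sq_real, inner_smul_right, inner_gradient_left, norm_smul, mul_pow,
      Real.norm_eq_abs, sq_abs] at this
    refine this.trans_eq ?_
    field_simp
  have hI12 : Integrable (fun x => ‖gradient φ x‖ ^ 2 +
      2 * γ * ((‖x‖ ^ 2)⁻¹ * (φ x * fderiv ℝ φ x x))) := hIg.add (hI2.const_mul _)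
  rw [integral_add hI12 (hI1.const_mul _), integral_add hIg (hI2.const_mul _), integral_const_mul, integral_const_mul] at hnn
  have hN : (N:ℝ) = 2 * γ + 2 := by rw [hγ]; ring
  rw [hN] at hdiv
  nlinarith

lemma hardy_int_pos {N : ℕ} {φ : Euc N → ℝ} (hφ : Continuous φ) (hc : HasCompactSupport φ)
    (h0 : (0 : Euc N) ∉ tsupport φ) (hne : φ ≠ 0) : 0 < ∫ x, (‖x‖ ^ 2)⁻¹ * φ x ^ 2 := by
  have hts : tsupport (fun x => φ x ^ 2) ⊆ tsupport φ := by
    apply closure_mono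
    intro x hx h
    exact hx (by simp [h])
  have hcs : HasCompactSupport (fun x => φ x ^ 2) :=
    hc.of_isClosed_subset (isClosed_tsupport _) hts
  have h0s : (0 : Euc N) ∉ tsupport (fun x => φ x ^ 2) := fun h => h0 (hts h)
  obtain ⟨x, hx⟩ := Function.ne_iff.1 hne
  have hx0 : x ≠ 0 := by
    rintro rfl
    exact h0 (subset_tsupport _ hx)
  have hcont := (contDiff_weight_mul (n := 0) (contDiff_zero.2 (hφ.pow 2)) h0s).continuous
  refine hcont.integral_pos_of_hasCompactSupport_nonneg_nonzero hcs.mul_left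
    (fun z => by positivity) (x := x) ?_
  have : ‖x‖ ≠ 0 := by simpa using hx0
  have hx' : φ x ≠ 0 := hx
  positivity

section hardy
variable {N : ℕ} {C : Set (Euc N)}

lemma hardy_set_integrals (h0 : (0 : Euc N) ∉ C) {φ : Euc N → ℝ} (hφ : IsTestFun C φ) :
    (∫ x in C, ‖gradient φ x‖ ^ 2) = ∫ x, ‖gradient φ x‖ ^ 2 ∧
    (∫ x in C, ‖x‖ ^ (-2 : ℝ) * φ x ^ 2) = ∫ x, (‖x‖ ^ 2)⁻¹ * φ x ^ 2 := by
  constructor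
  · apply setIntegral_eq_integral_of_forall_compl_eq_zero
    intro x hx
    rw [gradient_zero_of_notMem (fun h => hx (hφ.2.2 h))]; simp
  · simp_rw [rpow_neg_two]
    apply setIntegral_eq_integral_of_forall_compl_eq_zero
    intro x hx
    rw [image_eq_zero_of_notMem_tsupport (fun h => hx (hφ.2.2 h))]; simp

lemma hardy_set_nonempty (hC : IsOpen C) (hne : C.Nonempty) :
    ∃ φ : Euc N → ℝ, IsTestFun C φ ∧ φ ≠ 0 := by
  obtain ⟨x, hx⟩ := hne
  obtain ⟨f, h1, h2, h3, h4, h5⟩ := exists_contDiff_tsupport_subset (n := ⊤) (hC.mem_nhds hx)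
  refine ⟨f, ⟨h3, h2, h1⟩, fun h => ?_⟩
  rw [h] at h5; simp at h5

lemma hardyConst_ge (hC : IsOpen C) (hne : C.Nonempty) (h0 : (0 : Euc N) ∉ C) :
    (((N:ℝ) - 2) / 2) ^ 2 ≤ hardyConst C := by
  obtain ⟨φ, hφ, hφ0⟩ := hardy_set_nonempty hC hne
  refine le_csInf ⟨_, φ, hφ, hφ0, rfl⟩ ?_
  rintro t ⟨φ, hφ, hφ0, rfl⟩
  rw [(hardy_set_integrals h0 hφ).1, (hardy_set_integrals h0 hφ).2]
  have h0' : (0 : Euc N) ∉ tsupport φ := fun h => h0 (hφ.2.2 h)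
  rw [le_div_iff₀ (hardy_int_pos hφ.1.continuous hφ.2.1 h0' hφ0)]
  exact hardy_basic (hφ.1.of_le (by exact_mod_cast le_top)) hφ.2.1 h0'

lemma exists_near_hardy (hC : IsOpen C) (hne : C.Nonempty) (h0 : (0 : Euc N) ∉ C) {M : ℝ}
    (hM : hardyConst C < M) : ∃ φ : Euc N → ℝ, IsTestFun C φ ∧
      ∫ x, ‖gradient φ x‖ ^ 2 < M * ∫ x, (‖x‖ ^ 2)⁻¹ * φ x ^ 2 := by
  obtain ⟨φ, hφ, hφ0⟩ := hardy_set_nonempty hC hne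
  unfold hardyConst at hM
  obtain ⟨t, ht1, ht⟩ := exists_lt_of_csInf_lt (by exact ⟨_, φ, hφ, hφ0, rfl⟩) hM
  obtain ⟨φ, hφ, hφ0, rfl⟩ := ht1
  refine ⟨φ, hφ, ?_⟩
  rw [(hardy_set_integrals h0 hφ).1, (hardy_set_integrals h0 hφ).2] at ht
  have h0' : (0 : Euc N) ∉ tsupport φ := fun h => h0 (hφ.2.2 h)
  rwa [div_lt_iff₀ (hardy_int_pos hφ.1.continuous hφ.2.1 h0' hφ0)] at ht

end hardy

/-- smoothed positive part -/
def jpos (τ s : ℝ) : ℝ := s * expNegInvGlue (s / τ)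

lemma jpos_smooth (τ : ℝ) : ContDiff ℝ (⊤ : ℕ∞) (jpos τ) :=
  contDiff_id.mul (expGlue_smooth.comp (contDiff_id.div_const τ))

lemma jpos_of_nonpos {τ s : ℝ} (hτ : 0 < τ) (hs : s ≤ 0) : jpos τ s = 0 := by
  unfold jpos
  rw [expNegInvGlue.zero_of_nonpos (div_nonpos_of_nonpos_of_nonneg hs hτ.le), mul_zero]

lemma jpos_of_pos {τ s : ℝ} (hτ : 0 < τ) (hs : 0 < s) : jpos τ s = s * Real.exp (-(τ / s)) := by
  unfold jpos expNegInvGlue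
  rw [if_neg (not_le.2 (by positivity)), inv_div]

lemma jpos_nonneg {τ : ℝ} (hτ : 0 < τ) (s : ℝ) : 0 ≤ jpos τ s := by
  rcases le_or_gt s 0 with h | h
  · rw [jpos_of_nonpos hτ h]
  · rw [jpos_of_pos hτ h]; positivity

lemma jpos_le {τ s : ℝ} (hs : 0 ≤ s) : jpos τ s ≤ s := by
  unfold jpos
  nlinarith [expGlue_le_one (s / τ)]

lemma jpos_ge {τ s : ℝ} (hτ : 0 < τ) (hs : 0 < s) : s - τ ≤ jpos τ s := by
  rw [jpos_of_pos hτ hs]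
  have := Real.add_one_le_exp (-(τ / s))
  have h2 : s * (-(τ / s) + 1) = s - τ := by field_simp; ring
  nlinarith

lemma jpos_deriv {τ : ℝ} (hτ : 0 < τ) (s : ℝ) : |deriv (jpos τ) s| ≤ 1 := by
  have hc : Continuous (deriv (jpos τ)) := (jpos_smooth τ).continuous_deriv (by norm_num)
  have hcl : IsClosed {s : ℝ | |deriv (jpos τ) s| ≤ 1} := isClosed_le (by fun_prop) continuous_const
  have hd : Dense ({0}ᶜ : Set ℝ) := dense_compl_singleton 0
  have hsub : ({0}ᶜ : Set ℝ) ⊆ {s : ℝ | |deriv (jpos τ) s| ≤ 1} := by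
    intro s hs
    change |deriv (jpos τ) s| ≤ 1
    rcases lt_or_gt_of_ne (show s ≠ 0 from hs) with h | h
    · have : jpos τ =ᶠ[𝓝 s] fun _ => 0 := by
        filter_upwards [eventually_lt_nhds h] with y hy
        exact jpos_of_nonpos hτ hy.le
      rw [this.deriv_eq]; simp
    · have : jpos τ =ᶠ[𝓝 s] fun y => y * Real.exp (-(τ / y)) := by
        filter_upwards [eventually_gt_nhds h] with y hy
        exact jpos_of_pos hτ hy
      rw [this.deriv_eq]
      have h1 : HasDerivAt (fun y : ℝ => -(τ / y)) (τ / s ^ 2) s := by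
        refine (((hasDerivAt_inv h.ne').const_mul τ).neg).congr_deriv ?_
        field_simp
      have h2 := (hasDerivAt_id s).mul h1.exp
      have h3 : HasDerivAt (fun y : ℝ => y * Real.exp (-(τ / y))) _ s := h2
      rw [h3.deriv]
      have h4 : 1 * Real.exp (-(τ / s)) + id s * (Real.exp (-(τ / s)) * (τ / s ^ 2)) =
        Real.exp (-(τ / s)) * (τ / s + 1) := by
        simp only [id]; field_simp
        ring
      rw [h4, abs_of_nonneg (by positivity)]
      have := Real.add_one_le_exp (τ / s)
      calc Real.exp (-(τ / s)) * (τ / s + 1) ≤ Real.exp (-(τ / s)) * Real.exp (τ / s) := by gcongr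
        _ = 1 := by rw [← Real.exp_add]; simp
  exact hcl.closure_subset_iff.2 hsub (hd s)

/-- admissible functions for the variational problem -/
def Adm {N : ℕ} (K : Set (Euc N)) (φ : Euc N → ℝ) : Prop :=
  ContDiff ℝ 1 φ ∧ (∀ x, 0 ≤ φ x) ∧ (∀ x, φ x ≤ 1) ∧ ∀ x, x ∉ K → φ x = 0

/-- quadratic form -/
def Qf {N : ℕ} (M : ℝ) (φ : Euc N → ℝ) : ℝ :=
  (∫ x, ‖gradient φ x‖ ^ 2) - M * ∫ x, (‖x‖ ^ 2)⁻¹ * φ x ^ 2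

section
variable {N : ℕ} {K : Set (Euc N)}

lemma supp_of_zero (hK : IsCompact K) {φ : Euc N → ℝ} (h : ∀ x, x ∉ K → φ x = 0) :
    tsupport φ ⊆ K := by
  refine closure_minimal ?_ hK.isClosed
  intro x hx
  by_contra hn
  exact hx (h x hn)

lemma cs_of_zero (hK : IsCompact K) {φ : Euc N → ℝ} (h : ∀ x, x ∉ K → φ x = 0) :
    HasCompactSupport φ := hK.of_isClosed_subset (isClosed_tsupport _) (supp_of_zero hK h)

lemma wint (hK : IsCompact K) (h0 : (0 : Euc N) ∉ K) {φ : Euc N → ℝ} (hc : Continuous φ)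
    (h : ∀ x, x ∉ K → φ x = 0) : Integrable (fun x => (‖x‖ ^ 2)⁻¹ * φ x) :=
  weight_integrable hc (cs_of_zero hK h) (fun h' => h0 (supp_of_zero hK h h'))

lemma gradient_comp_norm_le {j : ℝ → ℝ} (hj : Differentiable ℝ j) (hb : ∀ s, |deriv j s| ≤ 1)
    {f : Euc N → ℝ} (hf : Differentiable ℝ f) (x : Euc N) :
    ‖gradient (fun x => j (f x)) x‖ ^ 2 ≤ ‖gradient f x‖ ^ 2 := by
  rw [norm_gradient, norm_gradient]
  have h1 : HasFDerivAt (fun x => j (f x)) (deriv j (f x) • fderiv ℝ f x) x :=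
    (hj (f x)).hasDerivAt.comp_hasFDerivAt x (hf x).hasFDerivAt
  rw [h1.fderiv, norm_smul, Real.norm_eq_abs]
  have := hb (f x)
  gcongr
  nlinarith [norm_nonneg (fderiv ℝ f x)]

lemma var_test (hK : IsCompact K) (h0 : (0 : Euc N) ∉ K) {M m ε : ℝ} (hM : 0 ≤ M)
    (hm : ∀ ψ, Adm K ψ → -m ≤ Qf M ψ) {φ : Euc N → ℝ} (hφ : Adm K φ) (hε : Qf M φ ≤ -m + ε)
    {η : Euc N → ℝ} (hη : ContDiff ℝ 1 η) (hηc : HasCompactSupport η) (hη0 : ∀ x, 0 ≤ η x)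
    {s : ℝ} (hs : 0 < s) :
    2 * s * ((∫ x, inner ℝ (gradient φ x) (gradient η x)) - M * ∫ x, (‖x‖ ^ 2)⁻¹ * (φ x * η x)) ≤
      ε + s ^ 2 * ∫ x, ‖gradient η x‖ ^ 2 := by
  have hφd : Differentiable ℝ φ := hφ.1.differentiable (by norm_num)
  have hηd : Differentiable ℝ η := hη.differentiable (by norm_num)
  have hφc := cs_of_zero hK hφ.2.2.2
  have hI1 := wint hK h0 hφ.1.continuous hφ.2.2.2
  have hI2 : Integrable (fun x => (‖x‖ ^ 2)⁻¹ * φ x ^ 2) := 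
    wint hK h0 (hφ.1.continuous.pow 2) (fun x hx => by simp [hφ.2.2.2 x hx])
  have hI3 : Integrable (fun x => (‖x‖ ^ 2)⁻¹ * (φ x * η x)) := 
    wint hK h0 (hφ.1.continuous.mul hη.continuous) (fun x hx => by simp [hφ.2.2.2 x hx])
  have hG1 := gradient_sq_integrable hφ.1 hφc
  have hG2 := gradient_sq_integrable hη hηc
  have hG3 : Integrable (fun x => inner ℝ (gradient φ x) (gradient η x)) := by
    refine Continuous.integrable_of_hasCompactSupport
      ((gradient_continuous hφ.1).inner (gradient_continuous hη)) ?_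
    refine HasCompactSupport.intro hφc fun x hx => ?_
    rw [gradient_zero_of_notMem hx]; simp
  have key : ∀ τ > 0, 2 * s * ((∫ x, inner ℝ (gradient φ x) (gradient η x)) -
      M * ∫ x, (‖x‖ ^ 2)⁻¹ * (φ x * η x)) ≤
      ε + s ^ 2 * (∫ x, ‖gradient η x‖ ^ 2) + τ * (2 * M * ∫ x, (‖x‖ ^ 2)⁻¹ * φ x) := by
    intro τ hτ
    set f : Euc N → ℝ := fun x => φ x - s * η x with hf
    have hfC : ContDiff ℝ 1 f := hφ.1.sub (contDiff_const.mul hη)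
    have hfd : Differentiable ℝ f := hfC.differentiable (by norm_num)
    have hj1 : ContDiff ℝ 1 (jpos τ) := (jpos_smooth τ).of_le (by exact_mod_cast le_top)
    set g : Euc N → ℝ := fun x => jpos τ (f x) with hg
    have hfle : ∀ x, f x ≤ φ x := fun x => by
      have := hη0 x
      simp only [hf]; nlinarith
    have hgA : Adm K g := by
      refine ⟨hj1.comp hfC, fun x => jpos_nonneg hτ _, fun x => ?_, fun x hx => ?_⟩
      · rcases le_or_gt (f x) 0 with h | h
        · simp only [hg]; rw [jpos_of_nonpos hτ h]; norm_num
        · exact (jpos_le h.le).trans ((hfle x).trans (hφ.2.2.1 x))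
      · refine jpos_of_nonpos hτ ((hfle x).trans ?_)
        rw [hφ.2.2.2 x hx]
    have hgI : Integrable (fun x => (‖x‖ ^ 2)⁻¹ * g x ^ 2) := 
      wint hK h0 (hgA.1.continuous.pow 2) (fun x hx => by simp [hgA.2.2.2 x hx])
    have hgG := gradient_sq_integrable hgA.1 (cs_of_zero hK hgA.2.2.2)
    have h1 : ∫ x, ‖gradient g x‖ ^ 2 ≤ ∫ x, (‖gradient φ x‖ ^ 2 -
        (2 * s) * inner ℝ (gradient φ x) (gradient η x) + s ^ 2 * ‖gradient η x‖ ^ 2) := by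
      refine integral_mono hgG ((hG1.sub (hG3.const_mul _)).add (hG2.const_mul _)) fun x => ?_
      refine (gradient_comp_norm_le (hj1.differentiable (by norm_num)) (jpos_deriv hτ) hfd x).trans ?_
      have h2 : gradient f x = gradient φ x - s • gradient η x := by
        have : HasFDerivAt f (fderiv ℝ φ x - s • fderiv ℝ η x) x :=
          (hφd x).hasFDerivAt.sub ((hηd x).hasFDerivAt.const_mul s)
        unfold gradient
        rw [this.fderiv]; simp
      rw [h2, norm_sub_sq_real, inner_smul_right, norm_smul, mul_pow, Real.norm_eq_abs, sq_abs]
      apply le_of_eq; ring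
    have h2 : ∫ x, ((‖x‖ ^ 2)⁻¹ * φ x ^ 2 - (2 * s) * ((‖x‖ ^ 2)⁻¹ * (φ x * η x))
        - (2 * τ) * ((‖x‖ ^ 2)⁻¹ * φ x)) ≤ ∫ x, (‖x‖ ^ 2)⁻¹ * g x ^ 2 := by
      refine integral_mono ((hI2.sub (hI3.const_mul _)).sub (hI1.const_mul _)) hgI fun x => ?_
      have hw : 0 ≤ (‖x‖ ^ 2)⁻¹ := by positivity
      have hpt : φ x ^ 2 - 2 * s * (φ x * η x) - 2 * τ * φ x ≤ g x ^ 2 := by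
        have a := hφ.2.1 x
        have b := hη0 x
        rcases le_or_gt (f x) 0 with h | h
        · have : φ x ≤ s * η x := by simp only [hf] at h; linarith
          nlinarith [sq_nonneg (g x), mul_nonneg hτ.le a, mul_nonneg a (mul_nonneg hs.le b)]
        · have hge := jpos_ge hτ h
          have hnn := jpos_nonneg hτ (f x)
          have hle := hfle x
          have h5 : f x ^ 2 - 2 * τ * f x ≤ g x ^ 2 := by
            simp only [hg]
            rcases le_or_gt (f x) τ with h6 | h6
            · nlinarith [sq_nonneg (jpos τ (f x))]
            · nlinarith [sq_nonneg (jpos τ (f x))]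
          have h7 : f x ^ 2 = φ x ^ 2 - 2 * s * (φ x * η x) + (s * η x) ^ 2 := by
            simp only [hf]; ring
          nlinarith [sq_nonneg (s * η x)]
      simp only
      nlinarith [mul_le_mul_of_nonneg_left hpt hw]
    have hGa : Integrable (fun x => ‖gradient φ x‖ ^ 2 -
        (2 * s) * inner ℝ (gradient φ x) (gradient η x)) := hG1.sub (hG3.const_mul _)
    have hIa : Integrable (fun x => (‖x‖ ^ 2)⁻¹ * φ x ^ 2 -
        (2 * s) * ((‖x‖ ^ 2)⁻¹ * (φ x * η x))) := hI2.sub (hI3.const_mul _)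
    rw [integral_add hGa (hG2.const_mul _), integral_sub hG1 (hG3.const_mul _),
      integral_const_mul, integral_const_mul] at h1
    rw [integral_sub hIa (hI1.const_mul _), integral_sub hI2 (hI3.const_mul _),
      integral_const_mul, integral_const_mul] at h2
    have h3 := hm g hgA
    unfold Qf at h3 hε
    nlinarith [mul_le_mul_of_nonneg_left h2 hM]
  refine le_of_forall_pos_le_add fun δ hδ => ?_
  set B := 2 * M * ∫ x, (‖x‖ ^ 2)⁻¹ * φ x
  have h5 := key (δ / (|B| + 1)) (by positivity)
  have h6 : δ / (|B| + 1) * B ≤ δ := by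
    rw [div_mul_eq_mul_div, div_le_iff₀ (by positivity)]
    nlinarith [le_abs_self B]
  linarith

end

lemma sqrt_abs_deriv {τ : ℝ} (hτ : 0 < τ) (s : ℝ) :
    HasDerivAt (fun s : ℝ => Real.sqrt (s ^ 2 + τ ^ 2) - τ) (s / Real.sqrt (s ^ 2 + τ ^ 2)) s := by
  have h1 : HasDerivAt (fun s : ℝ => s ^ 2 + τ ^ 2) (2 * s) s := by
    simpa using (hasDerivAt_pow 2 s).add_const (τ ^ 2)
  refine ((h1.sqrt (by positivity)).sub_const τ).congr_deriv ?_
  field_simp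

lemma exists_adm_neg {N : ℕ} {C : Set (Euc N)} (h0 : (0 : Euc N) ∉ C) {M : ℝ} (hM : 0 < M)
    {φ : Euc N → ℝ} (hφ : IsTestFun C φ)
    (hneg : ∫ x, ‖gradient φ x‖ ^ 2 < M * ∫ x, (‖x‖ ^ 2)⁻¹ * φ x ^ 2) :
    ∃ ψ, Adm (tsupport φ) ψ ∧ Qf M ψ < 0 := by
  have h0' : (0 : Euc N) ∉ tsupport φ := fun h => h0 (hφ.2.2 h)
  have hK : IsCompact (tsupport φ) := hφ.2.1
  obtain ⟨b, hb⟩ := hφ.2.1.exists_bound_of_continuous hφ.1.continuous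
  have hφ1 : ContDiff ℝ 1 φ := hφ.1.of_le (by exact_mod_cast le_top)
  have hφd : Differentiable ℝ φ := hφ1.differentiable (by norm_num)
  have hz : ∀ x, x ∉ tsupport φ → φ x = 0 := fun x hx => image_eq_zero_of_notMem_tsupport hx
  set B := |b| + 1
  have hB : 0 < B := by positivity
  have hbB : ∀ x, |φ x| ≤ B := fun x => (hb x).trans (by simp only [B]; linarith [le_abs_self b])
  have hI1 : Integrable (fun x => (‖x‖ ^ 2)⁻¹ * |φ x|) := 
    wint hK h0' (hφ1.continuous.abs) (fun x hx => by simp [hz x hx])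
  have hI2 : Integrable (fun x => (‖x‖ ^ 2)⁻¹ * φ x ^ 2) := 
    wint hK h0' (hφ1.continuous.pow 2) (fun x hx => by simp [hz x hx])
  set A := ∫ x, (‖x‖ ^ 2)⁻¹ * |φ x|
  have hA : 0 ≤ A := integral_nonneg fun x => by positivity
  set D := M * (∫ x, (‖x‖ ^ 2)⁻¹ * φ x ^ 2) - ∫ x, ‖gradient φ x‖ ^ 2
  have hD : 0 < D := by simp only [D]; linarith
  set τ := D / (2 * M * A + 1) / 2
  have hτ : 0 < τ := by positivity
  have hτA : 2 * τ * (M * A) < D := by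
    have : τ * (2 * M * A + 1) = D / 2 := by simp only [τ]; field_simp
    nlinarith
  set j : ℝ → ℝ := fun s => Real.sqrt (s ^ 2 + τ ^ 2) - τ with hj
  have hjC : ContDiff ℝ 1 j := by
    refine ContDiff.sub (ContDiff.sqrt (by fun_prop) ?_) contDiff_const
    intro s; positivity
  have hjle : ∀ s, j s ≤ |s| := by
    intro s
    have : Real.sqrt (s ^ 2 + τ ^ 2) ≤ |s| + τ := by
      rw [Real.sqrt_le_left (by positivity)]
      nlinarith [sq_abs s, abs_nonneg s]
    simp only [hj]; linarith
  have hj0 : ∀ s, 0 ≤ j s := by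
    intro s
    have : τ ≤ Real.sqrt (s ^ 2 + τ ^ 2) := Real.le_sqrt_of_sq_le (by nlinarith [sq_nonneg s])
    simp only [hj]; linarith
  have hjb : ∀ s, |deriv j s| ≤ 1 := by
    intro s
    rw [(sqrt_abs_deriv hτ s).deriv, abs_div, abs_of_nonneg (Real.sqrt_nonneg _)]
    refine div_le_one_of_le₀ ?_ (Real.sqrt_nonneg _)
    apply Real.le_sqrt_of_sq_le
    rw [sq_abs]
    nlinarith
  have hjsq : ∀ s, s ^ 2 - 2 * τ * |s| ≤ j s ^ 2 := by
    intro s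
    have h1 := Real.sq_sqrt (show 0 ≤ s ^ 2 + τ ^ 2 by positivity)
    have h2 := hjle s
    simp only [hj] at h2 ⊢
    nlinarith
  set g : Euc N → ℝ := fun x => j (φ x)
  have hgC : ContDiff ℝ 1 g := hjC.comp hφ1
  have hgz : ∀ x, x ∉ tsupport φ → g x = 0 := by
    intro x hx
    have h1 := hjle (φ x)
    have h2 := hj0 (φ x)
    rw [hz x hx, abs_zero] at h1
    rw [hz x hx] at h2
    simp only [g, hz x hx]
    linarith
  have hgI : Integrable (fun x => (‖x‖ ^ 2)⁻¹ * g x ^ 2) := 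
    wint hK h0' (hgC.continuous.pow 2) (fun x hx => by simp [hgz x hx])
  have hgG := gradient_sq_integrable hgC (cs_of_zero hK hgz)
  have hQ : Qf M g < 0 := by
    have h1 : ∫ x, ‖gradient g x‖ ^ 2 ≤ ∫ x, ‖gradient φ x‖ ^ 2 :=
      integral_mono hgG (gradient_sq_integrable hφ1 hφ.2.1)
        (gradient_comp_norm_le (hjC.differentiable (by norm_num)) hjb hφd)
    have h2 : ∫ x, ((‖x‖ ^ 2)⁻¹ * φ x ^ 2 - (2 * τ) * ((‖x‖ ^ 2)⁻¹ * |φ x|)) ≤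
        ∫ x, (‖x‖ ^ 2)⁻¹ * g x ^ 2 := by
      refine integral_mono (hI2.sub (hI1.const_mul _)) hgI fun x => ?_
      have hw : 0 ≤ (‖x‖ ^ 2)⁻¹ := by positivity
      have := mul_le_mul_of_nonneg_left (hjsq (φ x)) hw
      simp only [g]
      nlinarith
    rw [integral_sub hI2 (hI1.const_mul _), integral_const_mul] at h2
    unfold Qf
    have h3 := mul_le_mul_of_nonneg_left h2 hM.le
    simp only [D] at hτA
    nlinarith
  -- normalize
  refine ⟨fun x => B⁻¹ * g x, ⟨contDiff_const.mul hgC, fun x => ?_, fun x => ?_, fun x hx => ?_⟩, ?_⟩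
  · exact mul_nonneg (by positivity) (hj0 _)
  · rw [inv_mul_le_iff₀ hB, mul_one]
    exact (hjle _).trans (hbB x)
  · simp [hgz x hx]
  · have h1 : ∀ x, ‖gradient (fun x => B⁻¹ * g x) x‖ ^ 2 = (B⁻¹) ^ 2 * ‖gradient g x‖ ^ 2 := by
      intro x
      rw [norm_gradient, norm_gradient]
      have h3 : HasFDerivAt (fun x => B⁻¹ * g x) (B⁻¹ • fderiv ℝ g x) x :=
        (hgC.differentiable (by norm_num) x).hasFDerivAt.const_mul B⁻¹
      rw [h3.fderiv, norm_smul, mul_pow, Real.norm_eq_abs, sq_abs]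
    have h2 : ∀ x : Euc N, (‖x‖ ^ 2)⁻¹ * (B⁻¹ * g x) ^ 2 = (B⁻¹) ^ 2 * ((‖x‖ ^ 2)⁻¹ * g x ^ 2) := by
      intro x; ring
    unfold Qf at hQ ⊢
    simp_rw [h1, h2]
    rw [integral_const_mul, integral_const_mul]
    have : 0 < (B⁻¹) ^ 2 := by positivity
    nlinarith

lemma exists_lower_norm {N : ℕ} {K : Set (Euc N)} (hK : IsCompact K) (h0 : (0 : Euc N) ∉ K) :
    ∃ d, 0 < d ∧ ∀ x ∈ K, d ≤ ‖x‖ := by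
  have hn : Kᶜ ∈ 𝓝 (0 : Euc N) := hK.isClosed.isOpen_compl.mem_nhds h0
  obtain ⟨d, hd, hsub⟩ := Metric.mem_nhds_iff.1 hn
  refine ⟨d, hd, fun x hx => ?_⟩
  by_contra h
  exact hsub (by simpa using h) hx

/-- approximate minimizers satisfy an approximate weak inequality and do not degenerate -/
lemma var_exists {N : ℕ} {C : Set (Euc N)} (hC : IsOpen C) (hne : C.Nonempty) (h0 : (0 : Euc N) ∉ C)
    {M : ℝ} (hMpos : 0 < M) (hM : hardyConst C < M) :
    ∃ K : Set (Euc N), IsCompact K ∧ K ⊆ C ∧ ∃ c, 0 < c ∧ ∀ ε, 0 < ε → ∃ φ, Adm K φ ∧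
      c ≤ ∫ x, φ x ∧ ∀ η : Euc N → ℝ, ContDiff ℝ 1 η → HasCompactSupport η → (∀ x, 0 ≤ η x) →
        ∫ x, inner ℝ (gradient φ x) (gradient η x) ≤ M * (∫ x, (‖x‖ ^ 2)⁻¹ * (φ x * η x)) +
          ε * (1 + ∫ x, ‖gradient η x‖ ^ 2) := by
  obtain ⟨φ₀, hφ₀, hneg⟩ := exists_near_hardy hC hne h0 hM
  obtain ⟨ψ, hψ, hψneg⟩ := exists_adm_neg h0 hMpos hφ₀ hneg
  set K := tsupport φ₀
  have hK : IsCompact K := hφ₀.2.1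
  have h0K : (0 : Euc N) ∉ K := fun h => h0 (hφ₀.2.2 h)
  obtain ⟨d, hd, hdK⟩ := exists_lower_norm hK h0K
  -- weight bound
  have hwle : ∀ φ, Adm K φ → ∀ x, (‖x‖ ^ 2)⁻¹ * φ x ^ 2 ≤ (d ^ 2)⁻¹ * φ x := by
    intro φ hφ x
    by_cases hx : x ∈ K
    · have h1 : (‖x‖ ^ 2)⁻¹ ≤ (d ^ 2)⁻¹ := by
        have := hdK x hx
        gcongr
      have h2 : φ x ^ 2 ≤ φ x := by nlinarith [hφ.2.1 x, hφ.2.2.1 x]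
      have := hφ.2.1 x
      gcongr
    · simp [hφ.2.2.2 x hx]
  have hintg : ∀ φ, Adm K φ → Integrable φ := fun φ hφ =>
    hφ.1.continuous.integrable_of_hasCompactSupport (cs_of_zero hK hφ.2.2.2)
  have hwint : ∀ φ, Adm K φ → ∫ x, (‖x‖ ^ 2)⁻¹ * φ x ^ 2 ≤ (d ^ 2)⁻¹ * ∫ x, φ x := by
    intro φ hφ
    rw [← integral_const_mul]
    refine integral_mono (wint hK h0K (hφ.1.continuous.pow 2) (fun x hx => by simp [hφ.2.2.2 x hx]))
      ((hintg φ hφ).const_mul _) (hwle φ hφ)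
  have hle1 : ∀ φ, Adm K φ → ∫ x, φ x ≤ volume.real K := by
    intro φ hφ
    have h1 : ∫ x, φ x = ∫ x in K, φ x := by
      rw [setIntegral_eq_integral_of_forall_compl_eq_zero]
      intro x hx; exact hφ.2.2.2 x hx
    rw [h1]
    have h2 : ∫ x in K, φ x ≤ ∫ x in K, (1:ℝ) :=
      setIntegral_mono (hintg φ hφ).integrableOn (integrableOn_const hK.measure_lt_top.ne) hφ.2.2.1
    simpa using h2
  set Sset := {q : ℝ | ∃ φ, Adm K φ ∧ q = Qf M φ}
  have hbdd : BddBelow Sset := by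
    refine ⟨-(M * ((d ^ 2)⁻¹ * volume.real K)), ?_⟩
    rintro q ⟨φ, hφ, rfl⟩
    unfold Qf
    have h1 : 0 ≤ ∫ x, ‖gradient φ x‖ ^ 2 := integral_nonneg fun x => by positivity
    have h2 := (hwint φ hφ).trans (mul_le_mul_of_nonneg_left (hle1 φ hφ) (by positivity))
    nlinarith
  have hmem : Qf M ψ ∈ Sset := ⟨ψ, hψ, rfl⟩
  set m := - sInf Sset with hm
  have hmpos : 0 < m := by
    have := csInf_le hbdd hmem
    linarith
  have hmin : ∀ φ, Adm K φ → -m ≤ Qf M φ := by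
    intro φ hφ
    rw [hm, neg_neg]
    exact csInf_le hbdd ⟨φ, hφ, rfl⟩
  refine ⟨K, hK, hφ₀.2.2, m * d ^ 2 / (2 * M), by positivity, fun ε hε => ?_⟩
  obtain ⟨q, ⟨φ, hφ, rfl⟩, hq⟩ := exists_lt_of_csInf_lt (⟨_, hmem⟩ : Sset.Nonempty)
    (show sInf Sset < -m + min (ε ^ 2) (m / 2) by
      have : 0 < min (ε ^ 2) (m / 2) := lt_min (by positivity) (by positivity)
      linarith)
  refine ⟨φ, hφ, ?_, ?_⟩
  · have h1 : Qf M φ ≤ -m / 2 := by linarith [min_le_right (ε ^ 2) (m / 2)]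
    unfold Qf at h1
    have h2 : 0 ≤ ∫ x, ‖gradient φ x‖ ^ 2 := integral_nonneg fun x => by positivity
    have h3 := mul_le_mul_of_nonneg_left (hwint φ hφ) hMpos.le
    have h4 : m / 2 ≤ M * ((d ^ 2)⁻¹ * ∫ x, φ x) := by linarith
    rw [div_le_iff₀ (by positivity)]
    have h5 : M * ((d ^ 2)⁻¹ * ∫ x, φ x) * (2 * d ^ 2) = (∫ x, φ x) * (2 * M) := by field_simp
    rw [← h5]
    have : 0 < 2 * d ^ 2 := by positivity
    nlinarith
  · intro η hη hηc hη0
    have := var_test hK h0K hMpos.le hmin hφ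
      (hq.le.trans (by linarith [min_le_left (ε ^ 2) (m / 2)]) : Qf M φ ≤ -m + ε ^ 2) hη hηc hη0 hε
    have h2 : 0 ≤ ∫ x, ‖gradient η x‖ ^ 2 := integral_nonneg fun x => by positivity
    have h3 : 2 * ε * ((∫ x, inner ℝ (gradient φ x) (gradient η x)) -
      M * ∫ x, (‖x‖ ^ 2)⁻¹ * (φ x * η x)) ≤ 2 * ε * (ε * (1 + ∫ x, ‖gradient η x‖ ^ 2)) := by
      refine this.trans ?_
      have : 0 ≤ ε ^ 2 := by positivity
      nlinarith [mul_nonneg this h2]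
    have h4 := le_of_mul_le_mul_left h3 (by positivity)
    linarith

section homog
variable {N : ℕ}

/-- radial averaging (Mellin) operator -/
def hT {F : Type} [NormedAddCommGroup F] [NormedSpace ℝ F] (β : ℝ) (f : Euc N → F) (x : Euc N) : F :=
  ∫ s : ℝ, Real.exp (β * s) • f (Real.exp s • x)

lemma mem_Icc_of_annulus {d B a b s : ℝ} {x : Euc N} (hd : 0 < d) (ha : 0 < a) (hb : 0 < b)
    (hxa : a ≤ ‖x‖) (hxb : ‖x‖ ≤ b) (h1 : d ≤ ‖Real.exp s • x‖) (h2 : ‖Real.exp s • x‖ ≤ B) :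
    s ∈ Set.Icc (Real.log (d / b)) (Real.log (B / a)) := by
  rw [norm_smul, Real.norm_of_nonneg (Real.exp_pos s).le] at h1 h2
  have hs := Real.exp_pos s
  have h3 : 0 < ‖x‖ := ha.trans_le hxa
  have hB : 0 < B := by nlinarith [mul_pos hs h3]
  constructor
  · rw [Real.log_le_iff_le_exp (by positivity), div_le_iff₀ hb]
    nlinarith
  · rw [Real.le_log_iff_exp_le (by positivity), le_div_iff₀ ha]
    nlinarith

lemma hT_integrable {F : Type} [NormedAddCommGroup F] [NormedSpace ℝ F] (β : ℝ)
    {f : Euc N → F} (hf : Continuous f) {d B : ℝ} (hd : 0 < d)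
    (hz : ∀ x, f x ≠ 0 → d ≤ ‖x‖ ∧ ‖x‖ ≤ B) {x : Euc N} (hx : x ≠ 0) :
    Integrable (fun s : ℝ => Real.exp (β * s) • f (Real.exp s • x)) := by
  have hx' : 0 < ‖x‖ := norm_pos_iff.2 hx
  refine Continuous.integrable_of_hasCompactSupport (by fun_prop) ?_
  refine HasCompactSupport.intro (isCompact_Icc (a := Real.log (d / ‖x‖)) (b := Real.log (B / ‖x‖)))
    fun s hs => ?_
  by_contra h
  have h1 : f (Real.exp s • x) ≠ 0 := fun h2 => h (by rw [h2, smul_zero])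
  exact hs (mem_Icc_of_annulus hd hx' hx' le_rfl le_rfl (hz _ h1).1 (hz _ h1).2)

lemma hT_hasFDerivAt {F : Type} [NormedAddCommGroup F] [NormedSpace ℝ F] (β : ℝ)
    {f : Euc N → F} (hf : ContDiff ℝ 1 f) {d B : ℝ} (hd : 0 < d) 
    (hz : ∀ x, f x ≠ 0 → d ≤ ‖x‖ ∧ ‖x‖ ≤ B) (hz' : ∀ x, fderiv ℝ f x ≠ 0 → d ≤ ‖x‖ ∧ ‖x‖ ≤ B)
    {x : Euc N} (hx : x ≠ 0) :
    HasFDerivAt (hT β f) (hT (β + 1) (fderiv ℝ f) x) x := by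
  have hx' : 0 < ‖x‖ := norm_pos_iff.2 hx
  have hcf : Continuous (fderiv ℝ f) := hf.continuous_fderiv (by norm_num)
  have hcs : HasCompactSupport (fderiv ℝ f) := by
    refine HasCompactSupport.intro (isCompact_closedBall (0 : Euc N) B) fun y hy => ?_
    by_contra h
    exact hy (by simpa using (hz' y h).2)
  obtain ⟨Cb, hCb⟩ := hcf.bounded_above_of_compact_support hcs
  set I := Set.Icc (Real.log (d / (3 * ‖x‖ / 2))) (Real.log (B / (‖x‖ / 2)))
  have hfun : hT β f = fun y => ∫ s : ℝ, Real.exp (β * s) • f (Real.exp s • y) := rfl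
  rw [hfun]
  unfold hT
  refine hasFDerivAt_integral_of_dominated_of_fderiv_le (s := ball x (‖x‖ / 2))
    (F' := fun y s => Real.exp ((β + 1) * s) • fderiv ℝ f (Real.exp s • y))
    (bound := I.indicator fun s => Real.exp ((β + 1) * s) * Cb) (ball_mem_nhds x (by positivity))
    ?_ ?_ ?_ ?_ ?_ ?_
  · exact Eventually.of_forall fun y =>
      (Continuous.aestronglyMeasurable (by have := hf.continuous; fun_prop))
  · exact hT_integrable β hf.continuous hd hz hx
  · exact Continuous.aestronglyMeasurable (by fun_prop)
  · refine Eventually.of_forall fun s y hy => ?_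
    rw [mem_ball, dist_eq_norm] at hy
    have hy1 : ‖x‖ / 2 ≤ ‖y‖ := by
      have := norm_sub_norm_le x y
      rw [norm_sub_rev] at this; linarith
    have hy2 : ‖y‖ ≤ 3 * ‖x‖ / 2 := by
      have := norm_sub_norm_le y x
      linarith
    by_cases hs : s ∈ I
    · rw [Set.indicator_of_mem hs, norm_smul, Real.norm_of_nonneg (Real.exp_pos _).le]
      exact mul_le_mul_of_nonneg_left (hCb _) (Real.exp_pos _).le
    · rw [Set.indicator_of_notMem hs]
      have : fderiv ℝ f (Real.exp s • y) = 0 := by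
        by_contra h
        exact hs (mem_Icc_of_annulus hd (by positivity) (by positivity) hy1 hy2 (hz' _ h).1 (hz' _ h).2)
      rw [this]; simp
  · rw [integrable_indicator_iff measurableSet_Icc]
    exact (Continuous.continuousOn (by fun_prop)).integrableOn_compact isCompact_Icc
  · refine Eventually.of_forall fun s y _ => ?_
    have h1 : HasFDerivAt (fun y : Euc N => Real.exp s • y)
        (Real.exp s • ContinuousLinearMap.id ℝ (Euc N)) y :=
      (hasFDerivAt_id y).const_smul (Real.exp s)
    have h2 := ((hf.differentiable (by norm_num)).differentiableAt (x := Real.exp s • y)).hasFDerivAt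
    have h3 := (h2.comp y h1).const_smul (Real.exp (β * s))
    refine HasFDerivAt.congr_fderiv h3 ?_
    ext v
    simp only [_root_.smul_apply, ContinuousLinearMap.comp_apply, map_smul,
      ContinuousLinearMap.id_apply, smul_smul]
    rw [← Real.exp_add]
    ring_nf

lemma fderiv_supp {F : Type} [NormedAddCommGroup F] [NormedSpace ℝ F] {f : Euc N → F} {d B : ℝ}
    (hz : ∀ x, f x ≠ 0 → d ≤ ‖x‖ ∧ ‖x‖ ≤ B) : ∀ x, fderiv ℝ f x ≠ 0 → d ≤ ‖x‖ ∧ ‖x‖ ≤ B := by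
  intro x hx
  have h1 : x ∈ tsupport f := by
    by_contra h
    have : f =ᶠ[𝓝 x] fun _ => 0 := notMem_tsupport_iff_eventuallyEq.mp h
    exact hx (by rw [this.fderiv_eq]; simp)
  have hcl : IsClosed {x : Euc N | d ≤ ‖x‖ ∧ ‖x‖ ≤ B} :=
    (isClosed_le continuous_const continuous_norm).inter (isClosed_le continuous_norm continuous_const)
  exact closure_minimal (fun y hy => hz y hy) hcl h1

lemma hT_contDiffOn (n : ℕ) : ∀ {F : Type} [NormedAddCommGroup F] [NormedSpace ℝ F] (β : ℝ)
    {f : Euc N → F} (_ : ContDiff ℝ (⊤ : ℕ∞) f) {d B : ℝ} (_ : 0 < d)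
    (_ : ∀ x, f x ≠ 0 → d ≤ ‖x‖ ∧ ‖x‖ ≤ B), ContDiffOn ℝ n (hT β f) {0}ᶜ := by
  induction n with
  | zero =>
    intro F _ _ β f hf d B hd hz
    have : ContinuousOn (hT β f) {0}ᶜ := fun x hx =>
      (hT_hasFDerivAt β (hf.of_le (by exact_mod_cast le_top)) hd hz (fderiv_supp hz)
        hx).continuousAt.continuousWithinAt
    simpa using (contDiffOn_zero (𝕜 := ℝ)).2 this
  | succ n ih =>
    intro F _ _ β f hf d B hd hz
    have hder : ∀ x : Euc N, x ≠ 0 → HasFDerivAt (hT β f) (hT (β + 1) (fderiv ℝ f) x) x := fun x hx =>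
      hT_hasFDerivAt β (hf.of_le (by exact_mod_cast le_top)) hd hz (fderiv_supp hz) hx
    have h2 : ContDiffOn ℝ n (fderiv ℝ (hT β f)) {0}ᶜ :=
      (ih (β + 1) (hf.fderiv_right (by simp)) hd (fderiv_supp hz)).congr
        fun x hx => (hder x hx).fderiv
    have h3 := (contDiffOn_succ_iff_fderiv_of_isOpen (n := n) (f := hT β f) (𝕜 := ℝ)
      (isOpen_compl_singleton (x := (0 : Euc N)))).2
      ⟨fun x hx => (hder x hx).differentiableAt.differentiableWithinAt, by simp, h2⟩
    exact_mod_cast h3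

lemma hT_contDiffAt {F : Type} [NormedAddCommGroup F] [NormedSpace ℝ F] (β : ℝ)
    {f : Euc N → F} (hf : ContDiff ℝ (⊤ : ℕ∞) f) {d B : ℝ} (hd : 0 < d)
    (hz : ∀ x, f x ≠ 0 → d ≤ ‖x‖ ∧ ‖x‖ ≤ B) {x : Euc N} (hx : x ≠ 0) :
    ContDiffAt ℝ (⊤ : ℕ∞) (hT β f) x := by
  have : ContDiffOn ℝ (⊤ : ℕ∞) (hT β f) {0}ᶜ := contDiffOn_infty.2 fun n => hT_contDiffOn n β hf hd hz
  exact this.contDiffAt (isOpen_compl_singleton.mem_nhds hx)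

lemma hT_homog {F : Type} [NormedAddCommGroup F] [NormedSpace ℝ F] (β : ℝ) (f : Euc N → F)
    {l : ℝ} (hl : 0 < l) (x : Euc N) : hT β f (l • x) = l ^ (-β) • hT β f x := by
  unfold hT
  rw [← integral_smul]
  rw [← integral_add_right_eq_self (fun s : ℝ => l ^ (-β) • Real.exp (β * s) • f (Real.exp s • x)) (Real.log l)]
  congr 1
  ext s
  rw [Real.exp_add, Real.exp_log hl, smul_smul, smul_smul, Real.rpow_def_of_pos hl, ← Real.exp_add]
  ring_nf

lemma hT_lap (β : ℝ) {f : Euc N → ℝ} (hf : ContDiff ℝ (⊤ : ℕ∞) f) {d B : ℝ} (hd : 0 < d)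
    (hz : ∀ x, f x ≠ 0 → d ≤ ‖x‖ ∧ ‖x‖ ≤ B) {x : Euc N} (hx : x ≠ 0) :
    lap (hT β f) x = hT (β + 2) (lap f) x := by
  have hf' : ContDiff ℝ (⊤ : ℕ∞) (fderiv ℝ f) := hf.fderiv_right (by simp)
  have hf'' : ContDiff ℝ (⊤ : ℕ∞) (fderiv ℝ (fderiv ℝ f)) := hf'.fderiv_right (by simp)
  have e1 : fderiv ℝ (hT β f) =ᶠ[𝓝 x] hT (β + 1) (fderiv ℝ f) := by
    filter_upwards [isOpen_compl_singleton.mem_nhds hx] with y hy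
    exact (hT_hasFDerivAt β (hf.of_le (by exact_mod_cast le_top)) hd hz (fderiv_supp hz) hy).fderiv
  have e2 : fderiv ℝ (fderiv ℝ (hT β f)) x = hT (β + 1 + 1) (fderiv ℝ (fderiv ℝ f)) x := by
    rw [e1.fderiv_eq]
    exact (hT_hasFDerivAt (β + 1) (hf'.of_le (by exact_mod_cast le_top)) hd (fderiv_supp hz)
      (fderiv_supp (fderiv_supp hz)) hx).fderiv
  have hintg := hT_integrable (β + 1 + 1) hf''.continuous hd (fderiv_supp (fderiv_supp hz)) hx
  rw [lap_eq_sum, e2]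
  unfold hT
  have h3 : ∀ v : Euc N, (∫ s : ℝ, Real.exp ((β + 1 + 1) * s) • fderiv ℝ (fderiv ℝ f) (Real.exp s • x)) v v
      = ∫ s : ℝ, Real.exp ((β + 2) * s) * fderiv ℝ (fderiv ℝ f) (Real.exp s • x) v v := by
    intro v
    rw [ContinuousLinearMap.integral_apply hintg, ContinuousLinearMap.integral_apply (hintg.apply_continuousLinearMap v)]
    congr 1; ext s
    simp; left; left; ring
  simp_rw [h3]
  rw [← integral_finsetSum]
  · congr 1; ext s
    rw [lap_eq_sum, smul_eq_mul, Finset.mul_sum]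
  · intro i _
    have := (hintg.apply_continuousLinearMap (EuclideanSpace.single i (1:ℝ))).apply_continuousLinearMap
      (EuclideanSpace.single i (1:ℝ))
    refine this.congr (Eventually.of_forall fun s => ?_)
    simp; left; left; ring

/-- Euler identity. -/
lemma euler_of_homog {Ψ : Euc N → ℝ} {γ : ℝ} {x : Euc N} (hd : DifferentiableAt ℝ Ψ x)
    (hh : ∀ l : ℝ, 0 < l → Ψ (l • x) = l ^ (-γ) * Ψ x) : fderiv ℝ Ψ x x = -γ * Ψ x := by
  have h1 : HasDerivAt (fun l : ℝ => l • x) x 1 := by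
    simpa using (hasDerivAt_id (1:ℝ)).smul_const x
  have h2 : HasDerivAt (fun l : ℝ => Ψ (l • x)) (fderiv ℝ Ψ x x) 1 := by
    have h3 : HasFDerivAt Ψ (fderiv ℝ Ψ x) ((1:ℝ) • x) := by simpa using hd.hasFDerivAt
    exact h3.comp_hasDerivAt 1 h1
  have h4 : HasDerivAt (fun l : ℝ => l ^ (-γ) * Ψ x) (-γ * Ψ x) 1 := by
    have := (Real.hasDerivAt_rpow_const (x := 1) (p := -γ) (Or.inl one_ne_zero)).mul_const (Ψ x)
    simpa using this
  refine h2.unique (h4.congr_of_eventuallyEq ?_)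
  filter_upwards [lt_mem_nhds (show (0:ℝ) < 1 by norm_num)] with l hl
  exact hh l hl

end homog

section moll
variable {N : ℕ}
open scoped Convolution

lemma lap_neg_arg (f : Euc N → ℝ) (x : Euc N) : lap (fun z => f (-z)) x = lap f (-x) := by
  have h : ∀ {F : Type} [NormedAddCommGroup F] [NormedSpace ℝ F] (g : Euc N → F) (z : Euc N),
      fderiv ℝ (fun z => g (-z)) z = -fderiv ℝ g (-z) := by
    intro F _ _ g z
    have := (ContinuousLinearEquiv.neg ℝ (M := Euc N)).comp_right_fderiv (f := g) (x := z)
    have h2 : (g ∘ ⇑(ContinuousLinearEquiv.neg ℝ (M := Euc N))) = fun z => g (-z) := rfl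
    rw [h2] at this
    rw [this]
    ext v
    simp
  rw [lap_eq_sum, lap_eq_sum]
  refine Finset.sum_congr rfl fun i _ => ?_
  have h1 : fderiv ℝ (fun z => f (-z)) = fun z => -fderiv ℝ f (-z) := by
    ext1 z; exact h f z
  rw [h1]
  have h2 : fderiv ℝ (fun z => -fderiv ℝ f (-z)) x = fderiv ℝ (fderiv ℝ f) (-x) := by
    have : (fun z => -fderiv ℝ f (-z)) = -(fun z => fderiv ℝ f (-z)) := rfl
    rw [this, fderiv_neg, h, neg_neg]
  rw [h2]

/-- integration by parts -/
lemma ibp_lap {φ η : Euc N → ℝ} (hφ : ContDiff ℝ 1 φ) (hφc : HasCompactSupport φ)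
    (hη : ContDiff ℝ 2 η) :
    ∫ x, φ x * lap η x = -∫ x, inner ℝ (gradient φ x) (gradient η x) := by
  have hcφ : Continuous (fderiv ℝ φ) := hφ.continuous_fderiv (by norm_num)
  have hη1 : ContDiff ℝ 1 (fderiv ℝ η) := hη.fderiv_right (by norm_num)
  have hcη : Continuous (fderiv ℝ η) := hη1.continuous
  have hcη2 : Continuous (fderiv ℝ (fderiv ℝ η)) := hη1.continuous_fderiv (by norm_num)
  have hI1 : ∀ v : Euc N, Integrable (fun x => fderiv ℝ φ x v * fderiv ℝ η x v) := by
    intro v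
    refine Continuous.integrable_of_hasCompactSupport (by fun_prop) ?_
    refine HasCompactSupport.intro hφc fun x hx => ?_
    have : φ =ᶠ[𝓝 x] fun _ => 0 := notMem_tsupport_iff_eventuallyEq.mp hx
    rw [this.fderiv_eq]; simp
  have hI2 : ∀ v : Euc N, Integrable (fun x => φ x * fderiv ℝ (fderiv ℝ η) x v v) := by
    intro v
    exact Continuous.integrable_of_hasCompactSupport (by have := hφ.continuous; fun_prop) hφc.mul_right
  have hv : ∀ v : Euc N, ∫ x, φ x * fderiv ℝ (fderiv ℝ η) x v v =
      -∫ x, fderiv ℝ φ x v * fderiv ℝ η x v := by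
    intro v
    have e : ∀ x, fderiv ℝ (fderiv ℝ η) x v v = fderiv ℝ (fun y => fderiv ℝ η y v) x v :=
      fun x => fderiv2_apply hη.contDiffAt v v
    have h2 := hI2 v
    simp_rw [e] at h2 ⊢
    refine integral_mul_fderiv_eq_neg_fderiv_mul_of_integrable (hI1 v) h2 ?_ ?_ ?_
    · exact Continuous.integrable_of_hasCompactSupport (by have := hφ.continuous; fun_prop) hφc.mul_right
    · intro x _; exact (hφ.differentiable (by norm_num)) x
    · intro x _
      exact ((hη1.differentiable (by norm_num)) x).clm_apply (differentiableAt_const v)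
  have h1 : ∀ x, φ x * lap η x = ∑ i : Fin N, φ x * fderiv ℝ (fderiv ℝ η) x
      (EuclideanSpace.single i 1) (EuclideanSpace.single i 1) := fun x => by
    rw [lap_eq_sum, Finset.mul_sum]
  simp_rw [h1]
  rw [integral_finsetSum _ fun i _ => hI2 _]
  simp_rw [hv]
  rw [Finset.sum_neg_distrib, ← integral_finsetSum _ fun i _ => hI1 _]
  congr 2
  ext x
  have h3 := sum_inner_single_clm (gradient φ x) (fderiv ℝ η x)
  rw [real_inner_comm, inner_gradient_left, ← h3]
  refine Finset.sum_congr rfl fun i _ => ?_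
  rw [inner_gradient_left]

/-- mollification -/
def moll (φ ρ : Euc N → ℝ) (x : Euc N) : ℝ := ∫ y, φ y * ρ (x - y)

lemma moll_eq (φ ρ : Euc N → ℝ) : moll φ ρ = φ ⋆[ContinuousLinearMap.mul ℝ ℝ, volume] ρ := by
  ext x; rfl

lemma moll_smooth {φ ρ : Euc N → ℝ} (hφ : Continuous φ) (hρ : ContDiff ℝ (⊤ : ℕ∞) ρ)
    (hρc : HasCompactSupport ρ) : ContDiff ℝ (⊤ : ℕ∞) (moll φ ρ) := by
  rw [moll_eq]
  exact hρc.contDiff_convolution_right _ hφ.locallyIntegrable hρ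

lemma moll_lap {φ ρ : Euc N → ℝ} (hφ : Continuous φ) (hρ : ContDiff ℝ (⊤ : ℕ∞) ρ)
    (hρc : HasCompactSupport ρ) (x : Euc N) : lap (moll φ ρ) x = ∫ y, φ y * lap ρ (x - y) := by
  have hρ1 : ContDiff ℝ (⊤ : ℕ∞) (fderiv ℝ ρ) := hρ.fderiv_right (by simp)
  have hc1 : HasCompactSupport (fderiv ℝ ρ) := hρc.fderiv (𝕜 := ℝ)
  have hc2 : HasCompactSupport (fderiv ℝ (fderiv ℝ ρ)) := hc1.fderiv (𝕜 := ℝ)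
  have hρ2 : ContDiff ℝ (⊤ : ℕ∞) (fderiv ℝ (fderiv ℝ ρ)) := hρ1.fderiv_right (by simp)
  have e1 : fderiv ℝ (moll φ ρ) = φ ⋆[ContinuousLinearMap.precompR (Euc N) (ContinuousLinearMap.mul ℝ ℝ), volume] fderiv ℝ ρ := by
    ext1 x
    rw [moll_eq]
    exact (hρc.hasFDerivAt_convolution_right _ hφ.locallyIntegrable (hρ.of_le (by exact_mod_cast le_top)) x).fderiv
  rw [lap_eq_sum]
  rw [e1, (hc1.hasFDerivAt_convolution_right _ hφ.locallyIntegrable (hρ1.of_le (by exact_mod_cast le_top)) x).fderiv]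
  have hintg : ∀ v : Euc N, Integrable (fun y => φ y * fderiv ℝ (fderiv ℝ ρ) (x - y) v v) := by
    intro v
    have hcc := hρ2.continuous
    refine Continuous.integrable_of_hasCompactSupport (by fun_prop) ?_
    have h3 : HasCompactSupport (fun y => fderiv ℝ (fderiv ℝ ρ) (x - y)) :=
      hc2.comp_homeomorph (Homeomorph.subLeft x)
    refine HasCompactSupport.intro h3 fun y hy => ?_
    have := image_eq_zero_of_notMem_tsupport hy
    rw [this]; simp
  have h4 : ∀ y, φ y * lap ρ (x - y) = ∑ i : Fin N, φ y * fderiv ℝ (fderiv ℝ ρ) (x - y)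
      (EuclideanSpace.single i 1) (EuclideanSpace.single i 1) := fun y => by
    rw [lap_eq_sum, Finset.mul_sum]
  simp_rw [h4]
  rw [integral_finsetSum _ fun i _ => hintg _]
  refine Finset.sum_congr rfl fun i _ => ?_
  rw [convolution_precompR_apply _ hφ.locallyIntegrable hc2 hρ2.continuous,
    convolution_precompR_apply _ hφ.locallyIntegrable]
  · rfl
  · refine HasCompactSupport.intro hc2 fun y hy => ?_
    have := image_eq_zero_of_notMem_tsupport hy
    rw [this]; simp
  · have hcc := hρ2.continuous
    fun_prop

end moll

section sub1
variable {N : ℕ}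

lemma exists_mollifier (δ : ℝ) (hδ : 0 < δ) : ∃ ρ : Euc N → ℝ, ContDiff ℝ (⊤ : ℕ∞) ρ ∧
    HasCompactSupport ρ ∧ (∀ x, 0 ≤ ρ x) ∧ (∀ x, ρ x ≠ 0 → ‖x‖ ≤ δ) ∧ (∀ x, ρ (-x) = ρ x) ∧
    ∫ x, ρ x = 1 := by
  let b : ContDiffBump (0 : Euc N) := ⟨δ / 2, δ, by positivity, by linarith⟩
  refine ⟨b.normed volume, b.contDiff_normed, b.hasCompactSupport_normed, b.nonneg_normed, ?_,
    b.normed_neg, b.integral_normed⟩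
  intro x hx
  have : x ∈ Function.support (b.normed volume) := hx
  rw [b.support_normed_eq] at this
  have h2 : ‖x‖ < δ := by simpa using this
  exact h2.le

lemma moll_integral {φ ρ : Euc N → ℝ} (hφ : Integrable φ) (hρ : Integrable ρ) :
    ∫ x, moll φ ρ x = (∫ x, φ x) * ∫ x, ρ x := by
  rw [moll_eq]
  exact integral_convolution (ContinuousLinearMap.mul ℝ ℝ) hφ hρ

lemma sub1 {C : Set (Euc N)} (hC : IsOpen C) (hne : C.Nonempty) (h0 : (0 : Euc N) ∉ C)
    {M : ℝ} (hμ : 0 < hardyConst C) (hM : hardyConst C < M) :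
    ∃ K : Set (Euc N), IsCompact K ∧ K ⊆ C ∧ ∃ a, 0 < a ∧ ∃ L : ℝ≥0, ∀ ε, 0 < ε →
      ∃ ψ : Euc N → ℝ, ContDiff ℝ (⊤ : ℕ∞) ψ ∧ (∀ x, 0 ≤ ψ x) ∧ (∀ x, ψ x ≠ 0 → x ∈ K) ∧
        (∀ x, - lap ψ x ≤ M * ((‖x‖ ^ 2)⁻¹ * ψ x) + ε) ∧ LipschitzWith L ψ ∧ ∃ y, a ≤ ψ y := by
  set M' := (hardyConst C + M) / 2 with hM'
  have hM'1 : hardyConst C < M' := by linarith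
  have hM'2 : M' < M := by linarith
  have hM'0 : 0 < M' := by linarith
  obtain ⟨K, hK, hKC, c, hc, hφ⟩ := var_exists hC hne h0 hM'0 hM'1
  have h0K : (0 : Euc N) ∉ K := fun h => h0 (hKC h)
  obtain ⟨d, hd, hdK⟩ := exists_lower_norm hK h0K
  obtain ⟨δ₀, hδ₀, hδ₀C⟩ := hK.exists_cthickening_subset_open hC hKC
  set t := min 1 ((M - M') / (3 * M')) with ht
  have htpos : 0 < t := lt_min one_pos (div_pos (by linarith) (by positivity))
  have ht1 : t ≤ 1 := min_le_left _ _
  have htM : M' * (1 + t) ^ 2 ≤ M := by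
    have h1 : t * (3 * M') ≤ M - M' := by
      rw [← le_div_iff₀ (by positivity)]; exact min_le_right _ _
    nlinarith [mul_nonneg htpos.le (sub_nonneg.2 ht1)]
  set δ := min δ₀ (min (d / 2) (d * t)) with hδ
  have hδpos : 0 < δ := lt_min hδ₀ (lt_min (by positivity) (by positivity))
  have hδ1 : δ ≤ δ₀ := min_le_left _ _
  have hδ2 : δ ≤ d * t := (min_le_right _ _).trans (min_le_right _ _)
  have hδ3 : δ ≤ d / 2 := (min_le_right _ _).trans (min_le_left _ _)
  obtain ⟨ρ, hρ, hρc, hρ0, hρs, hρn, hρ1⟩ := exists_mollifier (N := N) δ hδpos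
  have hρi : Integrable ρ := hρ.continuous.integrable_of_hasCompactSupport hρc
  obtain ⟨Lρ, hLρ⟩ := ContDiff.lipschitzWith_of_hasCompactSupport hρc hρ (by simp)
  set K' := cthickening δ K with hK'
  have hK'c : IsCompact K' := hK.cthickening
  set J := ∫ x, ‖gradient ρ x‖ ^ 2 with hJ
  have hJ0 : 0 ≤ J := integral_nonneg fun x => by positivity
  refine ⟨K', hK'c, (cthickening_mono hδ1 K).trans hδ₀C, c / (volume.real K' + 1),
    by positivity, (volume.real K).toNNReal * Lρ, fun ε hε => ?_⟩
  obtain ⟨φ, hφA, hφc, hφt⟩ := hφ (ε / (1 + J)) (by positivity)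
  have hφs := cs_of_zero hK hφA.2.2.2
  have hφi : Integrable φ := hφA.1.continuous.integrable_of_hasCompactSupport hφs
  have hφcont := hφA.1.continuous
  have hψsm := moll_smooth hφcont hρ hρc
  have hψ0 : ∀ x, 0 ≤ moll φ ρ x := fun x => integral_nonneg fun y => mul_nonneg (hφA.2.1 y) (hρ0 _)
  have hne0 : ∀ x y, φ y * ρ (x - y) ≠ 0 → y ∈ K ∧ ‖x - y‖ ≤ δ := by
    intro x y h
    refine ⟨?_, hρs _ (right_ne_zero_of_mul h)⟩
    by_contra h1
    exact left_ne_zero_of_mul h (hφA.2.2.2 y h1)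
  have hψs : ∀ x, moll φ ρ x ≠ 0 → x ∈ K' := by
    intro x hx
    by_contra h
    apply hx
    unfold moll
    refine integral_eq_zero_of_ae (Eventually.of_forall fun y => ?_)
    by_contra h2
    obtain ⟨h3, h4⟩ := hne0 x y h2
    exact h (mem_cthickening_of_dist_le x y δ K h3 (by rwa [dist_eq_norm]))
  have hintg : ∀ x, Integrable (fun y => φ y * ρ (x - y)) := fun x =>
    Continuous.integrable_of_hasCompactSupport (by have := hρ.continuous; fun_prop) hφs.mul_right
  refine ⟨moll φ ρ, hψsm, hψ0, hψs, ?_, ?_, ?_⟩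
  · intro x
    by_cases hx : x ∈ K'
    swap
    · have h1 : x ∉ tsupport (moll φ ρ) := fun h =>
        hx (closure_minimal (fun y hy => hψs y hy) hK'c.isClosed h)
      rw [lap_zero_of_notMem h1]
      have : 0 ≤ M * ((‖x‖ ^ 2)⁻¹ * moll φ ρ x) :=
        mul_nonneg (by linarith) (mul_nonneg (by positivity) (hψ0 x))
      linarith
    set η : Euc N → ℝ := fun y => ρ (x - y) with hη
    have hηe : η = fun y => ρ (y - x) := by
      ext y; rw [hη]; simp only; rw [← hρn, neg_sub]
    have hηsm : ContDiff ℝ (⊤ : ℕ∞) η := hρ.comp (contDiff_const.sub contDiff_id)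
    have hηc : HasCompactSupport η := hρc.comp_homeomorph (Homeomorph.subLeft x)
    have hlap : ∀ y, lap ρ (x - y) = lap η y := by
      intro y
      rw [hηe, lap_comp_sub, ← neg_sub y x, ← lap_neg_arg]
      simp_rw [hρn]
    have hgrad : ∫ y, ‖gradient η y‖ ^ 2 = J := by
      have h1 : ∀ y, gradient η y = gradient ρ (y - x) := by
        intro y
        unfold gradient
        rw [hηe, fderiv_comp_sub]
      simp_rw [h1]
      exact integral_sub_right_eq_self (fun y => ‖gradient ρ y‖ ^ 2) x
    have h1 : - lap (moll φ ρ) x = ∫ y, inner ℝ (gradient φ y) (gradient η y) := by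
      rw [moll_lap hφcont hρ hρc]
      simp_rw [hlap]
      rw [ibp_lap hφA.1 hφs (hηsm.of_le two_le_smooth), neg_neg]
    rw [h1]
    refine (hφt η (hηsm.of_le (by exact_mod_cast le_top)) hηc fun y => hρ0 _).trans ?_
    rw [hgrad, div_mul_cancel₀ _ (by positivity)]
    have h2 : M' * ∫ y, (‖y‖ ^ 2)⁻¹ * (φ y * η y) ≤ M * ((‖x‖ ^ 2)⁻¹ * moll φ ρ x) := by
      unfold moll
      rw [← integral_const_mul, ← integral_const_mul, ← integral_const_mul]
      refine integral_mono_of_nonneg (Eventually.of_forall fun y => ?_)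
        (((hintg x).const_mul _).const_mul _) (Eventually.of_forall fun y => ?_)
      · exact mul_nonneg hM'0.le (mul_nonneg (by positivity) (mul_nonneg (hφA.2.1 y) (hρ0 _)))
      · simp only
        by_cases hz : φ y * ρ (x - y) = 0
        · have : φ y * η y = 0 := hz
          rw [this]; simp
        obtain ⟨h3, h4⟩ := hne0 x y hz
        have hp : 0 ≤ φ y * ρ (x - y) := mul_nonneg (hφA.2.1 y) (hρ0 _)
        have hyd := hdK y h3
        have hxy : ‖x‖ ≤ ‖y‖ * (1 + t) := by
          have := norm_sub_norm_le x y
          nlinarith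
        have hx0 : 0 < ‖x‖ := by
          have := norm_sub_norm_le y x
          rw [norm_sub_rev] at this
          linarith
        have hy0 : 0 < ‖y‖ := by linarith
        have h5 : M' * (‖y‖ ^ 2)⁻¹ ≤ M * (‖x‖ ^ 2)⁻¹ := by
          rw [← div_eq_mul_inv, ← div_eq_mul_inv, div_le_div_iff₀ (by positivity) (by positivity)]
          calc M' * ‖x‖ ^ 2 ≤ M' * (‖y‖ * (1 + t)) ^ 2 := by gcongr
            _ = (M' * (1 + t) ^ 2) * ‖y‖ ^ 2 := by ring
            _ ≤ M * ‖y‖ ^ 2 := by gcongr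
        calc M' * ((‖y‖ ^ 2)⁻¹ * (φ y * η y)) = (M' * (‖y‖ ^ 2)⁻¹) * (φ y * ρ (x - y)) := by
              rw [hη]; ring
          _ ≤ (M * (‖x‖ ^ 2)⁻¹) * (φ y * ρ (x - y)) := by gcongr
          _ = _ := by ring
    linarith
  · refine LipschitzWith.of_dist_le_mul fun x x' => ?_
    rw [dist_eq_norm]
    unfold moll
    rw [← integral_sub (hintg x) (hintg x')]
    have h1 : (∫ y, (φ y * ρ (x - y) - φ y * ρ (x' - y))) =
        ∫ y in K, (φ y * ρ (x - y) - φ y * ρ (x' - y)) := by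
      rw [setIntegral_eq_integral_of_forall_compl_eq_zero]
      intro y hy; simp [hφA.2.2.2 y hy]
    rw [h1]
    have h2 := norm_setIntegral_le_of_norm_le_const (μ := volume) (s := K)
      (f := fun y => φ y * ρ (x - y) - φ y * ρ (x' - y)) (C := Lρ * dist x x') hK.measure_lt_top ?_
    · refine h2.trans (le_of_eq ?_)
      push_cast
      rw [Real.coe_toNNReal _ (by positivity)]
      ring
    · intro y hy
      rw [← mul_sub, norm_mul, Real.norm_of_nonneg (hφA.2.1 y)]
      have h3 := hLρ.dist_le_mul (x - y) (x' - y)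
      rw [dist_sub_right, dist_eq_norm] at h3
      have h4 := hφA.2.2.1 y
      have h5 := norm_nonneg (ρ (x - y) - ρ (x' - y))
      nlinarith
  · by_contra hcon
    push Not at hcon
    have h1 : ∫ x, moll φ ρ x = ∫ x, φ x := by
      rw [moll_integral hφi hρi, hρ1, mul_one]
    have h2 : ∫ x, moll φ ρ x = ∫ x in K', moll φ ρ x := by
      rw [setIntegral_eq_integral_of_forall_compl_eq_zero]
      intro x hx
      by_contra h; exact hx (hψs x h)
    have h3 : ∫ x in K', moll φ ρ x ≤ ∫ x in K', c / (volume.real K' + 1) := by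
      refine setIntegral_mono ?_ (integrableOn_const hK'c.measure_lt_top.ne) fun x => (hcon x).le
      exact hψsm.continuous.continuousOn.integrableOn_compact hK'c
    rw [setIntegral_const, smul_eq_mul] at h3
    have h4 : volume.real K' * (c / (volume.real K' + 1)) < c := by
      have : 0 ≤ volume.real K' := measureReal_nonneg
      rw [mul_div_assoc', div_lt_iff₀ (by positivity)]
      nlinarith
    linarith

end sub1

section sub2
variable {N : ℕ}

/-- Homogeneous approximate subsolutions. -/
structure SubSol (γ M ε : ℝ) (K : Set (Euc N)) (Ψ : Euc N → ℝ) : Prop where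
  smooth : ∀ x : Euc N, x ≠ 0 → ContDiffAt ℝ (⊤ : ℕ∞) Ψ x
  hom : ∀ l : ℝ, 0 < l → ∀ x, Ψ (l • x) = l ^ (-γ) * Ψ x
  nonneg : ∀ x, 0 ≤ Ψ x
  supp : ∀ x, Ψ x ≠ 0 → ∃ s : ℝ, 0 < s ∧ s • x ∈ K
  ineq : ∀ x, x ≠ 0 → - lap Ψ x ≤ M * ((‖x‖ ^ 2)⁻¹ * Ψ x) + ε * ‖x‖ ^ (-γ - 2)
  le_one : ∀ x, ‖x‖ = 1 → Ψ x ≤ 1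
  attained : ∃ x, ‖x‖ = 1 ∧ Ψ x = 1

lemma lap_const_mul (f : Euc N → ℝ) (a : ℝ) (x : Euc N) (hf : ContDiffAt ℝ 2 f x) :
    lap (fun y => a * f y) x = a * lap f x := by
  unfold lap
  rw [Finset.mul_sum]
  refine Finset.sum_congr rfl fun i _ => ?_
  have := iteratedFDeriv_const_smul_apply (𝕜 := ℝ) (i := 2) (a := a) (f := f) (x := x) (by exact_mod_cast hf)
  have h2 : (fun y => a * f y) = a • f := by ext; simp
  rw [h2, this]; simp

lemma sub2 {C : Set (Euc N)} (hC : IsOpen C) (hne : C.Nonempty) (h0 : (0 : Euc N) ∉ C)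
    {M γ : ℝ} (hγ : 0 ≤ γ) (hμ : 0 < hardyConst C) (hM : hardyConst C < M) :
    ∃ K : Set (Euc N), IsCompact K ∧ K ⊆ C ∧ ∀ ε, 0 < ε → ∃ Ψ, SubSol γ M ε K Ψ := by
  obtain ⟨K, hK, hKC, a, ha, L, hψ⟩ := sub1 hC hne h0 hμ hM
  have h0K : (0 : Euc N) ∉ K := fun h => h0 (hKC h)
  obtain ⟨d, hd, hdK⟩ := exists_lower_norm hK h0K
  obtain ⟨B₀, hB₀⟩ := hK.isBounded.exists_norm_le
  set B := max B₀ d with hB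
  have hBd : d ≤ B := le_max_right _ _
  have hBpos : 0 < B := hd.trans_le hBd
  have hBK : ∀ x ∈ K, ‖x‖ ≤ B := fun x hx => (hB₀ x hx).trans (le_max_left _ _)
  have hlog : 0 ≤ Real.log (B / d) := Real.log_nonneg ((one_le_div hd).2 hBd)
  set s0 := min 1 (a / (4 * (L + 1) * B)) with hs0
  have hs0p : 0 < s0 := lt_min one_pos (by positivity)
  have hs01 : s0 ≤ 1 := min_le_left _ _
  have hs02 : s0 * (4 * (L + 1) * B) ≤ a := by
    rw [← le_div_iff₀ (by positivity)]; exact min_le_right _ _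
  set b := 2 * s0 * (Real.exp (-γ) * (a / 2)) with hb
  have hbp : 0 < b := by positivity
  set m := d ^ γ * b with hm
  have hmp : 0 < m := by positivity
  refine ⟨K, hK, hKC, fun ε hε => ?_⟩
  set ε2 := ε * m / (B ^ (γ + 2) * (Real.log (B / d) + 1)) with hε2
  have heps_pos : 0 < ε2 := by positivity
  obtain ⟨ψ, hψs, hψ0, hψK, hψi, hψL, y, hy⟩ := hψ ε2 heps_pos
  have hz : ∀ x, ψ x ≠ 0 → d ≤ ‖x‖ ∧ ‖x‖ ≤ B := fun x hx => ⟨hdK x (hψK x hx), hBK x (hψK x hx)⟩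
  have hψc : Continuous ψ := hψs.continuous
  set Φ := hT γ ψ with hΦ
  have hΦ0 : ∀ x, 0 ≤ Φ x := fun x => integral_nonneg fun s => by
    simp only [smul_eq_mul]; exact mul_nonneg (Real.exp_pos _).le (hψ0 _)
  have hΦh : ∀ l : ℝ, 0 < l → ∀ x, Φ (l • x) = l ^ (-γ) * Φ x := fun l hl x => hT_homog γ ψ hl x
  have hΦsm : ∀ x : Euc N, x ≠ 0 → ContDiffAt ℝ (⊤ : ℕ∞) Φ x := fun x hx => hT_contDiffAt γ hψs hd hz hx
  have hyK : y ∈ K := hψK y (by linarith)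
  have hy0 : y ≠ 0 := fun h => h0K (h ▸ hyK)
  have hyn : 0 < ‖y‖ := norm_pos_iff.2 hy0
  -- lower bound at y
  have hΦy : b ≤ Φ y := by
    have hintg := hT_integrable γ hψc hd hz hy0
    have h1 : ∫ s in Set.Icc (-s0) s0, Real.exp (γ * s) • ψ (Real.exp s • y) ≤ Φ y :=
      setIntegral_le_integral hintg (Eventually.of_forall fun s => by
        simp only [smul_eq_mul]; exact mul_nonneg (Real.exp_pos _).le (hψ0 _))
    have h2 : ∫ s in Set.Icc (-s0) s0, (Real.exp (-γ) * (a / 2)) ≤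
        ∫ s in Set.Icc (-s0) s0, Real.exp (γ * s) • ψ (Real.exp s • y) := by
      refine setIntegral_mono_on (integrableOn_const (by simp)) hintg.integrableOn measurableSet_Icc ?_
      intro s hs
      rw [smul_eq_mul]
      have hsabs : |s| ≤ s0 := abs_le.2 ⟨hs.1, hs.2⟩
      have h3 : Real.exp (-γ) ≤ Real.exp (γ * s) := by
        rw [Real.exp_le_exp]
        nlinarith [hs.1]
      have h4 : a / 2 ≤ ψ (Real.exp s • y) := by
        have h5 := hψL.dist_le_mul (Real.exp s • y) y
        have h6 : dist (Real.exp s • y) y ≤ 2 * s0 * B := by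
          rw [dist_eq_norm]
          have : Real.exp s • y - y = (Real.exp s - 1) • y := by rw [sub_smul, one_smul]
          rw [this, norm_smul]
          have h7 := Real.abs_exp_sub_one_le (x := s) (hsabs.trans hs01)
          rw [Real.norm_eq_abs]
          calc |Real.exp s - 1| * ‖y‖ ≤ (2 * |s|) * B :=
                mul_le_mul h7 (hBK y hyK) (norm_nonneg _) (by positivity)
            _ ≤ 2 * s0 * B := by gcongr
        have h8 : (L : ℝ) * dist (Real.exp s • y) y ≤ a / 2 := by
          calc (L : ℝ) * dist (Real.exp s • y) y ≤ L * (2 * s0 * B) := by gcongr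
            _ ≤ a / 2 := by
              have : 0 ≤ s0 * B := by positivity
              nlinarith
        rw [Real.dist_eq] at h5
        have := (abs_le.1 (h5.trans h8)).1
        linarith
      exact mul_le_mul h3 h4 (by positivity) (Real.exp_pos _).le
    rw [setIntegral_const, smul_eq_mul, Real.volume_real_Icc_of_le (by linarith)] at h2
    calc b = (s0 - -s0) * (Real.exp (-γ) * (a / 2)) := by rw [hb]; ring
      _ ≤ _ := h2.trans h1
  have hΦy' : m ≤ Φ (‖y‖⁻¹ • y) := by
    rw [hΦh _ (by positivity), Real.rpow_neg (by positivity), Real.inv_rpow hyn.le, inv_inv, hm]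
    have : d ^ γ ≤ ‖y‖ ^ γ := Real.rpow_le_rpow hd.le (hdK y hyK) hγ
    exact mul_le_mul this hΦy hbp.le (by positivity)
  have hy1 : ‖y‖⁻¹ • y ∈ sphere (0 : Euc N) 1 := by
    simp [norm_smul, hyn.ne']
  obtain ⟨x', hx', hmax⟩ := (isCompact_sphere (0 : Euc N) 1).exists_isMaxOn ⟨_, hy1⟩
    (f := Φ) (fun x hx => (hΦsm x (by
      rintro rfl; simp at hx)).continuousAt.continuousWithinAt)
  set S := Φ x' with hS
  have hSm : m ≤ S := hΦy'.trans (hmax hy1)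
  have hSp : 0 < S := hmp.trans_le hSm
  refine ⟨fun x => S⁻¹ * Φ x, ?_, ?_, ?_, ?_, ?_, ?_, ?_⟩
  · intro x hx; exact contDiffAt_const.mul (hΦsm x hx)
  · intro l hl x; rw [hΦh l hl]; ring
  · intro x; exact mul_nonneg (by positivity) (hΦ0 x)
  · intro x hx
    by_contra hcon
    push Not at hcon
    apply right_ne_zero_of_mul hx
    refine integral_eq_zero_of_ae (Eventually.of_forall fun s => ?_)
    have : ψ (Real.exp s • x) = 0 := by
      by_contra h; exact hcon _ (Real.exp_pos s) (hψK _ h)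
    simp [this]
  · intro x hx
    have hxn : 0 < ‖x‖ := norm_pos_iff.2 hx
    rw [lap_const_mul _ _ _ ((hΦsm x hx).of_le two_le_smooth), hT_lap γ hψs hd hz hx]
    set I := Set.Icc (Real.log (d / ‖x‖)) (Real.log (B / ‖x‖)) with hI
    have hlint : Integrable (fun s : ℝ => Real.exp ((γ + 2) * s) • lap ψ (Real.exp s • x)) := by
      refine hT_integrable (γ + 2) (B := B) (lap_continuous (hψs.of_le two_le_smooth)) hd ?_ hx
      intro z hz0
      have h1 : fderiv ℝ (fderiv ℝ ψ) z ≠ 0 := by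
        intro h; apply hz0; rw [lap_eq_sum, h]; simp
      exact fderiv_supp (fderiv_supp hz) z h1
    have hψint := hT_integrable γ hψc hd hz hx
    have key : -hT (γ + 2) (lap ψ) x ≤ M * ((‖x‖ ^ 2)⁻¹ * Φ x) +
        ε2 * (Real.log (B / d) * (B / ‖x‖) ^ (γ + 2)) := by
      have hintI : Integrable (I.indicator fun _ : ℝ => ε2 * (B / ‖x‖) ^ (γ + 2)) := by
        rw [integrable_indicator_iff measurableSet_Icc]
        exact integrableOn_const (by simp [hI])
      have hI2 : ∫ s, I.indicator (fun _ : ℝ => ε2 * (B / ‖x‖) ^ (γ + 2)) s =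
          ε2 * (Real.log (B / d) * (B / ‖x‖) ^ (γ + 2)) := by
        have hle : Real.log (d / ‖x‖) ≤ Real.log (B / ‖x‖) :=
          Real.log_le_log (by positivity) (by gcongr)
        rw [integral_indicator measurableSet_Icc, setIntegral_const, smul_eq_mul,
          Real.volume_real_Icc_of_le hle,
          Real.log_div hBpos.ne' hxn.ne', Real.log_div hd.ne' hxn.ne', Real.log_div hBpos.ne' hd.ne']
        ring
      unfold hT at hΦ ⊢
      rw [hΦ, ← hI2, ← integral_neg]
      simp only []
      rw [← integral_const_mul, ← integral_const_mul, ← integral_add _ hintI]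
      · refine integral_mono hlint.neg (((hψint.const_mul _).const_mul _).add hintI) fun s => ?_
        simp only [smul_eq_mul, Pi.add_apply, Pi.neg_apply]
        have he : (0:ℝ) < Real.exp s := Real.exp_pos s
        have h2 : Real.exp ((γ + 2) * s) = Real.exp (γ * s) * Real.exp s ^ 2 := by
          rw [← Real.exp_nat_mul, ← Real.exp_add]; congr 1; push_cast; ring
        by_cases hs : s ∈ I
        · rw [Set.indicator_of_mem hs]
          have h1 := hψi (Real.exp s • x)
          rw [norm_smul, Real.norm_of_nonneg he.le] at h1
          have h3 : Real.exp ((γ + 2) * s) ≤ (B / ‖x‖) ^ (γ + 2) := by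
            rw [mul_comm, Real.exp_mul]
            refine Real.rpow_le_rpow he.le ?_ (by linarith)
            rw [← Real.le_log_iff_exp_le (by positivity)]; exact hs.2
          have h4 : Real.exp ((γ + 2) * s) * (M * (((Real.exp s * ‖x‖) ^ 2)⁻¹ * ψ (Real.exp s • x))) =
              M * ((‖x‖ ^ 2)⁻¹ * (Real.exp (γ * s) * ψ (Real.exp s • x))) := by
            rw [h2]; field_simp
          have h5 := mul_le_mul_of_nonneg_left h1 (Real.exp_pos ((γ + 2) * s)).le
          nlinarith
        · rw [Set.indicator_of_notMem hs]
          have h1 : lap ψ (Real.exp s • x) = 0 := by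
            by_contra hz0
            have h1 : fderiv ℝ (fderiv ℝ ψ) (Real.exp s • x) ≠ 0 := by
              intro h; apply hz0; rw [lap_eq_sum, h]; simp
            have h6 := fderiv_supp (fderiv_supp hz) _ h1
            exact hs (mem_Icc_of_annulus hd hxn hxn le_rfl le_rfl h6.1 h6.2)
          rw [h1]
          have : 0 ≤ M * ((‖x‖ ^ 2)⁻¹ * (Real.exp (γ * s) * ψ (Real.exp s • x))) :=
            mul_nonneg (by linarith) (mul_nonneg (by positivity)
              (mul_nonneg (Real.exp_pos _).le (hψ0 _)))
          linarith
      · exact (hψint.const_mul _).const_mul _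
    have hfin : S⁻¹ * (ε2 * (Real.log (B / d) * (B / ‖x‖) ^ (γ + 2))) ≤ ε * ‖x‖ ^ (-γ - 2) := by
      have e1 : (B / ‖x‖) ^ (γ + 2) = B ^ (γ + 2) * ‖x‖ ^ (-γ - 2) := by
        rw [Real.div_rpow hBpos.le hxn.le, div_eq_mul_inv, ← Real.rpow_neg hxn.le]; congr 2; ring
      rw [e1, inv_mul_le_iff₀ hSp]
      have e2 : ε2 * ((Real.log (B / d) + 1) * (B ^ (γ + 2) * ‖x‖ ^ (-γ - 2))) =
          m * (ε * ‖x‖ ^ (-γ - 2)) := by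
        rw [hε2]; field_simp
      have hP : 0 ≤ B ^ (γ + 2) * ‖x‖ ^ (-γ - 2) := by positivity
      have hQ : 0 ≤ ε * ‖x‖ ^ (-γ - 2) := by positivity
      calc ε2 * (Real.log (B / d) * (B ^ (γ + 2) * ‖x‖ ^ (-γ - 2)))
          ≤ ε2 * ((Real.log (B / d) + 1) * (B ^ (γ + 2) * ‖x‖ ^ (-γ - 2))) := by
            gcongr; linarith
        _ = m * (ε * ‖x‖ ^ (-γ - 2)) := e2
        _ ≤ S * (ε * ‖x‖ ^ (-γ - 2)) := by gcongr
    have h9 := mul_le_mul_of_nonneg_left key (inv_nonneg.2 hSp.le)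
    nlinarith
  · intro x hx
    rw [inv_mul_le_iff₀ hSp, mul_one]
    exact hmax (by simpa using hx)
  · exact ⟨x', by simpa using hx', inv_mul_cancel₀ hSp.ne'⟩

end sub2

section supL1
variable {N : ℕ}

lemma inner_int_comm (f g : Euc N → ℝ) : ∫ x, inner ℝ (gradient f x) (gradient g x) =
    ∫ x, inner ℝ (gradient g x) (gradient f x) := by
  simp_rw [real_inner_comm]

lemma green {φ η : Euc N → ℝ} (hφ : ContDiff ℝ 2 φ) (hφc : HasCompactSupport φ)
    (hη : ContDiff ℝ 2 η) (hηc : HasCompactSupport η) : ∫ x, η x * lap φ x = ∫ x, φ x * lap η x := by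
  rw [ibp_lap (hη.of_le (by norm_num)) hηc hφ, ibp_lap (hφ.of_le (by norm_num)) hφc hη, inner_int_comm]

/-- annulus -/
def annu (N : ℕ) (r : ℝ) : Set (Euc N) := {x | r / 2 ≤ ‖x‖ ∧ ‖x‖ ≤ 3 * r / 2}

lemma annu_closed (r : ℝ) : IsClosed (annu N r) :=
  (isClosed_le continuous_const continuous_norm).inter (isClosed_le continuous_norm continuous_const)

lemma annu_compact (r : ℝ) : IsCompact (annu N r) := by
  refine (isCompact_closedBall (0 : Euc N) (3 * r / 2)).of_isClosed_subset (annu_closed r) ?_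
  intro x hx; simpa using hx.2

lemma SubSol.eq_hom {γ M ε : ℝ} {K : Set (Euc N)} {Ψ : Euc N → ℝ} (h : SubSol γ M ε K Ψ)
    {x : Euc N} (hx : x ≠ 0) : Ψ x = ‖x‖ ^ (-γ) * Ψ (‖x‖⁻¹ • x) := by
  have hxn : 0 < ‖x‖ := norm_pos_iff.2 hx
  rw [← h.hom _ hxn, smul_smul, mul_inv_cancel₀ hxn.ne', one_smul]

lemma SubSol.le {γ M ε : ℝ} {K : Set (Euc N)} {Ψ : Euc N → ℝ} (h : SubSol γ M ε K Ψ)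
    {x : Euc N} (hx : x ≠ 0) : Ψ x ≤ ‖x‖ ^ (-γ) := by
  have hxn : 0 < ‖x‖ := norm_pos_iff.2 hx
  rw [h.eq_hom hx]
  have h1 := h.le_one (‖x‖⁻¹ • x) (by simp [norm_smul, hxn.ne'])
  have : 0 ≤ ‖x‖ ^ (-γ) := by positivity
  nlinarith

lemma SubSol.continuousOn {γ M ε : ℝ} {K : Set (Euc N)} {Ψ : Euc N → ℝ} (h : SubSol γ M ε K Ψ)
    {r : ℝ} (hr : 0 < r) : ContinuousOn Ψ (annu N r) := by
  intro x hx
  have : x ≠ 0 := by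
    rintro rfl
    have := hx.1
    simp at this; linarith
  exact (h.smooth x this).continuousAt.continuousWithinAt

lemma sup_L1 [NeZero N] {γ M0 r : ℝ} (hγ : 0 ≤ γ) (hM0 : 0 ≤ M0) (hr : 0 < r) :
    ∃ c2, 0 < c2 ∧ ∀ (M ε : ℝ) (K : Set (Euc N)) (Ψ : Euc N → ℝ), M ≤ M0 → ε ≤ 1 →
      SubSol γ M ε K Ψ → c2 ≤ ∫ x in annu N r, Ψ x := by
  set Q := M0 * (((r / 2) ^ 2)⁻¹ * (r / 2) ^ (-γ)) + (r / 2) ^ (-γ - 2) with hQ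
  have hQ0 : 0 ≤ Q := by positivity
  set m := mvM N with hm
  have hmp : 0 < m := mvM_pos N
  have hc0 : 0 ≤ mvc N := mvc_nonneg N
  set e2 := min (r / 8) (min 1 (m * r ^ (-γ) / (2 * (Q * mvc N + 1)))) with he2
  have he2p : 0 < e2 := lt_min (by positivity) (lt_min one_pos (by positivity))
  have he21 : e2 ≤ r / 8 := min_le_left _ _
  have he22 : e2 ≤ 1 := (min_le_right _ _).trans (min_le_left _ _)
  have he23 : e2 * (2 * (Q * mvc N + 1)) ≤ m * r ^ (-γ) := by
    rw [← le_div_iff₀ (by positivity)]; exact (min_le_right _ _).trans (min_le_right _ _)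
  refine ⟨e2 ^ N * (m * r ^ (-γ) / 4), by positivity, ?_⟩
  intro M ε K Ψ hM hε hΨ
  obtain ⟨xs, hxs, hxs1⟩ := hΨ.attained
  set A := annu N r with hA
  set w := A.indicator (fun x => -Ψ x) with hw
  have hΨA : IntegrableOn Ψ A := (hΨ.continuousOn hr).integrableOn_compact (annu_compact r)
  have hwi : Integrable w := (integrable_indicator_iff (annu_closed r).measurableSet).2 hΨA.neg
  have hz0 : r • xs ≠ 0 := by
    intro h
    have : ‖r • xs‖ = r := by rw [norm_smul, hxs, Real.norm_of_nonneg hr.le, mul_one]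
    rw [h, norm_zero] at this; linarith
  have hΨz : Ψ (r • xs) = r ^ (-γ) := by rw [hΨ.hom r hr, hxs1, mul_one]
  have hnear : ∀ᶠ x in 𝓝 (r • xs), 3 / 4 * r ^ (-γ) < Ψ x ∧ ‖x - r • xs‖ < r / 8 := by
    refine ((hΨ.smooth _ hz0).continuousAt.eventually (lt_mem_nhds ?_)).and ?_
    · rw [hΨz]; have : 0 < r ^ (-γ) := by positivity
      linarith
    · have := ball_mem_nhds (r • xs) (show 0 < r / 8 by positivity)
      filter_upwards [this] with x hx
      rwa [mem_ball, dist_eq_norm] at hx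
  obtain ⟨x, ⟨hx1, hx2⟩, hmv⟩ : ∃ x, (3 / 4 * r ^ (-γ) < Ψ x ∧ ‖x - r • xs‖ < r / 8) ∧
      (∀ e0 Q, (∀ φ, IsTestFun (ball x e0) φ → (∀ y, 0 ≤ φ y) → ∫ y, w y * lap φ y ≤ Q * ∫ y, φ y) →
        ∀ e2, 0 < e2 → e2 < e0 → ∫ y, w y * mvK x e2 y ≤ mvM N * w x + Q * mvc N * e2 ^ 2 / 2) := by
    obtain ⟨V, hV, hVo, hVx⟩ := _root_.eventually_nhds_iff.1 hnear
    by_contra hcon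
    push Not at hcon
    have h1 : V ⊆ {x | ¬ ∀ e0 Q, (∀ φ, IsTestFun (ball x e0) φ → (∀ y, 0 ≤ φ y) →
        ∫ y, w y * lap φ y ≤ Q * ∫ y, φ y) → ∀ e2, 0 < e2 → e2 < e0 →
        ∫ y, w y * mvK x e2 y ≤ mvM N * w x + Q * mvc N * e2 ^ 2 / 2} := by
      intro x hx hall
      obtain ⟨e0, Q, ha, e2, hb, hc, hd⟩ := hcon x (hV x hx)
      exact absurd (hall e0 Q ha e2 hb hc) (not_le.2 hd)
    have h2 := measure_mono_null h1 (ae_iff.1 (mv_final hwi))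
    exact (hVo.measure_pos volume ⟨_, hVx⟩).ne' h2
  have hnz : ‖r • xs‖ = r := by rw [norm_smul, hxs, Real.norm_of_nonneg hr.le, mul_one]
  have hxn1 : 7 * r / 8 < ‖x‖ := by
    have := norm_sub_norm_le (r • xs) x
    rw [norm_sub_rev] at this; linarith
  have hxn2 : ‖x‖ < 9 * r / 8 := by
    have := norm_sub_norm_le x (r • xs)
    linarith
  have hball : ball x (r / 4) ⊆ A := by
    intro y hy
    rw [mem_ball, dist_eq_norm] at hy
    constructor
    · have := norm_sub_norm_le x y
      rw [norm_sub_rev] at this; linarith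
    · have := norm_sub_norm_le y x
      linarith
  have hA0 : ∀ y ∈ A, y ≠ 0 := by
    rintro y hy rfl
    have := hy.1
    simp at this; linarith
  have htest : ∀ φ, IsTestFun (ball x (r / 4)) φ → (∀ y, 0 ≤ φ y) →
      ∫ y, w y * lap φ y ≤ Q * ∫ y, φ y := by
    intro φ hφ hφ0
    let b : ContDiffBump x := ⟨r / 4, r / 2, by positivity, by linarith⟩
    set Ψ' := fun y => b y * Ψ y with hΨ'
    have hts : tsupport Ψ' ⊆ closedBall x (r / 2) := by
      refine closure_minimal (fun y hy => ?_) isClosed_closedBall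
      have h1 : y ∈ Function.support b := left_ne_zero_of_mul hy
      rw [b.support_eq] at h1
      exact ball_subset_closedBall h1
    have hPsm : ContDiff ℝ 2 Ψ' := by
      apply contDiff_of_tsupp
      intro y hy
      have h1 := hts hy
      have hy0 : y ≠ 0 := by
        rintro rfl
        rw [mem_closedBall, dist_eq_norm, zero_sub, norm_neg] at h1
        linarith
      exact b.contDiff.contDiffAt.mul ((hΨ.smooth y hy0).of_le two_le_smooth)
    have hPsc : HasCompactSupport Ψ' :=
      (isCompact_closedBall x (r / 2)).of_isClosed_subset (isClosed_tsupport _) hts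
    have hφ2 : ContDiff ℝ 2 φ := hφ.1.of_le two_le_smooth
    have e0 : ∀ y ∈ ball x (r / 4), b y = 1 := fun y hy =>
      b.one_of_mem_closedBall (ball_subset_closedBall hy)
    have e1 : ∀ y, w y * lap φ y = -(Ψ' y * lap φ y) := by
      intro y
      by_cases hy : y ∈ ball x (r / 4)
      · rw [hw, Set.indicator_of_mem (hball hy), hΨ']
        simp only
        rw [e0 y hy]; ring
      · rw [lap_zero_of_notMem (fun h => hy (hφ.2.2 h))]; simp
    have hwb : ∀ y ∈ A, - lap Ψ y ≤ Q := by
      intro y hy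
      have hyn : 0 < ‖y‖ := norm_pos_iff.2 (hA0 y hy)
      have hr2 : 0 < r / 2 := by positivity
      refine (hΨ.ineq y (hA0 y hy)).trans ?_
      have h1 : ‖y‖ ^ (-γ) ≤ (r / 2) ^ (-γ) :=
        Real.rpow_le_rpow_of_nonpos hr2 hy.1 (by linarith)
      have h2 : ‖y‖ ^ (-γ - 2) ≤ (r / 2) ^ (-γ - 2) :=
        Real.rpow_le_rpow_of_nonpos hr2 hy.1 (by linarith)
      have h3 : (‖y‖ ^ 2)⁻¹ ≤ ((r / 2) ^ 2)⁻¹ := by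
        have := hy.1
        gcongr
      have h4 : (‖y‖ ^ 2)⁻¹ * Ψ y ≤ ((r / 2) ^ 2)⁻¹ * (r / 2) ^ (-γ) :=
        mul_le_mul h3 ((hΨ.le (hA0 y hy)).trans h1) (hΨ.nonneg y) (by positivity)
      have h5 : 0 ≤ (‖y‖ ^ 2)⁻¹ * Ψ y := mul_nonneg (by positivity) (hΨ.nonneg y)
      have h6 : M * ((‖y‖ ^ 2)⁻¹ * Ψ y) ≤ M0 * (((r / 2) ^ 2)⁻¹ * (r / 2) ^ (-γ)) :=
        (mul_le_mul_of_nonneg_right hM h5).trans (mul_le_mul_of_nonneg_left h4 hM0)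
      have h7 : ε * ‖y‖ ^ (-γ - 2) ≤ 1 * ‖y‖ ^ (-γ - 2) :=
        mul_le_mul_of_nonneg_right hε (by positivity)
      linarith
    have hφi : Integrable φ := hφ.1.continuous.integrable_of_hasCompactSupport hφ.2.1
    simp_rw [e1]
    rw [integral_neg, green hφ2 hφ.2.1 hPsm hPsc, ← integral_neg, ← integral_const_mul]
    refine integral_mono ?_ (hφi.const_mul Q) fun y => ?_
    · refine Integrable.neg ?_
      refine Continuous.integrable_of_hasCompactSupport ?_ hφ.2.1.mul_right
      exact hφ.1.continuous.mul (lap_continuous hPsm)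
    · by_cases hy : y ∈ ball x (r / 4)
      · have h1 : lap Ψ' y = lap Ψ y := by
          apply lap_congr
          filter_upwards [isOpen_ball.mem_nhds hy] with z hz
          rw [hΨ']; simp only; rw [e0 z hz, one_mul]
        have h2 := hwb y (hball hy)
        simp only
        rw [h1]
        nlinarith [hφ0 y]
      · have : φ y = 0 := by
          by_contra h
          exact hy (hφ.2.2 (subset_tsupport _ h))
        simp [this]
  have hfin := hmv (r / 4) Q htest e2 he2p (by linarith)
  have hxA : x ∈ A := hball (mem_ball_self (by positivity))
  have hwx : w x = -Ψ x := by rw [hw, Set.indicator_of_mem hxA]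
  have hlow : -((e2 ^ N)⁻¹ * ∫ y in A, Ψ y) ≤ ∫ y, w y * mvK x e2 y := by
    rw [← integral_indicator (annu_closed r).measurableSet, ← integral_const_mul, ← integral_neg]
    have hΨAi : Integrable (A.indicator Ψ) :=
      (integrable_indicator_iff (annu_closed r).measurableSet).2 hΨA
    refine integral_mono (hΨAi.const_mul _).neg (mvK_bdd_mul hwi x he2p) fun y => ?_
    simp only
    by_cases hy : y ∈ A
    · rw [hw, Set.indicator_of_mem hy, Set.indicator_of_mem hy]
      have := mvK_le x he2p y
      nlinarith [hΨ.nonneg y]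
    · rw [hw, Set.indicator_of_notMem hy, Set.indicator_of_notMem hy]; simp
  rw [hwx] at hfin
  have hrp : 0 < r ^ (-γ) := by positivity
  have h1 : Q * mvc N * e2 ^ 2 / 2 ≤ m * r ^ (-γ) / 4 := by
    have : 0 ≤ Q * mvc N := by positivity
    have h2 : e2 ^ 2 ≤ e2 := by nlinarith
    nlinarith [mul_le_mul_of_nonneg_left h2 this]
  have h2 : m * r ^ (-γ) / 4 ≤ (e2 ^ N)⁻¹ * ∫ y in A, Ψ y := by
    have h3 := mul_lt_mul_of_pos_left hx1 hmp
    have h4 : 0 < m * r ^ (-γ) := by positivity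
    rw [← hm] at hfin
    linarith
  rwa [le_inv_mul_iff₀ (by positivity)] at h2

end supL1

section oneD

lemma st_derivs : ∃ (s1 s2 : ℝ → ℝ) (B : ℝ), 0 ≤ B ∧
    (∀ x, HasDerivAt Real.smoothTransition (s1 x) x) ∧ (∀ x, HasDerivAt s1 (s2 x) x) ∧
    (∀ x, 0 ≤ s1 x) ∧ (∀ x, s1 x ≤ B) ∧ (∀ x, |s2 x| ≤ B) ∧
    (∀ x, 1 < x → s1 x = 0 ∧ s2 x = 0) := by
  have hc : ContDiff ℝ (⊤ : ℕ∞) Real.smoothTransition := Real.smoothTransition.contDiff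
  have h1 := (contDiff_infty_iff_deriv.1 hc)
  have h2 := (contDiff_infty_iff_deriv.1 h1.2)
  have hz : ∀ x, (1 < x ∨ x < 0) → deriv Real.smoothTransition =ᶠ[𝓝 x] fun _ => 0 := by
    intro x hx
    rcases hx with hx | hx
    · filter_upwards [isOpen_Ioi.mem_nhds hx] with y hy
      have : Real.smoothTransition =ᶠ[𝓝 y] fun _ => 1 := by
        filter_upwards [isOpen_Ioi.mem_nhds hy] with z hz
        exact Real.smoothTransition.one_of_one_le (le_of_lt hz)
      rw [this.deriv_eq]; simp
    · filter_upwards [isOpen_Iio.mem_nhds hx] with y hy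
      have : Real.smoothTransition =ᶠ[𝓝 y] fun _ => 0 := by
        filter_upwards [isOpen_Iio.mem_nhds hy] with z hz
        exact Real.smoothTransition.zero_of_nonpos (le_of_lt hz)
      rw [this.deriv_eq]; simp
  have hz2 : ∀ x, (1 < x ∨ x < 0) → deriv (deriv Real.smoothTransition) x = 0 := by
    intro x hx
    rw [(hz x hx).deriv_eq]; simp
  have hb : ∀ f : ℝ → ℝ, Continuous f → (∀ x, (1 < x ∨ x < 0) → f x = 0) →
      ∃ B, 0 ≤ B ∧ ∀ x, |f x| ≤ B := by
    intro f hf h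
    obtain ⟨B, hB⟩ := isCompact_Icc.exists_bound_of_continuousOn (s := Set.Icc (0 : ℝ) 1)
      hf.continuousOn
    refine ⟨max B 0, le_max_right _ _, fun x => ?_⟩
    by_cases hx : 1 < x ∨ x < 0
    · rw [h x hx]; simp
    · push Not at hx
      exact (hB x ⟨hx.2, hx.1⟩).trans (le_max_left _ _)
  obtain ⟨B1, hB1, hb1⟩ := hb _ h1.2.continuous (fun x hx => (hz x hx).eq_of_nhds)
  obtain ⟨B2, hB2, hb2⟩ := hb _ (contDiff_infty_iff_deriv.1 h1.2).2.continuous hz2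
  refine ⟨deriv Real.smoothTransition, deriv (deriv Real.smoothTransition), max B1 B2,
    hB1.trans (le_max_left _ _), fun x => (h1.1 x).hasDerivAt, fun x => (h2.1 x).hasDerivAt,
    fun x => Real.smoothTransition.monotone.deriv_nonneg, ?_, ?_, ?_⟩
  · intro x
    exact (le_abs_self _).trans ((hb1 x).trans (le_max_left _ _))
  · intro x
    exact (hb2 x).trans (le_max_right _ _)
  · intro x hx
    exact ⟨(hz x (Or.inl hx)).eq_of_nhds, hz2 x (Or.inl hx)⟩

lemma kS {D : ℝ} (hD : 0 ≤ D) : ∃ S g g1 : ℝ → ℝ, ContDiff ℝ (⊤ : ℕ∞) S ∧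
    (∀ x, HasDerivAt S (g x) x) ∧ (∀ x, HasDerivAt g (g1 x) x) ∧ (∀ x, 0 ≤ x → 0 ≤ g x ∧ g x ≤ 1) ∧
    (∀ x, 0 ≤ g1 x + 2 * D * g x) ∧ (∀ x, x ≤ 0 → S x = 0 ∧ g x = 0) ∧ (∀ x, 0 ≤ S x) ∧
    (∀ x, 0 ≤ x → S x ≤ x) ∧ Monotone S ∧ 0 < S 1 ∧ (∀ x, 0 ≤ x → 2 * D * S x ≤ 1) := by
  obtain ⟨s1, s2, B, -, hs1, -, hs10, -, -, -⟩ := st_derivs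
  set g : ℝ → ℝ := fun x => Real.exp (-(2 * D * x)) * Real.smoothTransition x with hg
  have hgs : ContDiff ℝ (⊤ : ℕ∞) g := by
    apply ContDiff.mul _ Real.smoothTransition.contDiff
    fun_prop
  have hS : ∀ x, HasDerivAt (fun y => ∫ s in (0:ℝ)..y, g s) (g x) x := fun x =>
    (hgs.continuous.integral_hasStrictDerivAt 0 x).hasDerivAt
  have he : ∀ x, HasDerivAt (fun x => Real.exp (-(2 * D * x))) (-(2*D) * Real.exp (-(2 * D * x))) x := by
    intro x
    have := (((hasDerivAt_id x).const_mul (2 * D)).neg).exp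
    refine this.congr_deriv ?_
    simp; ring
  have hg0 : ∀ x, 0 ≤ g x := fun x => mul_nonneg (Real.exp_pos _).le (Real.smoothTransition.nonneg x)
  have hge : ∀ x, g x ≤ Real.exp (-(2 * D * x)) := fun x => by
    simpa using mul_le_mul_of_nonneg_left (Real.smoothTransition.le_one x) (Real.exp_pos (-(2*D*x))).le
  have hg1 : ∀ x, 0 ≤ x → g x ≤ 1 := fun x hx => (hge x).trans (by
    rw [Real.exp_le_one_iff]; nlinarith [mul_nonneg hD hx])
  have hgz : ∀ x, x ≤ 0 → g x = 0 := fun x hx => by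
    simp [hg, Real.smoothTransition.zero_of_nonpos hx]
  set S : ℝ → ℝ := fun y => ∫ s in (0:ℝ)..y, g s with hSd
  have hmono : Monotone S := monotone_of_deriv_nonneg (fun x => (hS x).differentiableAt)
    (fun x => by rw [(hS x).deriv]; exact hg0 x)
  have hS0 : S 0 = 0 := by simp [hSd]
  have hSz : ∀ x, x ≤ 0 → S x = 0 := by
    intro x hx
    have : ∀ s ∈ Set.uIcc 0 x, g s = 0 := by
      intro s hs
      rw [Set.uIcc_of_ge hx] at hs
      exact hgz s hs.2
    rw [hSd]; simp only
    rw [intervalIntegral.integral_congr (g := fun _ => (0:ℝ)) this]; simp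
  have hSn : ∀ x, 0 ≤ S x := by
    intro x
    rcases le_total x 0 with h | h
    · exact (hSz x h).ge
    · rw [← hS0]; exact hmono h
  refine ⟨S, g, fun x => (-(2*D) * Real.exp (-(2 * D * x))) * Real.smoothTransition x
      + Real.exp (-(2 * D * x)) * s1 x, ?_, hS, fun x => (he x).mul (hs1 x),
      fun x hx => ⟨hg0 x, hg1 x hx⟩, ?_, fun x hx => ⟨hSz x hx, hgz x hx⟩, hSn, ?_, hmono, ?_, ?_⟩
  · rw [contDiff_infty_iff_deriv]
    refine ⟨fun x => (hS x).differentiableAt, ?_⟩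
    rwa [show deriv S = g from funext fun x => (hS x).deriv]
  · intro x
    have : 0 ≤ Real.exp (-(2 * D * x)) * s1 x := mul_nonneg (Real.exp_pos _).le (hs10 x)
    simp only [hg]; nlinarith
  · intro x hx
    have hm : MonotoneOn (fun y => y - S y) (Set.Ici 0) := by
      apply monotoneOn_of_deriv_nonneg (convex_Ici 0)
      · exact fun y _ => ((hasDerivAt_id y).sub (hS y)).continuousAt.continuousWithinAt
      · exact fun y _ => ((hasDerivAt_id y).sub (hS y)).differentiableAt.differentiableWithinAt
      · intro y hy
        simp only [interior_Ici, Set.mem_Ioi] at hy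
        have := ((hasDerivAt_id y).sub (hS y)).deriv
        have h2 := hg1 y hy.le
        have e : (fun y => y - S y) = (id - S) := rfl
        rw [e, this]; linarith
    have := hm (Set.self_mem_Ici) hx hx
    simp only [hS0] at this; linarith
  · rw [hSd]; simp only
    apply intervalIntegral.intervalIntegral_pos_of_pos_on
    · exact hgs.continuous.intervalIntegrable _ _
    · intro x hx
      exact mul_pos (Real.exp_pos _) (Real.smoothTransition.pos_of_pos hx.1)
    · norm_num
  · intro x hx
    have hd : ∀ y, HasDerivAt (fun y => (1 - Real.exp (-(2*D*y))) - 2 * D * S y)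
        ((0 - (-(2*D) * Real.exp (-(2 * D * y)))) - 2 * D * g y) y := fun y =>
      ((hasDerivAt_const y 1).sub (he y)).sub ((hS y).const_mul _)
    have hm : Monotone (fun y => (1 - Real.exp (-(2*D*y))) - 2 * D * S y) := by
      apply monotone_of_deriv_nonneg (fun y => (hd y).differentiableAt)
      intro y
      rw [(hd y).deriv]
      nlinarith [hge y]
    have := hm hx
    simp only [hS0] at this
    simp at this
    nlinarith [Real.exp_pos (-(2*D*x))]

lemma kfun {D p : ℝ} (hD : 0 ≤ D) (hp : 1 < p) : ∃ C c0 : ℝ, 0 < C ∧ 0 < c0 ∧ ∀ T, 1 ≤ T →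
    ∃ k k1 k2 : ℝ → ℝ, ContDiff ℝ (⊤ : ℕ∞) k ∧ (∀ x, HasDerivAt k (k1 x) x) ∧
      (∀ x, HasDerivAt k1 (k2 x) x) ∧ (∀ x, 0 ≤ k x) ∧
      (∀ x, k x ≠ 0 → 0 ≤ x ∧ x ≤ 2 * T) ∧ (∀ x, 1 ≤ x → x ≤ T → c0 ≤ k x) ∧
      (∀ x, k x ≤ 2 * T) ∧ (∀ x, - k2 x - 2 * D * k1 x ≤ C / T * k x ^ (1 / p)) := by
  obtain ⟨s1, s2, B, hB, hs1, hs2, hs10, hs1B, hs2B, hsz⟩ := st_derivs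
  obtain ⟨S, g, g1, hS, hSd, hgd, hg, hg1, hz, hS0, hSx, hSm, hS1, hDS⟩ := kS hD
  obtain ⟨n, hn⟩ := exists_nat_ge (max 1 (2 / (p - 1)))
  have hn1 : (1:ℝ) ≤ n := (le_max_left _ _).trans hn
  have hn1' : 1 ≤ n := by exact_mod_cast hn1
  have hn2 : ((n:ℝ) + 2) ≤ n * p := by
    have h := (le_max_right _ _).trans hn
    rw [div_le_iff₀ (by linarith)] at h; linarith
  have hc0p : 0 < S 1 ^ (1/p) := Real.rpow_pos_of_pos hS1 _
  refine ⟨((n:ℝ) + 2) * (5 * B + 1) / S 1 ^ (1/p), S 1, by positivity, hS1, fun T hT => ?_⟩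
  have hT0 : 0 < T := by linarith
  set χ : ℝ → ℝ := fun x => Real.smoothTransition (2 - x / T) with hχ
  set χ1 : ℝ → ℝ := fun x => - (s1 (2 - x / T) / T) with hχ1
  set χ2 : ℝ → ℝ := fun x => s2 (2 - x / T) / T ^ 2 with hχ2
  have hl : ∀ x, HasDerivAt (fun x => 2 - x / T) (-(1 / T)) x := fun x => by
    have := ((hasDerivAt_id x).div_const T).const_sub 2
    exact this
  have hd1 : ∀ x, HasDerivAt χ (χ1 x) x := fun x => by
    have := (hs1 (2 - x / T)).comp x (hl x)
    refine this.congr_deriv ?_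
    simp only [hχ1]; ring
  have hd2 : ∀ x, HasDerivAt χ1 (χ2 x) x := fun x => by
    have := (((hs2 (2 - x / T)).comp x (hl x)).div_const T).neg
    refine this.congr_deriv ?_
    simp only [hχ2]; field_simp
  have hχ0 : ∀ x, 0 ≤ χ x := fun x => Real.smoothTransition.nonneg _
  have hχle : ∀ x, χ x ≤ 1 := fun x => Real.smoothTransition.le_one _
  have hχs : ContDiff ℝ (⊤ : ℕ∞) χ := by
    have h2 : ContDiff ℝ (⊤ : ℕ∞) (fun x : ℝ => 2 - x / T) := by fun_prop
    exact Real.smoothTransition.contDiff.comp h2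
  have hχT : ∀ x, x ≤ T → χ x = 1 := fun x hx => by
    apply Real.smoothTransition.one_of_one_le
    have : x / T ≤ 1 := by rw [div_le_one hT0]; exact hx
    linarith
  have hchi_end : ∀ x, 2 * T ≤ x → χ x = 0 := fun x hx => by
    apply Real.smoothTransition.zero_of_nonpos
    have : 2 ≤ x / T := by rw [le_div_iff₀ hT0]; exact hx
    linarith
  set k1 : ℝ → ℝ := fun x => g x * χ x ^ (n+2) + S x * ((n+2) * χ x ^ (n+1) * χ1 x) with hk1
  set k2 : ℝ → ℝ := fun x => (g1 x * χ x ^ (n+2) + g x * ((n+2) * χ x ^ (n+1) * χ1 x)) +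
    (g x * ((n+2) * χ x ^ (n+1) * χ1 x) + S x * ((n+2) * ((n+1) * χ x ^ n * χ1 x) * χ1 x
      + (n+2) * χ x ^ (n+1) * χ2 x)) with hk2
  have hpow2 : ∀ x, HasDerivAt (fun x => χ x ^ (n+2)) ((n+2) * χ x ^ (n+1) * χ1 x) x := fun x => by
    refine ((hd1 x).pow (n+2)).congr_deriv ?_
    push_cast; simp
  have hpow1 : ∀ x, HasDerivAt (fun x => χ x ^ (n+1)) ((n+1) * χ x ^ n * χ1 x) x := fun x => by
    refine ((hd1 x).pow (n+1)).congr_deriv ?_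
    push_cast; simp
  have hkd : ∀ x, HasDerivAt (fun x => S x * χ x ^ (n+2)) (k1 x) x := fun x =>
    (hSd x).mul (hpow2 x)
  have hkd2 : ∀ x, HasDerivAt k1 (k2 x) x := fun x =>
    ((hgd x).mul (hpow2 x)).add ((hSd x).mul (((hpow1 x).const_mul ((n:ℝ)+2)).mul (hd2 x)))
  refine ⟨fun x => S x * χ x ^ (n+2), k1, k2, hS.mul (hχs.pow _), hkd, hkd2,
    fun x => mul_nonneg (hS0 x) (pow_nonneg (hχ0 x) _), ?_, ?_, ?_, ?_⟩
  · intro x hx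
    constructor
    · by_contra h
      exact hx (by simp [(hz x (not_le.1 h).le).1])
    · by_contra h
      exact hx (by simp [hchi_end x (not_le.1 h).le])
  · intro x h1 h2
    simp only [hχT x h2, one_pow, mul_one]
    exact hSm h1
  · intro x
    simp only
    rcases le_total x 0 with h | h
    · simp [(hz x h).1, hT0.le]
    rcases le_total (2 * T) x with h' | h'
    · simp [hchi_end x h', hT0.le]
    · have := mul_le_mul_of_nonneg_left (pow_le_one₀ (n := n+2) (hχ0 x) (hχle x)) (hS0 x)
      linarith [hSx x h]
  · intro x
    simp only
    have hid : k2 x + 2 * D * k1 x = (g1 x + 2 * D * g x) * χ x ^ (n+2) +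
        (2 * g x + 2 * D * S x) * ((n+2) * χ x ^ (n+1)) * χ1 x +
        S x * ((n+2) * (n+1) * χ x ^ n) * χ1 x ^ 2 + S x * ((n+2) * χ x ^ (n+1)) * χ2 x := by
      simp only [hk1, hk2]; ring
    have hA : 0 ≤ (g1 x + 2 * D * g x) * χ x ^ (n+2) := mul_nonneg (hg1 x) (pow_nonneg (hχ0 x) _)
    have hC : 0 ≤ S x * ((n+2) * (n+1) * χ x ^ n) * χ1 x ^ 2 := by
      have := hS0 x; have := hχ0 x; positivity
    have hR : 0 ≤ ((n:ℝ) + 2) * (5 * B + 1) / S 1 ^ (1/p) / T * (S x * χ x ^ (n+2)) ^ (1/p) := by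
      have := hS0 x; have := hχ0 x; positivity
    rcases lt_or_ge x T with hx | hx
    · have : 1 < 2 - x / T := by
        have : x / T < 1 := by rw [div_lt_one hT0]; exact hx
        linarith
      have e1 : χ1 x = 0 := by simp [hχ1, (hsz _ this).1]
      have e2 : χ2 x = 0 := by simp [hχ2, (hsz _ this).2]
      rw [e1, e2] at hid
      linarith
    · have hx0 : 0 ≤ x := by linarith
      have hb1 : -(B / T) ≤ χ1 x := by
        simp only [hχ1]; apply neg_le_neg
        gcongr; exact hs1B _
      have hb2 : -(B / T ^ 2) ≤ χ2 x := by
        simp only [hχ2]; rw [← neg_div]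
        gcongr; exact neg_le_of_abs_le (hs2B _)
      have hpw : χ x ^ (n+1) ≤ χ x ^ n := pow_le_pow_of_le_one (hχ0 x) (hχle x) (by omega)
      have hpn : 0 ≤ χ x ^ n := pow_nonneg (hχ0 x) _
      have hpn1 : 0 ≤ χ x ^ (n+1) := pow_nonneg (hχ0 x) _
      have hBT : 0 ≤ B / T := by positivity
      have t2 : -(3 * (n+2) * χ x ^ n * (B / T)) ≤
          (2 * g x + 2 * D * S x) * ((n+2) * χ x ^ (n+1)) * χ1 x := by
        have h3 : 2 * g x + 2 * D * S x ≤ 3 := by linarith [hDS x hx0, (hg x hx0).2]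
        have h30 : 0 ≤ 2 * g x + 2 * D * S x := by
          have := (hg x hx0).1; have := hS0 x; positivity
        have : (2 * g x + 2 * D * S x) * ((n+2) * χ x ^ (n+1)) ≤ 3 * (((n:ℝ)+2) * χ x ^ n) := by
          gcongr
        have h4 : (2 * g x + 2 * D * S x) * ((n+2) * χ x ^ (n+1)) * (-(B/T)) ≤
          (2 * g x + 2 * D * S x) * ((n+2) * χ x ^ (n+1)) * χ1 x :=
          mul_le_mul_of_nonneg_left hb1 (by positivity)
        have h5 := mul_le_mul_of_nonneg_right this hBT
        linarith
      have t4 : -(2 * (n+2) * χ x ^ n * (B / T)) ≤ S x * ((n+2) * χ x ^ (n+1)) * χ2 x := by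
        rcases le_total (2 * T) x with h' | h'
        · rw [hchi_end x h', zero_pow (by omega), zero_pow (by omega)]; simp
        · have h3 : S x ≤ 2 * T := (hSx x hx0).trans h'
          have h30 := hS0 x
          have : S x * ((n+2) * χ x ^ (n+1)) ≤ (2 * T) * (((n:ℝ)+2) * χ x ^ n) := by
            gcongr
          have h4 : S x * ((n+2) * χ x ^ (n+1)) * (-(B/T^2)) ≤
            S x * ((n+2) * χ x ^ (n+1)) * χ2 x :=
            mul_le_mul_of_nonneg_left hb2 (by positivity)
          have h5 := mul_le_mul_of_nonneg_right this (show 0 ≤ B / T^2 by positivity)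
          have e : (2 * T) * (((n:ℝ)+2) * χ x ^ n) * (B / T^2) = 2 * (n+2) * χ x ^ n * (B / T) := by
            field_simp
          linarith
      have hkey : χ x ^ n * S 1 ^ (1/p) ≤ (S x * χ x ^ (n+2)) ^ (1/p) := by
        rw [Real.mul_rpow (hS0 x) (pow_nonneg (hχ0 x) _), mul_comm]
        have hpp : 0 ≤ 1 / p := by positivity
        have h1 : S 1 ^ (1/p) ≤ S x ^ (1/p) :=
          Real.rpow_le_rpow hS1.le (hSm (hT.trans hx)) hpp
        have h2 : χ x ^ n ≤ (χ x ^ (n+2)) ^ (1/p) := by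
          rcases (hχ0 x).eq_or_lt with h | h
          · rw [← h, zero_pow (by omega)]; positivity
          · rw [← Real.rpow_natCast, ← Real.rpow_natCast, ← Real.rpow_mul (hχ0 x)]
            apply Real.rpow_le_rpow_of_exponent_ge h (hχle x)
            push_cast
            rw [mul_one_div, div_le_iff₀ (by linarith)]; exact hn2
        exact mul_le_mul h1 h2 hpn (Real.rpow_nonneg (hS0 x) _)
      have hfin : (n+2) * χ x ^ n * (5 * B / T) ≤
          ((n:ℝ) + 2) * (5 * B + 1) / S 1 ^ (1/p) / T * (S x * χ x ^ (n+2)) ^ (1/p) := by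
        calc (n+2) * χ x ^ n * (5 * B / T) ≤ ((n:ℝ)+2) * χ x ^ n * ((5 * B + 1) / T) := by
              gcongr; linarith
          _ = ((n:ℝ) + 2) * (5 * B + 1) / S 1 ^ (1/p) / T * (χ x ^ n * S 1 ^ (1/p)) := by
              field_simp
          _ ≤ _ := by gcongr
      have e5 : (n+2) * χ x ^ n * (5 * B / T) = 3 * (n+2) * χ x ^ n * (B / T) + 2 * (n+2) * χ x ^ n * (B / T) := by ring
      linarith
end oneD

section mp
variable {N : ℕ}

def Xf (D t1 : ℝ) (k : ℝ → ℝ) (Ψ : Euc N → ℝ) (x : Euc N) : ℝ :=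
  (Real.exp (D * (-Real.log ‖x‖)) * k (-Real.log ‖x‖ - t1)) * Ψ x

lemma Xf_smooth {D t1 γ M ε : ℝ} {k : ℝ → ℝ} {K : Set (Euc N)} {Ψ : Euc N → ℝ}
    (hk : ContDiff ℝ (⊤ : ℕ∞) k)
    (hΨ : SubSol γ M ε K Ψ) {x : Euc N} (hx : x ≠ 0) :
    ContDiffAt ℝ (⊤ : ℕ∞) (Xf D t1 k Ψ) x := by
  have hl : ContDiffAt ℝ (⊤ : ℕ∞) (fun y : Euc N => -Real.log ‖y‖) x :=
    (((contDiffAt_norm ℝ hx).log (norm_ne_zero_iff.2 hx))).neg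
  refine ContDiffAt.mul (ContDiffAt.mul ?_ ?_) (hΨ.smooth x hx)
  · exact (contDiffAt_const.mul hl).exp
  · exact hk.contDiffAt.comp x (hl.sub contDiffAt_const)

lemma Xf_lap {D t1 γ M ε : ℝ} {k k1 k2 : ℝ → ℝ} {K : Set (Euc N)} {Ψ : Euc N → ℝ}
    (hγ : 2 * γ = N - 2)
    (hk : ContDiff ℝ (⊤ : ℕ∞) k)
    (hk1 : ∀ x, HasDerivAt k (k1 x) x) (hk2 : ∀ x, HasDerivAt k1 (k2 x) x)
    (hΨ : SubSol γ M ε K Ψ) {x : Euc N} (hx : x ≠ 0) :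
    lap (Xf D t1 k Ψ) x = (‖x‖ ^ 2)⁻¹ * (Real.exp (D * (-Real.log ‖x‖)) *
      (k2 (-Real.log ‖x‖ - t1) + 2 * D * k1 (-Real.log ‖x‖ - t1)
        + D ^ 2 * k (-Real.log ‖x‖ - t1))) * Ψ x
      + Real.exp (D * (-Real.log ‖x‖)) * k (-Real.log ‖x‖ - t1) * lap Ψ x := by
  have hx2 : 0 < ‖x‖ ^ 2 := by have := norm_pos_iff.2 hx; positivity
  set G : ℝ → ℝ := fun t => Real.exp (D * t) * k (t - t1) with hG
  set G1 : ℝ → ℝ := fun t => Real.exp (D * t) * (D * k (t - t1) + k1 (t - t1)) with hG1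
  set G2 : ℝ → ℝ := fun t => Real.exp (D * t) * (k2 (t - t1) + 2 * D * k1 (t-t1) + D ^ 2 * k (t - t1)) with hG2
  have he : ∀ t, HasDerivAt (fun t => Real.exp (D * t)) (D * Real.exp (D * t)) t := fun t => by
    refine (((hasDerivAt_id t).const_mul D).exp).congr_deriv ?_
    simp; ring
  have hsh : ∀ t, HasDerivAt (fun t => t - t1) 1 t := fun t => (hasDerivAt_id t).sub_const t1
  have hkk : ∀ t, HasDerivAt (fun t => k (t - t1)) (k1 (t - t1)) t := fun t => by
    refine ((hk1 (t - t1)).comp t (hsh t)).congr_deriv (by ring)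
  have hkk1 : ∀ t, HasDerivAt (fun t => k1 (t - t1)) (k2 (t - t1)) t := fun t => by
    refine ((hk2 (t - t1)).comp t (hsh t)).congr_deriv (by ring)
  have hGd : ∀ t, HasDerivAt G (G1 t) t := fun t => by
    refine ((he t).mul (hkk t)).congr_deriv ?_
    simp only [hG1]; ring
  have hG1d : ∀ t, HasDerivAt G1 (G2 t) t := fun t => by
    refine ((he t).mul (((hkk t).const_mul D).add (hkk1 t))).congr_deriv ?_
    simp only [hG2]; simp only [Pi.add_apply]; ring
  set F : ℝ → ℝ := fun s => G (-(Real.log s / 2)) with hF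
  set F1 : ℝ → ℝ := fun s => G1 (-(Real.log s / 2)) * (-(s⁻¹ / 2)) with hF1
  have hl : ∀ s, s ≠ 0 → HasDerivAt (fun s => -(Real.log s / 2)) (-(s⁻¹ / 2)) s := fun s hs =>
    ((Real.hasDerivAt_log hs).div_const 2).neg
  have hFd : ∀ s, s ≠ 0 → HasDerivAt F (F1 s) s := fun s hs =>
    (hGd _).comp s (hl s hs)
  set s0 := ‖x‖ ^ 2 with hs0
  have hF1d : HasDerivAt F1 (G2 (-(Real.log s0 / 2)) * (-(s0⁻¹ / 2)) * (-(s0⁻¹ / 2)) +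
      G1 (-(Real.log s0 / 2)) * (-(-(s0 ^ 2)⁻¹ / 2))) s0 := by
    have h1 := (hG1d _).comp s0 (hl s0 hx2.ne')
    have h2 := ((hasDerivAt_inv hx2.ne').div_const 2).neg
    exact h1.mul h2
  have hev : ∀ᶠ s in 𝓝 (‖x‖ ^ 2), HasDerivAt F (F1 s) s := by
    filter_upwards [isOpen_Ioi.mem_nhds hx2] with s hs
    exact hFd s (ne_of_gt hs)
  have hlog : ∀ y : Euc N, -(Real.log (‖y‖ ^ 2) / 2) = -Real.log ‖y‖ := fun y => by
    rw [Real.log_pow]; push_cast; ring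
  have hXe : Xf D t1 k Ψ = fun y => F (‖y‖ ^ 2) * Ψ y := by
    funext y
    simp only [Xf, hF, hG, hlog]
  have hsm := (hΨ.smooth x hx).of_le two_le_smooth
  have heul := euler_of_homog (γ := γ) (hsm.differentiableAt (by norm_num))
    (fun l hl => hΨ.hom l hl x)
  have hXs := (Xf_smooth (D := D) (t1 := t1) hk hΨ hx).of_le two_le_smooth
  rw [hXe] at hXs
  rw [hXe, lap_radial_mul hev hF1d hsm hXs, heul]
  simp only [hF1, hF, hs0, hlog]
  have e1 : (‖x‖^2)⁻¹ * ‖x‖^2 = 1 := inv_mul_cancel₀ hx2.ne'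
  have hNN : (N:ℝ) = 2 * γ + 2 := by linarith
  rw [hNN]
  simp only [hG, hG2]
  have hxn : ‖x‖ ≠ 0 := norm_ne_zero_iff.2 hx
  field_simp
  ring

lemma Xf_ineq {D t1 γ M ε c μ Ck T p : ℝ} {k k1 k2 : ℝ → ℝ} {K : Set (Euc N)} {Ψ : Euc N → ℝ}
    (hγ : 2 * γ = N - 2) (hD : D ^ 2 = μ - c) (hT : 1 ≤ T)
    (hM2 : M ≤ μ + 1 / (2 * T ^ 2)) (hp : 1 < p)
    (hk : ContDiff ℝ (⊤ : ℕ∞) k)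
    (hk1 : ∀ x, HasDerivAt k (k1 x) x) (hk2 : ∀ x, HasDerivAt k1 (k2 x) x)
    (hk0 : ∀ x, 0 ≤ k x) (hkT : ∀ x, k x ≤ 2 * T)
    (hkin : ∀ x, - k2 x - 2 * D * k1 x ≤ Ck / T * k x ^ (1 / p))
    (hΨ : SubSol γ M ε K Ψ) {x : Euc N} (hx : x ≠ 0) :
    -lap (Xf D t1 k Ψ) x - c * ‖x‖ ^ (-2 : ℝ) * Xf D t1 k Ψ x ≤
      (‖x‖ ^ 2)⁻¹ * Ψ x * Real.exp (D * (-Real.log ‖x‖)) *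
        ((Ck + 1) / T * k (-Real.log ‖x‖ - t1) ^ (1 / p)) +
      ε * (Real.exp (D * (-Real.log ‖x‖)) * k (-Real.log ‖x‖ - t1) * ‖x‖ ^ (-γ - 2)) := by
  rw [Xf_lap hγ hk hk1 hk2 hΨ hx, rpow_neg_two]
  unfold Xf
  set E := Real.exp (D * (-Real.log ‖x‖)) with hE
  set τ := -Real.log ‖x‖ - t1
  set w := (‖x‖ ^ 2)⁻¹ with hw
  have hE0 : 0 < E := Real.exp_pos _
  have hw0 : 0 ≤ w := by positivity
  have hΨ0 := hΨ.nonneg x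
  have hkt := hk0 τ
  have h1 := mul_le_mul_of_nonneg_left (hΨ.ineq x hx) (mul_nonneg hE0.le hkt)
  have h2 : (M - μ) * k τ ≤ 1 / T * k τ ^ (1 / p) := by
    rcases hkt.eq_or_lt with h | h
    · rw [← h]; simp
      have : 0 ≤ (0:ℝ) ^ p⁻¹ := by positivity
      positivity
    · have e : k τ = k τ ^ (1/p) * k τ ^ (1 - 1/p) := by
        rw [← Real.rpow_add h]; simp
      have hip : 1 / p ≤ 1 := by rw [div_le_one (by linarith)]; exact hp.le
      have hip0 : 0 ≤ 1 / p := by positivity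
      have h3 : k τ ^ (1 - 1/p) ≤ 2 * T := by
        calc k τ ^ (1 - 1/p) ≤ (2 * T) ^ (1 - 1/p) :=
              Real.rpow_le_rpow hkt (hkT τ) (by linarith)
          _ ≤ (2 * T) ^ (1:ℝ) := Real.rpow_le_rpow_of_exponent_le (by linarith) (by linarith)
          _ = 2 * T := Real.rpow_one _
      have hq : 0 ≤ k τ ^ (1/p) := Real.rpow_nonneg hkt _
      calc (M - μ) * k τ = (M - μ) * (k τ ^ (1/p) * k τ ^ (1 - 1/p)) := by rw [← e]
        _ ≤ (1 / (2 * T ^ 2)) * (k τ ^ (1/p) * (2 * T)) := by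
            gcongr
            linarith
        _ = 1 / T * k τ ^ (1 / p) := by field_simp
  have h3 : - k2 τ - 2 * D * k1 τ + (M - μ) * k τ ≤ (Ck + 1) / T * k τ ^ (1 / p) := by
    have := hkin τ
    have e : (Ck + 1) / T * k τ ^ (1 / p) = Ck / T * k τ ^ (1 / p) + 1 / T * k τ ^ (1 / p) := by ring
    linarith
  have h4 := mul_le_mul_of_nonneg_left h3 (show 0 ≤ w * Ψ x * E by positivity)
  have hD' : M - c - D ^ 2 = M - μ := by rw [hD]; ring
  have e5 : w * Ψ x * E * (- k2 τ - 2 * D * k1 τ + (M - μ) * k τ) =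
    - (w * (E * (k2 τ + 2 * D * k1 τ + D ^ 2 * k τ)) * Ψ x) - c * w * (E * k τ * Ψ x)
      + E * k τ * (M * (w * Ψ x)) := by rw [← hD']; ring
  linarith

def K3 (K : Set (Euc N)) (a b : ℝ) : Set (Euc N) :=
  (fun q : Euc N × ℝ => (q.2 / ‖q.1‖) • q.1) '' (K ×ˢ Set.Icc a b)

lemma K3_compact {K : Set (Euc N)} (hK : IsCompact K) (h0 : (0 : Euc N) ∉ K) (a b : ℝ) :
    IsCompact (K3 K a b) := by
  apply (hK.prod isCompact_Icc).image_of_continuousOn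
  have h : ContinuousOn (fun q : Euc N × ℝ => q.2 / ‖q.1‖) (K ×ˢ Set.Icc a b) := by
    refine ContinuousOn.div continuousOn_snd continuousOn_fst.norm ?_
    rintro ⟨y, l⟩ ⟨hy, -⟩
    exact norm_ne_zero_iff.2 (fun h => h0 (h ▸ hy))
  exact h.smul continuousOn_fst

lemma K3_norm {K : Set (Euc N)} (h0 : (0 : Euc N) ∉ K) {a b : ℝ} (ha : 0 < a) {x : Euc N}
    (hx : x ∈ K3 K a b) : a ≤ ‖x‖ ∧ ‖x‖ ≤ b ∧ ∃ s : ℝ, 0 < s ∧ ∃ y ∈ K, x = s • y := by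
  obtain ⟨⟨y, l⟩, ⟨hy, hl⟩, rfl⟩ := hx
  have hyn : 0 < ‖y‖ := norm_pos_iff.2 (fun h => h0 (h ▸ hy))
  have hl0 : 0 < l := ha.trans_le hl.1
  have : ‖(l / ‖y‖) • y‖ = l := by
    rw [norm_smul, Real.norm_of_nonneg (by positivity)]; field_simp
  simp only [this]
  exact ⟨hl.1, hl.2, l / ‖y‖, by positivity, y, hy, rfl⟩

lemma mem_K3 {K : Set (Euc N)} {a b : ℝ} {x : Euc N} (hx : x ≠ 0) (h1 : a ≤ ‖x‖) (h2 : ‖x‖ ≤ b)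
    {s : ℝ} (hs : 0 < s) (hK : s • x ∈ K) : x ∈ K3 K a b := by
  refine ⟨(s • x, ‖x‖), ⟨hK, h1, h2⟩, ?_⟩
  have hxn : ‖x‖ ≠ 0 := norm_ne_zero_iff.2 hx
  simp only
  rw [norm_smul, Real.norm_of_nonneg hs.le, smul_smul]
  have : ‖x‖ / (s * ‖x‖) * s = 1 := by field_simp
  rw [this, one_smul]

lemma log_range {t1 T : ℝ} {x : Euc N} (hx : x ≠ 0) (h : 0 ≤ -Real.log ‖x‖ - t1)
    (h2 : -Real.log ‖x‖ - t1 ≤ 2 * T) :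
    Real.exp (-t1 - 2 * T) ≤ ‖x‖ ∧ ‖x‖ ≤ Real.exp (-t1) := by
  have hn := norm_pos_iff.2 hx
  rw [← Real.le_log_iff_exp_le hn, ← Real.log_le_iff_le_exp hn]
  constructor <;> linarith

lemma Xf_supp {D t1 γ M ε T : ℝ} {k : ℝ → ℝ} {K : Set (Euc N)} {Ψ : Euc N → ℝ}
    (h0 : (0 : Euc N) ∉ K)
    (hks : ∀ x, k x ≠ 0 → 0 ≤ x ∧ x ≤ 2 * T)
    (hΨ : SubSol γ M ε K Ψ) {x : Euc N} (hx : Xf D t1 k Ψ x ≠ 0) :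
    x ∈ K3 K (Real.exp (-t1 - 2 * T)) (Real.exp (-t1)) := by
  unfold Xf at hx
  have h1 : Ψ x ≠ 0 := fun h => hx (by rw [h]; simp)
  have h2 : k (-Real.log ‖x‖ - t1) ≠ 0 := fun h => hx (by rw [h]; simp)
  obtain ⟨s, hs, hsK⟩ := hΨ.supp x h1
  have hx0 : x ≠ 0 := fun h => h0 (by rw [h] at hsK; simpa using hsK)
  obtain ⟨ha, hb⟩ := log_range hx0 (hks _ h2).1 (hks _ h2).2
  exact mem_K3 hx0 ha hb hs hsK

lemma Xf_test {D t1 γ M ε T R : ℝ} {k : ℝ → ℝ} {S K : Set (Euc N)} {Ψ : Euc N → ℝ}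
    (h0 : (0 : Euc N) ∉ K) (hK : IsCompact K) (hKC : K ⊆ sphCone S) (hR : Real.exp (-t1) < R)
    (hk : ContDiff ℝ (⊤ : ℕ∞) k)
    (hks : ∀ x, k x ≠ 0 → 0 ≤ x ∧ x ≤ 2 * T)
    (hΨ : SubSol γ M ε K Ψ) :
    K3 K (Real.exp (-t1 - 2 * T)) (Real.exp (-t1)) ⊆ coneLike S R ∧
    tsupport (Xf D t1 k Ψ) ⊆ K3 K (Real.exp (-t1 - 2 * T)) (Real.exp (-t1)) ∧
    IsTestFun (coneLike S R) (Xf D t1 k Ψ) := by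
  have hKK := K3_compact hK h0 (Real.exp (-t1 - 2 * T)) (Real.exp (-t1))
  have hsub : K3 K (Real.exp (-t1 - 2 * T)) (Real.exp (-t1)) ⊆ coneLike S R := by
    intro x hx
    obtain ⟨-, h2, s, hs, y, hy, rfl⟩ := K3_norm h0 (Real.exp_pos _) hx
    refine ⟨sphCone_smul hs (hKC hy), ?_⟩
    rw [mem_ball_zero_iff]; linarith
  have hts : tsupport (Xf D t1 k Ψ) ⊆ K3 K (Real.exp (-t1 - 2 * T)) (Real.exp (-t1)) :=
    closure_minimal (fun x hx => Xf_supp h0 hks hΨ hx) hKK.isClosed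
  refine ⟨hsub, hts, ?_, hKK.of_isClosed_subset (isClosed_tsupport _) hts, hts.trans hsub⟩
  apply contDiff_of_tsupp
  intro x hx
  apply Xf_smooth hk hΨ
  have := (K3_norm h0 (Real.exp_pos _) (hts hx)).1
  have h3 := Real.exp_pos (-t1 - 2 * T)
  exact norm_pos_iff.1 (by linarith)

end mp

section mp2
variable {N : ℕ}

lemma young_pt {U κ Ψ r γ D h p q θ n R0 : ℝ} (hr : 0 < r) (hU : 0 ≤ U) (hκ : 0 ≤ κ) (hΨ : 0 ≤ Ψ)
    (hΨ2 : Ψ ≤ r ^ (-γ)) (hh : 0 ≤ h) (hpq : p.HolderConjugate q) (hrR : r ≤ R0) (hθ : 0 ≤ θ)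
    (hθe : θ = n - γ - D - 2 * q) :
    U * ((r ^ 2)⁻¹ * Ψ * Real.exp (D * (-Real.log r)) * (h * κ ^ (1 / p))) ≤
      1 / p * (U ^ p * (Real.exp (D * (-Real.log r)) * κ * Ψ)) + R0 ^ θ * h ^ q * r ^ (-n) := by
  have hE : Real.exp (D * (-Real.log r)) = r ^ (-D) := by
    rw [Real.rpow_def_of_pos hr]; ring_nf
  have hp := hpq.pos
  have hq := hpq.symm.pos
  have hq1 := hpq.symm.lt
  have hκp : 0 ≤ κ ^ (1/p) := Real.rpow_nonneg hκ _
  have hy := Real.young_inequality_of_nonneg (mul_nonneg hU hκp)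
    (show 0 ≤ (r^2)⁻¹ * h by positivity) hpq
  have e1 : (U * κ ^ (1/p)) ^ p = U ^ p * κ := by
    rw [Real.mul_rpow hU hκp, ← Real.rpow_mul hκ]
    field_simp; simp
  have e2 : ((r^2)⁻¹ * h) ^ q = r ^ (-2 * q) * h ^ q := by
    rw [Real.mul_rpow (by positivity) hh]
    congr 1
    rw [← Real.rpow_natCast, ← Real.rpow_neg hr.le, ← Real.rpow_mul hr.le]; norm_num
  rw [e1, e2] at hy
  have hb0 : 0 ≤ r ^ (-2*q) * h ^ q := by positivity
  have hy2 : r ^ (-2 * q) * h ^ q / q ≤ r ^ (-2 * q) * h ^ q := div_le_self hb0 hq1.le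
  rw [hE]
  have hrD : 0 < r ^ (-D) := Real.rpow_pos_of_pos hr _
  have h3 := mul_le_mul_of_nonneg_left (hy.trans (add_le_add le_rfl hy2)) (mul_nonneg hΨ hrD.le)
  have h4 : Ψ * r ^ (-D) * (r ^ (-2 * q) * h ^ q) ≤ R0 ^ θ * h ^ q * r ^ (-n) := by
    calc Ψ * r ^ (-D) * (r ^ (-2 * q) * h ^ q) ≤ r ^ (-γ) * r ^ (-D) * (r ^ (-2 * q) * h ^ q) := by
          gcongr
      _ = (r ^ (-γ) * r ^ (-D) * r ^ (-2 * q)) * h ^ q := by ring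
      _ = (r ^ θ * r ^ (-n)) * h ^ q := by
          rw [← Real.rpow_add hr, ← Real.rpow_add hr, ← Real.rpow_add hr]
          congr 2; rw [hθe]; ring
      _ = r ^ θ * h ^ q * r ^ (-n) := by ring
      _ ≤ _ := by gcongr
  calc _ = Ψ * r ^ (-D) * (U * κ ^ (1/p) * ((r^2)⁻¹ * h)) := by ring
    _ ≤ _ := h3
    _ = 1 / p * (U ^ p * (r ^ (-D) * κ * Ψ)) + Ψ * r ^ (-D) * (r ^ (-2 * q) * h ^ q) := by ring
    _ ≤ _ := by linarith

lemma shell_integral [NeZero N] : ∃ V, 0 ≤ V ∧ ∀ a b : ℝ, 0 < a → a ≤ b →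
    IntegrableOn (fun x : Euc N => ‖x‖ ^ (-(N:ℝ))) {x | a ≤ ‖x‖ ∧ ‖x‖ ≤ b} volume ∧
    ∫ x in {x : Euc N | a ≤ ‖x‖ ∧ ‖x‖ ≤ b}, ‖x‖ ^ (-(N:ℝ)) = V * Real.log (b / a) := by
  have : Nontrivial (Euc N) := by
    have : Nonempty (Fin N) := ⟨0⟩
    infer_instance
  refine ⟨N * (volume : Measure (Euc N)).real (ball 0 1), by positivity, fun a b ha hab => ?_⟩
  have hcl : IsClosed {x : Euc N | a ≤ ‖x‖ ∧ ‖x‖ ≤ b} :=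
    (isClosed_le continuous_const continuous_norm).inter
      (isClosed_le continuous_norm continuous_const)
  have hcp : IsCompact {x : Euc N | a ≤ ‖x‖ ∧ ‖x‖ ≤ b} :=
    (isCompact_closedBall (0 : Euc N) b).of_isClosed_subset hcl (fun x hx => by simpa using hx.2)
  constructor
  · refine ContinuousOn.integrableOn_compact hcp ?_
    apply ContinuousOn.rpow_const continuous_norm.continuousOn
    intro x hx
    left; have := hx.1; linarith
  · rw [← integral_indicator hcl.measurableSet]
    have e : (Set.indicator {x : Euc N | a ≤ ‖x‖ ∧ ‖x‖ ≤ b} fun x => ‖x‖ ^ (-(N:ℝ))) =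
        fun x => (Set.indicator (Set.Icc a b) (fun y : ℝ => y ^ (-(N:ℝ)))) ‖x‖ := by
      funext x
      by_cases h : a ≤ ‖x‖ ∧ ‖x‖ ≤ b
      · rw [Set.indicator_of_mem (by exact h), Set.indicator_of_mem (by exact h)]
      · rw [Set.indicator_of_notMem (by exact h), Set.indicator_of_notMem (by exact h)]
    rw [e, integral_fun_norm_addHaar]
    have e2 : ∫ y in Set.Ioi (0:ℝ), y ^ (Module.finrank ℝ (Euc N) - 1) •
        (Set.indicator (Set.Icc a b) (fun y : ℝ => y ^ (-(N:ℝ)))) y = Real.log (b / a) := by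
      rw [← integral_inv_of_pos ha (ha.trans_le hab), intervalIntegral.integral_of_le hab,
        ← integral_Icc_eq_integral_Ioc]
      have : ∀ y : ℝ, y ^ (Module.finrank ℝ (Euc N) - 1) •
        (Set.indicator (Set.Icc a b) (fun y : ℝ => y ^ (-(N:ℝ)))) y =
        (Set.indicator (Set.Icc a b) (fun y : ℝ => y⁻¹)) y := by
        intro y
        by_cases h : y ∈ Set.Icc a b
        · rw [Set.indicator_of_mem h, Set.indicator_of_mem h, finrank_euclideanSpace_fin, smul_eq_mul]
          have hy : 0 < y := ha.trans_le h.1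
          have hN : 1 ≤ N := NeZero.one_le
          rw [← Real.rpow_natCast, ← Real.rpow_add hy, ← Real.rpow_neg_one]
          congr 1; push_cast [hN]; ring
        · rw [Set.indicator_of_notMem h, Set.indicator_of_notMem h]; simp
      simp_rw [this]
      rw [setIntegral_indicator measurableSet_Icc]
      congr 2
      ext y; constructor
      · exact fun h => h.2
      · exact fun h => ⟨ha.trans_le h.1, h⟩
    rw [e2]
    simp [mul_assoc]

end mp2

section mp3
variable {N : ℕ}

lemma mp_est {S : Set (Euc N)} (hS : IsSphereDomain N S) {R c p q γ D t1 M ε μ Ck T θ V : ℝ}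
    (hpq : p.HolderConjugate q)
    (u : Euc N → ℝ)
    (hu0 : ∀ᵐ x ∂volume, x ∈ coneLike S R → 0 ≤ u x)
    (huloc : LocallyIntegrableOn u (coneLike S R) volume)
    (hup : LocallyIntegrableOn (fun x => u x ^ p) (coneLike S R) volume)
    (hsuper : ∀ φ : Euc N → ℝ, IsTestFun (coneLike S R) φ → (∀ x, 0 ≤ φ x) →
      ∫ x in coneLike S R, u x ^ p * φ x ≤
        ∫ x in coneLike S R, u x * (-(lap φ x) - c * ‖x‖ ^ (-2 : ℝ) * φ x))
    (hV : ∀ a b : ℝ, 0 < a → a ≤ b →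
      IntegrableOn (fun x : Euc N => ‖x‖ ^ (-(N:ℝ))) {x | a ≤ ‖x‖ ∧ ‖x‖ ≤ b} volume ∧
      ∫ x in {x : Euc N | a ≤ ‖x‖ ∧ ‖x‖ ≤ b}, ‖x‖ ^ (-(N:ℝ)) = V * Real.log (b / a))
    (hR : Real.exp (-t1) < R) (hCk : 0 ≤ Ck) (hε : 0 ≤ ε) (hγ0 : 0 ≤ γ) (hD0 : 0 ≤ D)
    (hγ : 2 * γ = N - 2) (hD : D ^ 2 = μ - c) (hT : 1 ≤ T)
    (hM2 : M ≤ μ + 1 / (2 * T ^ 2))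
    (hθ : 0 ≤ θ) (hθe : θ = N - γ - D - 2 * q)
    {k k1 k2 : ℝ → ℝ}
    (hk : ContDiff ℝ (⊤ : ℕ∞) k)
    (hk1 : ∀ x, HasDerivAt k (k1 x) x) (hk2 : ∀ x, HasDerivAt k1 (k2 x) x)
    (hk0 : ∀ x, 0 ≤ k x) (hkT : ∀ x, k x ≤ 2 * T)
    (hks : ∀ x, k x ≠ 0 → 0 ≤ x ∧ x ≤ 2 * T)
    (hkin : ∀ x, - k2 x - 2 * D * k1 x ≤ Ck / T * k x ^ (1 / p))
    {K : Set (Euc N)} (hK : IsCompact K) (hKC : K ⊆ sphCone S) {Ψ : Euc N → ℝ}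
    (hΨ : SubSol γ M ε K Ψ) :
    IntegrableOn (fun x => u x ^ p * Xf D t1 k Ψ x) (coneLike S R) volume ∧
    (1 - 1 / p) * ∫ x in coneLike S R, u x ^ p * Xf D t1 k Ψ x ≤
      Real.exp (-t1) ^ θ * ((Ck + 1) / T) ^ q * (V * (2 * T)) +
      ε * ((Real.exp (D * (t1 + 2 * T)) * (2 * T) * Real.exp (-t1 - 2 * T) ^ (-γ - 2)) *
        ∫ x in K3 K (Real.exp (-t1 - 2 * T)) (Real.exp (-t1)), u x) := by
  have h0 : (0 : Euc N) ∉ K := fun h => zero_notMem_sphCone hS (hKC h)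
  obtain ⟨hKΩ, hts, htest⟩ := Xf_test (D := D) h0 hK hKC hR hk hks hΨ
  set a := Real.exp (-t1 - 2 * T) with ha
  set b := Real.exp (-t1) with hb
  have ha0 : 0 < a := Real.exp_pos _
  have hK' := K3_compact hK h0 a b
  set K' := K3 K a b with hK'd
  set X := Xf D t1 k Ψ with hX
  have hΩ := (isOpen_coneLike hS R).measurableSet
  set Ω := coneLike S R with hΩd
  have hX0 : ∀ x, 0 ≤ X x := fun x =>
    mul_nonneg (mul_nonneg (Real.exp_pos _).le (hk0 _)) (hΨ.nonneg x)
  have hXc : Continuous X := htest.1.continuous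
  have hXoff : ∀ x, x ∉ K' → X x = 0 := fun x hx => by
    by_contra h; exact hx (hts (subset_tsupport _ h))
  have hlapoff : ∀ x, x ∉ K' → lap X x = 0 := fun x hx =>
    lap_zero_of_notMem (fun h => hx (hts h))
  have hKn : ∀ x ∈ K', a ≤ ‖x‖ ∧ ‖x‖ ≤ b := fun x hx =>
    ⟨(K3_norm h0 ha0 hx).1, (K3_norm h0 ha0 hx).2.1⟩
  have huK : IntegrableOn u K' volume := huloc.integrableOn_compact_subset hKΩ hK'
  have hupK : IntegrableOn (fun x => u x ^ p) K' volume := hup.integrableOn_compact_subset hKΩ hK'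
  have i1 : IntegrableOn (fun x => u x ^ p * X x) K' volume :=
    hupK.mul_continuousOn hXc.continuousOn hK'
  have i1' : IntegrableOn (fun x => u x ^ p * X x) Ω volume := by
    rw [integrableOn_iff_integrable_of_support_subset] at i1
    · exact i1.integrableOn
    · intro x hx
      by_contra h
      exact hx (by simp [hXoff x h])
  refine ⟨i1', ?_⟩
  have hlapc : Continuous (lap X) := lap_continuous (htest.1.of_le two_le_smooth)
  have hnorm0 : ∀ x ∈ K', ‖x‖ ≠ 0 := fun x hx => by
    have := (hKn x hx).1; linarith
  have i2 : IntegrableOn (fun x => u x * (-(lap X x) - c * ‖x‖ ^ (-2 : ℝ) * X x)) K' volume := by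
    refine huK.mul_continuousOn ?_ hK'
    refine hlapc.neg.continuousOn.sub (ContinuousOn.mul (continuousOn_const.mul ?_) hXc.continuousOn)
    exact continuous_norm.continuousOn.rpow_const (fun x hx => Or.inl (hnorm0 x hx))
  have e1 : ∫ x in Ω, u x ^ p * X x = ∫ x in K', u x ^ p * X x :=
    setIntegral_eq_of_subset_of_forall_sdiff_eq_zero hΩ hKΩ
      (fun x hx => by simp [hXoff x hx.2])
  have e2 : ∫ x in Ω, u x * (-(lap X x) - c * ‖x‖ ^ (-2 : ℝ) * X x) =
      ∫ x in K', u x * (-(lap X x) - c * ‖x‖ ^ (-2 : ℝ) * X x) :=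
    setIntegral_eq_of_subset_of_forall_sdiff_eq_zero hΩ hKΩ
      (fun x hx => by simp [hXoff x hx.2, hlapoff x hx.2])
  have hmain := hsuper X htest hX0
  rw [e1, e2] at hmain
  rw [e1]
  have hab : a ≤ b := by
    rw [ha, hb, Real.exp_le_exp]; linarith
  obtain ⟨hVi, hVe⟩ := hV a b ha0 hab
  have hsub : K' ⊆ {x : Euc N | a ≤ ‖x‖ ∧ ‖x‖ ≤ b} := hKn
  have i3 : IntegrableOn (fun x : Euc N => ‖x‖ ^ (-(N:ℝ))) K' volume := hVi.mono_set hsub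
  set c3 := Real.exp (D * (t1 + 2 * T)) * (2 * T) * a ^ (-γ - 2) with hc3
  have hbd : ∫ x in K', u x * (-(lap X x) - c * ‖x‖ ^ (-2 : ℝ) * X x) ≤
      ∫ x in K', (1 / p * (u x ^ p * X x) + b ^ θ * ((Ck + 1) / T) ^ q * ‖x‖ ^ (-(N:ℝ))
        + ε * c3 * u x) := by
    apply setIntegral_mono_on_ae i2
      (((i1.const_mul _).add (i3.const_mul _)).add (huK.const_mul _)) hK'.measurableSet
    filter_upwards [hu0] with x hxu hxK
    have hU := hxu (hKΩ hxK)
    have hx0 : x ≠ 0 := norm_ne_zero_iff.1 (hnorm0 x hxK)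
    have hxn := norm_pos_iff.2 hx0
    have h1 := mul_le_mul_of_nonneg_left (Xf_ineq (t1 := t1) hγ hD hT hM2 hpq.lt hk hk1 hk2 hk0 hkT hkin hΨ hx0) hU
    have h2 := young_pt (h := (Ck + 1) / T) (D := D) hxn hU (hk0 (-Real.log ‖x‖ - t1)) (hΨ.nonneg x) (hΨ.le hx0)
      (by positivity) hpq (hKn x hxK).2 hθ hθe
    have h3 : Real.exp (D * (-Real.log ‖x‖)) * k (-Real.log ‖x‖ - t1) * ‖x‖ ^ (-γ - 2) ≤ c3 := by
      rw [hc3]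
      have hl : -Real.log ‖x‖ ≤ t1 + 2 * T := by
        have := (Real.le_log_iff_exp_le hxn).2 (hKn x hxK).1
        linarith
      have hr : ‖x‖ ^ (-γ - 2) ≤ a ^ (-γ - 2) :=
        Real.rpow_le_rpow_of_nonpos ha0 (hKn x hxK).1 (by linarith)
      have := hkT (-Real.log ‖x‖ - t1)
      have := hk0 (-Real.log ‖x‖ - t1)
      gcongr
    have h4 := mul_le_mul_of_nonneg_left h3 (mul_nonneg hε hU)
    have e : X x = Real.exp (D * (-Real.log ‖x‖)) * k (-Real.log ‖x‖ - t1) * Ψ x := rfl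
    rw [← e] at h2
    rw [← hX, mul_add] at h1
    simp only [Pi.add_apply]
    linarith
  have i12 : IntegrableOn (fun x => 1 / p * (u x ^ p * X x) +
      b ^ θ * ((Ck + 1) / T) ^ q * ‖x‖ ^ (-(N:ℝ))) K' volume :=
    (i1.const_mul _).add (i3.const_mul _)
  rw [integral_add i12 (huK.const_mul _), integral_add (i1.const_mul _) (i3.const_mul _),
    integral_const_mul, integral_const_mul, integral_const_mul] at hbd
  have hshell : ∫ x in K', ‖x‖ ^ (-(N:ℝ)) ≤ V * (2 * T) := by
    have e : Real.log (b / a) = 2 * T := by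
      rw [hb, ha, ← Real.exp_sub, Real.log_exp]; ring
    rw [e] at hVe
    rw [← hVe]
    exact setIntegral_mono_set hVi (Eventually.of_forall fun x => by positivity)
      (LE.le.eventuallyLE hsub)
  have hq : 0 ≤ b ^ θ * ((Ck + 1) / T) ^ q := by positivity
  have h5 := mul_le_mul_of_nonneg_left hshell hq
  linarith

end mp3

section mp4
variable {N : ℕ}

lemma mp_small [NeZero N] {S : Set (Euc N)} (hS : IsSphereDomain N S) {R c p q γ D t1 : ℝ}
    (hpq : p.HolderConjugate q)
    (u : Euc N → ℝ)
    (hu0 : ∀ᵐ x ∂volume, x ∈ coneLike S R → 0 ≤ u x)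
    (huloc : LocallyIntegrableOn u (coneLike S R) volume)
    (hup : LocallyIntegrableOn (fun x => u x ^ p) (coneLike S R) volume)
    (hsuper : ∀ φ : Euc N → ℝ, IsTestFun (coneLike S R) φ → (∀ x, 0 ≤ φ x) →
      ∫ x in coneLike S R, u x ^ p * φ x ≤
        ∫ x in coneLike S R, u x * (-(lap φ x) - c * ‖x‖ ^ (-2 : ℝ) * φ x))
    (hR : Real.exp (-t1) < R) (hγ0 : 0 ≤ γ) (hD0 : 0 ≤ D) (hμ : 0 < hardyConst (sphCone S))
    (hγ : 2 * γ = N - 2) (hD : D ^ 2 = hardyConst (sphCone S) - c)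
    (hθ : 0 ≤ N - γ - D - 2 * q) :
    ∃ c1, 0 < c1 ∧ ∀ κ, 0 < κ → ∃ (M ε : ℝ) (K : Set (Euc N)) (Ψ X : Euc N → ℝ),
      M ≤ hardyConst (sphCone S) + 1 ∧ ε ≤ 1 ∧ K ⊆ sphCone S ∧ SubSol γ M ε K Ψ ∧
      (∀ x, 0 ≤ X x) ∧ (∀ x ∈ annu N (Real.exp (-t1 - 2)), c1 * Ψ x ≤ X x) ∧
      IntegrableOn (fun x => u x ^ p * X x) (coneLike S R) volume ∧
      ∫ x in coneLike S R, u x ^ p * X x ≤ κ := by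
  obtain ⟨Ck, c0, hCk, hc0, hkf⟩ := kfun hD0 hpq.lt
  obtain ⟨V, hV0, hV⟩ := shell_integral (N := N)
  refine ⟨c0 * Real.exp (D * (t1 + 1)), by positivity, fun κ hκ => ?_⟩
  have hp := hpq.pos
  set δ := 1 - 1 / p with hδ
  have hδ0 : 0 < δ := by
    have : 1 / p < 1 := by rw [div_lt_one hp]; exact hpq.lt
    linarith
  set θ : ℝ := N - γ - D - 2 * q with hθe
  obtain ⟨T, hT3, hTs⟩ : ∃ T : ℝ, 3 ≤ T ∧
      Real.exp (-t1) ^ θ * ((Ck + 1) / T) ^ q * (V * (2 * T)) < δ * κ / 2 := by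
    have hq1 : 0 < q - 1 := by linarith [hpq.symm.lt]
    have ht := (tendsto_rpow_neg_atTop hq1).const_mul
      (Real.exp (-t1) ^ θ * (Ck + 1) ^ q * (V * 2))
    rw [mul_zero] at ht
    have hev := ht.eventually (gt_mem_nhds (show 0 < δ * κ / 2 by positivity))
    obtain ⟨T, h1, h2⟩ := (hev.and (eventually_ge_atTop 3)).exists
    refine ⟨T, h2, ?_⟩
    have hT0 : 0 < T := by linarith
    have e : ((Ck + 1) / T) ^ q * T = (Ck + 1) ^ q * T ^ (-(q - 1)) := by
      rw [Real.div_rpow (by positivity) hT0.le, neg_sub, Real.rpow_sub hT0, Real.rpow_one]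
      ring
    calc _ = Real.exp (-t1) ^ θ * (((Ck + 1) / T) ^ q * T) * (V * 2) := by ring
      _ = Real.exp (-t1) ^ θ * (Ck + 1) ^ q * (V * 2) * T ^ (-(q-1)) := by rw [e]; ring
      _ < _ := h1
  have hT1 : 1 ≤ T := by linarith
  obtain ⟨k, k1, k2, hk, hk1, hk2, hk0, hks, hkc, hkT, hkin⟩ := hkf T hT1
  have hMl : hardyConst (sphCone S) < hardyConst (sphCone S) + 1 / (2 * T ^ 2) := by
    have : 0 < 1 / (2 * T ^ 2) := by positivity
    linarith
  obtain ⟨K, hK, hKC, hsub⟩ := sub2 (isOpen_sphCone hS) (sphCone_nonempty hS)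
    (zero_notMem_sphCone hS) hγ0 hμ hMl
  set E3 := (Real.exp (D * (t1 + 2 * T)) * (2 * T) * Real.exp (-t1 - 2 * T) ^ (-γ - 2)) *
        ∫ x in K3 K (Real.exp (-t1 - 2 * T)) (Real.exp (-t1)), u x with hE3
  set ε := min 1 (δ * κ / 2 / (|E3| + 1)) with hε
  have hE : 0 < |E3| + 1 := by positivity
  have hε0 : 0 < ε := lt_min one_pos (by positivity)
  obtain ⟨Ψ, hΨ⟩ := hsub ε hε0
  obtain ⟨hi, hest⟩ := mp_est hS hpq u hu0 huloc hup hsuper hV hR hCk.le hε0.le hγ0 hD0 hγ hD hT1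
    le_rfl hθ hθe hk hk1 hk2 hk0 hkT hks hkin hK hKC hΨ
  refine ⟨_, ε, K, Ψ, Xf D t1 k Ψ, ?_, min_le_left _ _, hKC, hΨ, ?_, ?_, hi, ?_⟩
  · have : 1 / (2 * T ^ 2) ≤ 1 := by
      rw [div_le_one (by positivity)]; nlinarith
    linarith
  · exact fun x => mul_nonneg (mul_nonneg (Real.exp_pos _).le (hk0 _)) (hΨ.nonneg x)
  · rintro x ⟨h1, h2⟩
    have hxn : 0 < ‖x‖ := by have := Real.exp_pos (-t1 - 2); linarith
    have e1 : Real.log ‖x‖ ≤ -t1 - 1 := by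
      rw [Real.log_le_iff_le_exp hxn]
      have : Real.exp (-t1 - 1) = Real.exp 1 * Real.exp (-t1 - 2) := by
        rw [← Real.exp_add]; ring_nf
      rw [this]
      have := Real.add_one_le_exp (1:ℝ)
      nlinarith [Real.exp_pos (-t1 - 2)]
    have e2 : -t1 - 3 ≤ Real.log ‖x‖ := by
      rw [Real.le_log_iff_exp_le hxn]
      have : Real.exp (-t1 - 2) = Real.exp 1 * Real.exp (-t1 - 3) := by
        rw [← Real.exp_add]; ring_nf
      rw [this] at h1
      have := Real.add_one_le_exp (1:ℝ)
      nlinarith [Real.exp_pos (-t1 - 3)]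
    have h3 := hkc (-Real.log ‖x‖ - t1) (by linarith) (by linarith)
    have h4 : Real.exp (D * (t1 + 1)) ≤ Real.exp (D * (-Real.log ‖x‖)) := by
      rw [Real.exp_le_exp]; gcongr; linarith
    unfold Xf
    rw [mul_comm c0]
    have := hΨ.nonneg x
    gcongr
  · have h5 : ε * E3 ≤ δ * κ / 2 := by
      calc ε * E3 ≤ ε * (|E3| + 1) := by
            gcongr; linarith [le_abs_self E3]
        _ ≤ δ * κ / 2 / (|E3| + 1) * (|E3| + 1) := by
            gcongr; exact min_le_right _ _
        _ = δ * κ / 2 := by field_simp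
    have h6 : δ * ∫ x in coneLike S R, u x ^ p * Xf D t1 k Ψ x ≤ δ * κ := by linarith
    exact le_of_mul_le_mul_left h6 hδ0

end mp4

section fin
variable {N : ℕ}

lemma super_weak {Ω : Set (Euc N)} (hΩ : IsOpen Ω) {c p : ℝ} (hc : 0 ≤ c) (u : Euc N → ℝ)
    (hu0 : ∀ᵐ x ∂volume, x ∈ Ω → 0 ≤ u x)
    (huloc : LocallyIntegrableOn u Ω volume)
    (hbu : LocallyIntegrableOn (fun x => c * ‖x‖ ^ (-2 : ℝ) * u x) Ω volume)
    (hsuper : ∀ φ : Euc N → ℝ, IsTestFun Ω φ → (∀ x, 0 ≤ φ x) →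
      ∫ x in Ω, u x ^ p * φ x ≤
        ∫ x in Ω, u x * (-(lap φ x) - c * ‖x‖ ^ (-2 : ℝ) * φ x))
    (φ : Euc N → ℝ) (hφ : IsTestFun Ω φ) (hφ0 : ∀ y, 0 ≤ φ y) :
    ∫ x in Ω, u x * lap φ x ≤ 0 := by
  have h := hsuper φ hφ hφ0
  have hK : IsCompact (tsupport φ) := hφ.2.1
  have hoff : ∀ x, x ∉ tsupport φ → φ x = 0 := fun x hx => image_eq_zero_of_notMem_tsupport hx
  have gen : ∀ v g : Euc N → ℝ, LocallyIntegrableOn v Ω volume → Continuous g →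
      (∀ x, x ∉ tsupport φ → g x = 0) → IntegrableOn (fun x => v x * g x) Ω volume := by
    intro v g hv hg hg0
    have i := (hv.integrableOn_compact_subset hφ.2.2 hK).mul_continuousOn hg.continuousOn hK
    rw [integrableOn_iff_integrable_of_support_subset] at i
    · exact i.integrableOn
    · intro x hx
      by_contra h
      exact hx (by simp [hg0 x h])
  have i1 := gen u (lap φ) huloc (lap_continuous (hφ.1.of_le two_le_smooth))
    (fun x hx => lap_zero_of_notMem hx)
  have i2 := gen _ φ hbu hφ.1.continuous hoff
  have e : ∫ x in Ω, u x * (-(lap φ x) - c * ‖x‖ ^ (-2 : ℝ) * φ x) =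
      - (∫ x in Ω, u x * lap φ x) - ∫ x in Ω, c * ‖x‖ ^ (-2 : ℝ) * u x * φ x := by
    have i1n : IntegrableOn (fun x => -(u x * lap φ x)) Ω volume := i1.neg
    rw [← integral_neg, ← integral_sub i1n i2]
    congr 1; funext x; ring
  have n1 : 0 ≤ ∫ x in Ω, u x ^ p * φ x := by
    apply integral_nonneg_of_ae
    rw [EventuallyLE, ae_restrict_iff' hΩ.measurableSet]
    filter_upwards [hu0] with x hx hxΩ
    exact mul_nonneg (Real.rpow_nonneg (hx hxΩ) _) (hφ0 x)
  have n2 : 0 ≤ ∫ x in Ω, c * ‖x‖ ^ (-2 : ℝ) * u x * φ x := by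
    apply integral_nonneg_of_ae
    rw [EventuallyLE, ae_restrict_iff' hΩ.measurableSet]
    filter_upwards [hu0] with x hx hxΩ
    have := hx hxΩ
    have := hφ0 x
    simp only [Pi.zero_apply]
    positivity
  linarith

lemma not_pos [NeZero N] {S : Set (Euc N)} (hS : IsSphereDomain N S) {R c p q γ D t1 : ℝ}
    (hpq : p.HolderConjugate q)
    (u : Euc N → ℝ)
    (hu0 : ∀ᵐ x ∂volume, x ∈ coneLike S R → 0 < u x)
    (huloc : LocallyIntegrableOn u (coneLike S R) volume)
    (hup : LocallyIntegrableOn (fun x => u x ^ p) (coneLike S R) volume)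
    (hsuper : ∀ φ : Euc N → ℝ, IsTestFun (coneLike S R) φ → (∀ x, 0 ≤ φ x) →
      ∫ x in coneLike S R, u x ^ p * φ x ≤
        ∫ x in coneLike S R, u x * (-(lap φ x) - c * ‖x‖ ^ (-2 : ℝ) * φ x))
    (hR : Real.exp (-t1) < R) (hγ0 : 0 ≤ γ) (hD0 : 0 ≤ D) (hμ : 0 < hardyConst (sphCone S))
    (hγ : 2 * γ = N - 2) (hD : D ^ 2 = hardyConst (sphCone S) - c)
    (hθ : 0 ≤ N - γ - D - 2 * q) : False := by
  obtain ⟨c1, hc1, hmp⟩ := mp_small hS hpq u (hu0.mono fun x h hx => (h hx).le) huloc hup hsuper hR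
    hγ0 hD0 hμ hγ hD hθ
  set r1 := Real.exp (-t1 - 2) with hr1
  have hr10 : 0 < r1 := Real.exp_pos _
  obtain ⟨c2, hc2, hL1⟩ := sup_L1 (N := N) (γ := γ) (M0 := hardyConst (sphCone S) + 1) hγ0
    (by linarith) hr10
  have hΩo := isOpen_coneLike hS R
  set Ω := coneLike S R with hΩ
  set A := annu N r1 ∩ Ω with hA
  have hAm : MeasurableSet A := (annu_closed r1).measurableSet.inter hΩo.measurableSet
  have hAfin : volume A < ∞ := (measure_mono Set.inter_subset_left).trans_lt
    (annu_compact r1).measure_lt_top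
  have hfinm : IsFiniteMeasure (volume.restrict A) := ⟨by simpa using hAfin⟩
  have hvm : AEMeasurable (fun x => u x ^ p) (volume.restrict A) :=
    (hup.aestronglyMeasurable.aemeasurable).mono_measure
      (Measure.restrict_mono Set.inter_subset_right le_rfl)
  have hpos : ∀ᵐ x ∂(volume.restrict A), 0 < u x ^ p := by
    rw [ae_restrict_iff' hAm]
    filter_upwards [hu0] with x hx hxA
    exact Real.rpow_pos_of_pos (hx hxA.2) _
  have hfm : ∀ n : ℕ, AEStronglyMeasurable (fun x => (1 + (n:ℝ) * u x ^ p)⁻¹) (volume.restrict A) :=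
    fun n => (((hvm.const_mul _).const_add 1).inv).aestronglyMeasurable
  have hfb : ∀ n : ℕ, ∀ᵐ x ∂(volume.restrict A), ‖(1 + (n:ℝ) * u x ^ p)⁻¹‖ ≤ 1 := fun n => by
    filter_upwards [hpos] with x hx
    have : 0 ≤ (n:ℝ) * u x ^ p := by positivity
    rw [Real.norm_of_nonneg (by positivity)]
    exact inv_le_one_of_one_le₀ (by linarith)
  have hfi : ∀ n : ℕ, Integrable (fun x => (1 + (n:ℝ) * u x ^ p)⁻¹) (volume.restrict A) := fun n =>
    Integrable.of_bound (hfm n) 1 (hfb n)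
  have hdom : Tendsto (fun n : ℕ => ∫ x in A, (1 + (n:ℝ) * u x ^ p)⁻¹) atTop
      (𝓝 (∫ x in A, (0:ℝ))) := by
    apply tendsto_integral_of_dominated_convergence (fun _ => 1) hfm (integrable_const 1) hfb
    filter_upwards [hpos] with x hx
    apply Tendsto.inv_tendsto_atTop
    apply tendsto_atTop_add_const_left
    exact Tendsto.atTop_mul_const hx tendsto_natCast_atTop_atTop
  set Cm := (r1 / 2) ^ (-γ) with hCm
  have hCm0 : 0 < Cm := by positivity
  have hdom2 := hdom.const_mul Cm
  simp only [integral_zero, mul_zero] at hdom2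
  obtain ⟨n, hn⟩ := (hdom2.eventually (gt_mem_nhds (show 0 < c2 / 2 by positivity))).exists
  have hκ : 0 < c1 * c2 / (4 * ((n:ℝ) + 1)) := by positivity
  obtain ⟨M, ε, K, Ψ, X, hM, hε, hKC, hΨ, hX0, hXΨ, hXi, hXκ⟩ := hmp _ hκ
  have hlow := hL1 M ε K Ψ hM hε hΨ
  have hann : ∀ x ∈ annu N r1, x ≠ 0 := fun x hx => by
    have := hx.1
    exact norm_pos_iff.1 (by linarith)
  have e1 : ∫ x in annu N r1, Ψ x = ∫ x in A, Ψ x := by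
    apply setIntegral_eq_of_subset_of_forall_sdiff_eq_zero (annu_closed r1).measurableSet
      Set.inter_subset_left
    rintro x ⟨hx, hxA⟩
    by_contra hne
    apply hxA
    refine ⟨hx, ?_, ?_⟩
    · obtain ⟨s, hs, hsK⟩ := hΨ.supp x hne
      have := sphCone_smul (inv_pos.2 hs) (hKC hsK)
      rwa [smul_smul, inv_mul_cancel₀ hs.ne', one_smul] at this
    · rw [mem_ball_zero_iff]
      have h1 := hx.2
      have e : Real.exp (-t1) = Real.exp 2 * r1 := by rw [hr1, ← Real.exp_add]; ring_nf
      have := Real.add_one_le_exp (2:ℝ)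
      nlinarith
  rw [e1] at hlow
  have iX : IntegrableOn (fun x => u x ^ p * X x) A volume := hXi.mono_set Set.inter_subset_right
  have iΨ : IntegrableOn Ψ A volume :=
    ((hΨ.continuousOn hr10).integrableOn_compact (annu_compact r1)).mono_set Set.inter_subset_left
  have hle : ∫ x in A, Ψ x ≤ ∫ x in A, (Cm * (1 + (n:ℝ) * u x ^ p)⁻¹ + n / c1 * (u x ^ p * X x)) := by
    apply integral_mono_ae iΨ (((hfi n).const_mul _).add (iX.const_mul _))
    have hmem : ∀ᵐ x ∂(volume.restrict A), x ∈ A := ae_restrict_mem hAm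
    filter_upwards [hpos, hmem] with x hx hxA
    simp only [Pi.add_apply]
    set v := u x ^ p
    have hnv : 0 ≤ (n:ℝ) * v := by positivity
    have hx0 := hann x hxA.1
    have h1 : Ψ x ≤ Cm := (hΨ.le hx0).trans
      (Real.rpow_le_rpow_of_nonpos (by positivity) hxA.1.1 (by linarith))
    have h2 : Ψ x ≤ X x / c1 := by
      rw [le_div_iff₀ hc1, mul_comm]; exact hXΨ x hxA.1
    have hΨ0 := hΨ.nonneg x
    have hI : (1 + (n:ℝ) * v)⁻¹ ≤ 1 := inv_le_one_of_one_le₀ (by linarith)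
    have hI0 : 0 < (1 + (n:ℝ) * v)⁻¹ := by positivity
    have hI1 : (1 + (n:ℝ) * v)⁻¹ * (1 + n * v) = 1 := inv_mul_cancel₀ (by positivity)
    calc Ψ x = Ψ x * (1 + (n:ℝ) * v)⁻¹ + n * v * (Ψ x * (1 + (n:ℝ) * v)⁻¹) := by
          linear_combination -(Ψ x) * hI1
      _ ≤ Cm * (1 + (n:ℝ) * v)⁻¹ + n * v * (X x / c1 * 1) := by
          have hq : 0 ≤ X x / c1 := div_nonneg (hX0 x) hc1.le
          gcongr
      _ = _ := by ring
  rw [integral_add ((hfi n).const_mul _) (iX.const_mul _), integral_const_mul,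
    integral_const_mul] at hle
  have hAΩ : ∫ x in A, u x ^ p * X x ≤ ∫ x in Ω, u x ^ p * X x := by
    apply setIntegral_mono_set hXi
    · rw [EventuallyLE, ae_restrict_iff' hΩo.measurableSet]
      filter_upwards [hu0] with x hx hxΩ
      exact mul_nonneg (Real.rpow_nonneg (hx hxΩ).le _) (hX0 x)
    · exact LE.le.eventuallyLE (Set.inter_subset_right)
  have hlast : (n:ℝ) / c1 * ∫ x in A, u x ^ p * X x ≤ c2 / 4 := by
    calc (n:ℝ) / c1 * ∫ x in A, u x ^ p * X x ≤ n / c1 * (c1 * c2 / (4 * ((n:ℝ) + 1))) := by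
          gcongr; exact hAΩ.trans hXκ
      _ = (n / (n + 1)) * (c2 / 4) := by field_simp
      _ ≤ 1 * (c2 / 4) := by
          gcongr
          rw [div_le_one (by positivity)]; linarith
      _ = c2 / 4 := one_mul _
  linarith
end fin

theorem nonexistence_coneLike {N : ℕ} (hN : 3 ≤ N) (S : Set (Euc N))
    (hS : IsSphereDomain N S) (R : ℝ) (hR : 0 < R) (c p : ℝ)
    (hc1 : hardyConst (sphCone S) - ((N : ℝ) - 2) ^ 2 / 4 < c)
    (hc2 : c ≤ hardyConst (sphCone S))
    (hp : 1 + 2 / (((N : ℝ) - 2) / 2 - Real.sqrt (hardyConst (sphCone S) - c)) ≤ p)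
    (u : Euc N → ℝ)
    (hu0 : ∀ᵐ x ∂volume, x ∈ coneLike S R → 0 ≤ u x)
    (huloc : LocallyIntegrableOn u (coneLike S R) volume)
    (hup : LocallyIntegrableOn (fun x => u x ^ p) (coneLike S R) volume)
    (hbu : LocallyIntegrableOn (fun x => c * ‖x‖ ^ (-2 : ℝ) * u x) (coneLike S R) volume)
    (hsuper : ∀ φ : Euc N → ℝ, IsTestFun (coneLike S R) φ → (∀ x, 0 ≤ φ x) →
      ∫ x in coneLike S R, u x ^ p * φ x ≤
        ∫ x in coneLike S R, u x * (-(lap φ x) - c * ‖x‖ ^ (-2 : ℝ) * φ x)) :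
    ∀ᵐ x ∂volume, x ∈ coneLike S R → u x = 0 := by
  have : NeZero N := ⟨by omega⟩
  have hN3 : (3:ℝ) ≤ N := by exact_mod_cast hN
  have hge := hardyConst_ge (isOpen_sphCone hS) (sphCone_nonempty hS) (zero_notMem_sphCone hS)
  set μ := hardyConst (sphCone S) with hμ
  set γ : ℝ := ((N:ℝ) - 2) / 2 with hγ
  set D := Real.sqrt (μ - c) with hD
  have hγ0 : 0 < γ := by rw [hγ]; linarith
  have hγ2 : γ ^ 2 = ((N:ℝ) - 2) ^ 2 / 4 := by rw [hγ]; ring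
  have hc : 0 < c := by linarith
  have hD0 : 0 ≤ D := Real.sqrt_nonneg _
  have hD2 : D ^ 2 = μ - c := Real.sq_sqrt (by linarith)
  have hDγ : D < γ := by
    rw [hD, Real.sqrt_lt' hγ0]; linarith
  have hα : 0 < γ - D := by linarith
  have h2α : 0 < 2 / (γ - D) := by positivity
  have hp1 : 1 < p := by linarith
  have hpq := Real.HolderConjugate.conjExponent hp1
  have hθ : 0 ≤ N - γ - D - 2 * p.conjExponent := by
    have e : p.conjExponent = 1 + 1 / (p - 1) := by
      unfold Real.conjExponent
      have : p - 1 ≠ 0 := by linarith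
      field_simp; ring
    have h1 : 1 / (p - 1) ≤ (γ - D) / 2 := by
      rw [div_le_iff₀ (by linarith)]
      have : 2 / (γ - D) ≤ p - 1 := by linarith
      rw [div_le_iff₀ hα] at this
      nlinarith
    rw [e]
    have : (N:ℝ) = 2 * γ + 2 := by rw [hγ]; ring
    rw [this]; linarith
  have hRe : Real.exp (-(-Real.log R + 1)) < R := by
    have : -(-Real.log R + 1) < Real.log R := by linarith
    calc _ < Real.exp (Real.log R) := Real.exp_lt_exp.2 this
      _ = R := Real.exp_log hR
  rcases smp (isOpen_coneLike hS R) (isPreconnected_coneLike hS R) huloc hu0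
    (super_weak (isOpen_coneLike hS R) hc.le u hu0 huloc hbu hsuper) with h | h
  · exact h
  · exact (not_pos hS hpq u h huloc hup hsuper hRe hγ0.le hD0 (by linarith) (by rw [hγ]; ring)
      hD2 hθ).elim
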